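/- arXiv:1411.1523 — 6 statements merged into one kernel-verified Lean document; each statement's English description precedes it below -/
import Mathlib

section
/- Let n ≥ 3 and 1 < p ≤ n/(n−2). Then the system (Sys) has no positive classical solution: there is no pair of positive C² functions u, v on ℝⁿ satisfying −Δu = √p · u^{p−1} v and −Δv = √p · u^p on ℝⁿ. -/
open MeasureTheory Real Filter

/-- The Laplacian of `u : ℝⁿ → ℝ`, as the sum of second partial derivatives. -/
noncomputable def lap {n : ℕ} (u : EuclideanSpace ℝ (Fin n) → ℝ)
    (x : EuclideanSpace ℝ (Fin n)) : ℝ :=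
  ∑ i : Fin n, iteratedFDeriv ℝ 2 u x ![EuclideanSpace.single i 1, EuclideanSpace.single i 1]

/-- `(u, v)` is a positive classical solution of the Schrödinger–Poisson type system
`-Δu = √p u^(p-1) v`, `-Δv = √p u^p` on `ℝⁿ`. -/
def IsSysSolution (n : ℕ) (p : ℝ) (u v : EuclideanSpace ℝ (Fin n) → ℝ) : Prop :=
  ContDiff ℝ 2 u ∧ ContDiff ℝ 2 v ∧ (∀ x, 0 < u x) ∧ (∀ x, 0 < v x) ∧
  (∀ x, -lap u x = Real.sqrt p * u x ^ (p - 1) * v x) ∧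
  (∀ x, -lap v x = Real.sqrt p * u x ^ p)

/-- Second-order necessary condition for a local minimum on the line. -/
theorem IsLocalMin.nonneg_of_hasDerivAt {g g' : ℝ → ℝ} {g'' a : ℝ} (h : IsLocalMin g a)
    (hg : ∀ᶠ t in nhds a, HasDerivAt g (g' t) t) (hg' : HasDerivAt g' g'' a) : 0 ≤ g'' := by
  by_contra! hneg
  have hd : deriv g =ᶠ[nhds a] g' := hg.mono fun t ht => ht.deriv
  have hdd : deriv (deriv g) a = g'' := by rw [hd.deriv_eq, hg'.deriv]
  have hmax : IsLocalMax g a :=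
    isLocalMax_of_deriv_deriv_neg (by rwa [hdd]) h.deriv_eq_zero hg.self_of_nhds.continuousAt
  have hconst : g =ᶠ[nhds a] fun _ => g a := by
    filter_upwards [h, hmax] with t h1 h2 using le_antisymm h2 h1
  have h0 : deriv g =ᶠ[nhds a] fun _ => 0 := by
    simpa using hconst.deriv
  have : deriv (deriv g) a = 0 := by simpa using h0.deriv_eq
  linarith

/-- If a radial function `F (‖·‖²)` touches `f` from below at `x` (up to a constant), then its
Laplacian at `x` is at most that of `f`. -/
theorem radial_le_lap_of_isLocalMin_sub {n : ℕ} {f : EuclideanSpace ℝ (Fin n) → ℝ}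
    {x : EuclideanSpace ℝ (Fin n)} {F F' : ℝ → ℝ} {F'' : ℝ} (hf : ContDiff ℝ 2 f)
    (hF : ∀ᶠ s in nhds (‖x‖ ^ 2), HasDerivAt F (F' s) s) (hF' : HasDerivAt F' F'' (‖x‖ ^ 2))
    (h : IsLocalMin (fun y => f y - F (‖y‖ ^ 2)) x) :
    4 * ‖x‖ ^ 2 * F'' + 2 * n * F' (‖x‖ ^ 2) ≤ lap f x := by
  have key : ∀ i : Fin n, 4 * (x i) ^ 2 * F'' + 2 * F' (‖x‖ ^ 2) ≤
      iteratedFDeriv ℝ 2 f x ![EuclideanSpace.single i 1, EuclideanSpace.single i 1] := by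
    intro i
    set e : EuclideanSpace ℝ (Fin n) := EuclideanSpace.single i 1 with he
    have hline : ∀ t : ℝ, HasDerivAt (fun t : ℝ => x + t • e) e t := fun t => by
      simpa using ((hasDerivAt_id t).smul_const e).const_add x
    have hcont : ContinuousAt (fun t : ℝ => x + t • e) 0 := (hline 0).continuousAt
    have hsq : ∀ t : ℝ, ‖x + t • e‖ ^ 2 = ‖x‖ ^ 2 + 2 * x i * t + t ^ 2 := fun t => by
      rw [norm_add_sq_real, norm_smul, inner_smul_right, he, EuclideanSpace.inner_single_right]
      simp
      ring
    have hq : ∀ t : ℝ,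
        HasDerivAt (fun t : ℝ => ‖x‖ ^ 2 + 2 * x i * t + t ^ 2) (2 * x i + 2 * t) t := fun t => by
      have h1 : HasDerivAt (fun t : ℝ => ‖x‖ ^ 2 + 2 * x i * t) (2 * x i) t := by
        simpa using ((hasDerivAt_id t).const_mul (2 * x i)).const_add (‖x‖ ^ 2)
      have h2 : HasDerivAt (fun t : ℝ => t ^ 2) (2 * t) t := by simpa using hasDerivAt_pow 2 t
      exact h1.add h2
    have hmin : IsLocalMin
        (fun t : ℝ => f (x + t • e) - F (‖x‖ ^ 2 + 2 * x i * t + t ^ 2)) 0 := by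
      have h1 : Tendsto (fun t : ℝ => x + t • e) (nhds 0) (nhds x) := by
        simpa [ContinuousAt] using hcont
      have := h1.eventually h
      filter_upwards [this] with t ht
      simpa [hsq] using ht
    have hq0 : Tendsto (fun t : ℝ => ‖x‖ ^ 2 + 2 * x i * t + t ^ 2) (nhds 0)
        (nhds (‖x‖ ^ 2)) := by
      simpa [ContinuousAt] using (hq 0).continuousAt
    have hderiv : ∀ᶠ t in nhds (0 : ℝ),
        HasDerivAt (fun t : ℝ => f (x + t • e) - F (‖x‖ ^ 2 + 2 * x i * t + t ^ 2))
          (fderiv ℝ f (x + t • e) e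
            - F' (‖x‖ ^ 2 + 2 * x i * t + t ^ 2) * (2 * x i + 2 * t)) t := by
      filter_upwards [hq0.eventually hF] with t ht
      have h1 := ((hf.differentiable (by norm_num)) (x + t • e)).hasFDerivAt.comp_hasDerivAt t
        (hline t)
      exact h1.sub (ht.comp t (hq t))
    have hf2 : DifferentiableAt ℝ (fderiv ℝ f) x :=
      (hf.fderiv_right (m := 1) (by norm_num)).differentiable (by norm_num) x
    have h2 : HasDerivAt (fun t : ℝ => fderiv ℝ f (x + t • e) e)
        (fderiv ℝ (fderiv ℝ f) x e e) 0 := by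
      have h0 : HasFDerivAt (fderiv ℝ f) (fderiv ℝ (fderiv ℝ f) x) (x + (0 : ℝ) • e) := by
        simpa using hf2.hasFDerivAt
      have h1 : HasDerivAt (fun t : ℝ => fderiv ℝ f (x + t • e))
          (fderiv ℝ (fderiv ℝ f) x e) 0 := h0.comp_hasDerivAt 0 (hline 0)
      exact (ContinuousLinearMap.apply ℝ ℝ e).hasFDerivAt.comp_hasDerivAt 0 h1
    have h3 : HasDerivAt (fun t : ℝ => F' (‖x‖ ^ 2 + 2 * x i * t + t ^ 2) * (2 * x i + 2 * t))
        (F'' * (2 * x i) * (2 * x i) + F' (‖x‖ ^ 2) * 2) 0 := by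
      have h0 : HasDerivAt F' F'' (‖x‖ ^ 2 + 2 * x i * 0 + 0 ^ 2) := by simpa using hF'
      have h4 := h0.comp (0 : ℝ) (hq 0)
      have h5 : HasDerivAt (fun t : ℝ => 2 * x i + 2 * t) 2 0 := by
        simpa using ((hasDerivAt_id (0 : ℝ)).const_mul 2).const_add (2 * x i)
      refine (h4.mul h5).congr_deriv ?_
      simp
    have := hmin.nonneg_of_hasDerivAt hderiv (h2.sub h3)
    rw [iteratedFDeriv_two_apply]
    simp only [Matrix.cons_val_zero, Matrix.cons_val_one]
    linarith
  calc 4 * ‖x‖ ^ 2 * F'' + 2 * n * F' (‖x‖ ^ 2)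
      = ∑ i : Fin n, (4 * (x i) ^ 2 * F'' + 2 * F' (‖x‖ ^ 2)) := by
        rw [Finset.sum_add_distrib, ← Finset.sum_mul, ← Finset.mul_sum,
          EuclideanSpace.real_norm_sq_eq]
        simp
        ring
    _ ≤ lap f x := Finset.sum_le_sum fun i _ => key i

theorem lap_sub {n : ℕ} {f g : EuclideanSpace ℝ (Fin n) → ℝ} (hf : ContDiff ℝ 2 f)
    (hg : ContDiff ℝ 2 g) (x : EuclideanSpace ℝ (Fin n)) :
    lap (fun y => f y - g y) x = lap f x - lap g x := by
  have : (fun y => f y - g y) = f - g := rfl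
  simp [lap, this, ← Finset.sum_sub_distrib, iteratedFDeriv_sub_apply hf.contDiffAt hg.contDiffAt]

/-- Keller–Osserman: a function with `Δf ≤ -(-f)^p` wherever it is negative, `p > 1`, is
nonnegative. -/
theorem nonneg_of_lap_le_neg_rpow {n : ℕ} {p : ℝ} (hp : 1 < p)
    {f : EuclideanSpace ℝ (Fin n) → ℝ} (hf : ContDiff ℝ 2 f)
    (h : ∀ x, f x < 0 → lap f x ≤ -(-f x) ^ p) (x₀ : EuclideanSpace ℝ (Fin n)) : 0 ≤ f x₀ := by
  by_contra! hx₀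
  set a : ℝ := 2 / (p - 1) with ha
  have hp' : 0 < p - 1 := by linarith
  have ha0 : 0 < a := by positivity
  have hap : a * (p - 1) = 2 := by rw [ha]; field_simp
  set K : ℝ := 4 * a * (a + 1) + 2 * n * a with hK
  have hK0 : 0 < K := by positivity
  have main : ∀ R : ℝ, ‖x₀‖ < R → (R ^ 2 - ‖x₀‖ ^ 2) ^ 2 * (-f x₀) ^ (p - 1) ≤ K * R ^ 2 := by
    intro R hR
    have hRpos : 0 < R := (norm_nonneg _).trans_lt hR
    have hpos : ∀ y : EuclideanSpace ℝ (Fin n), ‖y‖ < R → 0 < R ^ 2 - ‖y‖ ^ 2 := fun y hy => by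
      have := norm_nonneg y
      nlinarith
    have hcont : Continuous fun y : EuclideanSpace ℝ (Fin n) =>
        (R ^ 2 - ‖y‖ ^ 2) ^ a * f y := by
      refine Continuous.mul (Continuous.rpow_const (by fun_prop) fun _ => Or.inr ha0.le)
        hf.continuous
    obtain ⟨x, hxR, hxmin⟩ := (isCompact_closedBall (0 : EuclideanSpace ℝ (Fin n)) R).exists_isMinOn
      ⟨0, by simp [hRpos.le]⟩ hcont.continuousOn
    have hmin : ∀ y, ‖y‖ ≤ R → (R ^ 2 - ‖x‖ ^ 2) ^ a * f x ≤ (R ^ 2 - ‖y‖ ^ 2) ^ a * f y :=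
      fun y hy => hxmin (by simpa using hy)
    set t : ℝ := -((R ^ 2 - ‖x‖ ^ 2) ^ a * f x) with ht
    have hx₀pos := hpos x₀ hR
    have ht₀ : (R ^ 2 - ‖x₀‖ ^ 2) ^ a * (-f x₀) ≤ t := by linarith [hmin x₀ hR.le]
    have htpos : 0 < t := lt_of_lt_of_le (mul_pos (rpow_pos_of_pos hx₀pos a) (by linarith)) ht₀
    have hxlt : ‖x‖ < R := by
      refine lt_of_le_of_ne (by simpa using hxR) fun hEq => ?_
      rw [ht, hEq, sub_self, zero_rpow ha0.ne'] at htpos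
      simp at htpos
    have hd := hpos x hxlt
    set d : ℝ := R ^ 2 - ‖x‖ ^ 2 with hdef
    have hda : 0 < d ^ a := rpow_pos_of_pos hd a
    have hfx : f x = -t * d ^ (-a) := by
      rw [ht, rpow_neg hd.le]; field_simp
    have hfneg : f x < 0 := by
      rw [hfx]; have := rpow_pos_of_pos hd (-a); nlinarith
    have hlapx := h x hfneg
    have htouch : IsLocalMin (fun y => f y - (-t * (R ^ 2 - ‖y‖ ^ 2) ^ (-a))) x := by
      have hball : ∀ᶠ y in nhds x, ‖y‖ < R := continuous_norm.continuousAt.eventually_lt_const hxlt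
      filter_upwards [hball] with y hy
      have hy' := hpos y hy
      have hya : 0 < (R ^ 2 - ‖y‖ ^ 2) ^ a := rpow_pos_of_pos hy' a
      have h1 : -t ≤ (R ^ 2 - ‖y‖ ^ 2) ^ a * f y := by linarith [hmin y hy.le]
      have h2 : -t * (R ^ 2 - ‖y‖ ^ 2) ^ (-a) ≤ f y := by
        rw [rpow_neg hy'.le, ← div_eq_mul_inv, div_le_iff₀ hya]; linarith
      have h3 : f x - (-t * (R ^ 2 - ‖x‖ ^ 2) ^ (-a)) = 0 := by rw [hfx]; ring
      linarith
    have hD : ∀ b : ℝ, ∀ s : ℝ, s < R ^ 2 →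
        HasDerivAt (fun s : ℝ => (R ^ 2 - s) ^ b) (-b * (R ^ 2 - s) ^ (b - 1)) s := by
      intro b s hs
      have := ((hasDerivAt_id s).const_sub (R ^ 2)).rpow_const (p := b)
        (Or.inl (by simp; linarith))
      simpa using this
    have hsx : ‖x‖ ^ 2 < R ^ 2 := by linarith
    have hF : ∀ᶠ s in nhds (‖x‖ ^ 2), HasDerivAt (fun s : ℝ => -t * (R ^ 2 - s) ^ (-a))
        (-t * (- -a * (R ^ 2 - s) ^ (-a - 1))) s := by
      filter_upwards [eventually_lt_nhds hsx] with s hs using (hD (-a) s hs).const_mul _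
    have hF' := ((hD (-a - 1) _ hsx).const_mul (- -a)).const_mul (-t)
    have hle := radial_le_lap_of_isLocalMin_sub hf hF hF' htouch
    rw [← hdef] at hle
    have hpow : (-f x) ^ p = t ^ p * d ^ (-a - 2) := by
      rw [hfx, neg_mul, neg_neg, mul_rpow htpos.le (rpow_nonneg hd.le _), ← rpow_mul hd.le]
      congr 2
      linarith
    have hd1 : d ^ (-a - 1) = d ^ (-a - 2) * d := by
      rw [← rpow_add_one hd.ne']; congr 1; ring
    have hd2 : d ^ (-a - 1 - 1) = d ^ (-a - 2) := by congr 1; ring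
    rw [hd2, hd1] at hle
    rw [hpow] at hlapx
    have htp : t ^ p = t ^ (p - 1) * t := by rw [← rpow_add_one htpos.ne']; congr 1; ring
    have hE : 0 < d ^ (-a - 2) := rpow_pos_of_pos hd _
    have h4 : (t * d ^ (-a - 2)) * t ^ (p - 1) ≤
        (t * d ^ (-a - 2)) * (4 * ‖x‖ ^ 2 * (a * (a + 1)) + 2 * n * a * d) := by
      rw [htp] at hlapx
      nlinarith
    have h5 := le_of_mul_le_mul_left h4 (mul_pos htpos hE)
    have h6 : 4 * ‖x‖ ^ 2 * (a * (a + 1)) + 2 * n * a * d ≤ K * R ^ 2 := by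
      have e1 : (4 * (a * (a + 1))) * ‖x‖ ^ 2 ≤ (4 * (a * (a + 1))) * R ^ 2 := by gcongr
      have e2 : (2 * n * a) * d ≤ (2 * n * a) * R ^ 2 := by
        gcongr; rw [hdef]; nlinarith [norm_nonneg x]
      rw [hK]; linarith
    calc (R ^ 2 - ‖x₀‖ ^ 2) ^ 2 * (-f x₀) ^ (p - 1)
        = ((R ^ 2 - ‖x₀‖ ^ 2) ^ a * (-f x₀)) ^ (p - 1) := by
          rw [mul_rpow (rpow_nonneg hx₀pos.le _) (by linarith), ← rpow_mul hx₀pos.le, hap]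
          norm_num
      _ ≤ t ^ (p - 1) :=
          rpow_le_rpow (mul_nonneg (rpow_nonneg hx₀pos.le _) (by linarith)) ht₀ hp'.le
      _ ≤ K * R ^ 2 := h5.trans h6
  set w : ℝ := (-f x₀) ^ (p - 1) with hw
  have hwpos : 0 < w := rpow_pos_of_pos (by linarith) _
  set T : ℝ := 4 * K / w + 2 * ‖x₀‖ ^ 2 + 1 with hT
  have hTpos : 0 < T := by positivity
  have hx₀T : ‖x₀‖ < √T := by
    apply lt_sqrt_of_sq_lt
    have : 0 ≤ 4 * K / w := by positivity
    nlinarith [sq_nonneg ‖x₀‖]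
  have hm := main _ hx₀T
  rw [sq_sqrt hTpos.le] at hm
  have h1 : T / 2 ≤ T - ‖x₀‖ ^ 2 := by
    have : 0 ≤ 4 * K / w := by positivity
    linarith
  have h2 : (T / 2) ^ 2 * w ≤ K * T := (by gcongr : _ ≤ (T - ‖x₀‖ ^ 2) ^ 2 * w).trans hm
  have h3 : T * w ≤ 4 * K := by nlinarith
  have h4 : 4 * K / w < T := by nlinarith [sq_nonneg ‖x₀‖]
  rw [div_lt_iff₀ hwpos] at h4
  linarith

/-- A positive function cannot satisfy `Δu < -λ u` on a ball of radius `R` when `λ` exceeds a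
dimensional multiple of `R⁻²`. -/
theorem exists_neg_mul_le_lap {n : ℕ} {u : EuclideanSpace ℝ (Fin n) → ℝ} (hu : ContDiff ℝ 2 u)
    (hpos : ∀ x, 0 < u x) {R : ℝ} (hR : 0 < R) :
    ∃ x, ‖x‖ < R ∧ -((2 * n + 4) ^ 2 / 8 / R ^ 2) * u x ≤ lap u x := by
  have hcont : Continuous fun y => (R ^ 2 - ‖y‖ ^ 2) ^ 2 / u y :=
    Continuous.div (by fun_prop) hu.continuous fun y => (hpos y).ne'
  obtain ⟨x, hxR, hxmax⟩ := (isCompact_closedBall (0 : EuclideanSpace ℝ (Fin n)) R).exists_isMaxOn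
    ⟨0, by simp [hR.le]⟩ hcont.continuousOn
  have hmax : ∀ y, ‖y‖ ≤ R → (R ^ 2 - ‖y‖ ^ 2) ^ 2 / u y ≤ (R ^ 2 - ‖x‖ ^ 2) ^ 2 / u x :=
    fun y hy => hxmax (by simpa using hy)
  set m : ℝ := (R ^ 2 - ‖x‖ ^ 2) ^ 2 / u x with hm
  have hmpos : 0 < m := by
    refine lt_of_lt_of_le ?_ (hmax 0 (by simp [hR.le]))
    have := hpos 0
    have h0 : (R ^ 2 - ‖(0 : EuclideanSpace ℝ (Fin n))‖ ^ 2) ^ 2 = (R ^ 2) ^ 2 := by simp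
    rw [h0]
    positivity
  have hxlt : ‖x‖ < R := by
    refine lt_of_le_of_ne (by simpa using hxR) fun hEq => ?_
    rw [hm, hEq] at hmpos
    simp at hmpos
  refine ⟨x, hxlt, ?_⟩
  have hux : m⁻¹ * (R ^ 2 - ‖x‖ ^ 2) ^ 2 = u x := by
    have := (hpos x).ne'
    have h1 : (R ^ 2 - ‖x‖ ^ 2) ^ 2 = m * u x := by rw [hm]; field_simp
    rw [h1]; field_simp
  have htouch : IsLocalMin (fun y => u y - m⁻¹ * (R ^ 2 - ‖y‖ ^ 2) ^ 2) x := by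
    have hball : ∀ᶠ y in nhds x, ‖y‖ < R := continuous_norm.continuousAt.eventually_lt_const hxlt
    filter_upwards [hball] with y hy
    have h1 := hmax y hy.le
    rw [div_le_iff₀ (hpos y)] at h1
    have h2 : m⁻¹ * (R ^ 2 - ‖y‖ ^ 2) ^ 2 ≤ u y := by
      rw [inv_mul_le_iff₀ hmpos]; exact h1
    linarith
  have hlin : ∀ s : ℝ, HasDerivAt (fun s : ℝ => R ^ 2 - s) (-1) s := fun s => by
    simpa using (hasDerivAt_id s).const_sub (R ^ 2)
  have hF : ∀ s : ℝ, HasDerivAt (fun s : ℝ => m⁻¹ * (R ^ 2 - s) ^ 2)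
      (m⁻¹ * (-2 * (R ^ 2 - s))) s := fun s => by
    refine (((hlin s).pow 2).const_mul m⁻¹).congr_deriv ?_
    simp
  have hF' := ((hlin (‖x‖ ^ 2)).const_mul (-2)).const_mul m⁻¹
  have hle := radial_le_lap_of_isLocalMin_sub hu (Eventually.of_forall hF) hF' htouch
  refine le_trans ?_ hle
  rw [← hux]
  have hmi : 0 < m⁻¹ := by positivity
  have hkey : 0 ≤ (2 * (n : ℝ) + 4) ^ 2 / 8 / R ^ 2 * (R ^ 2 - ‖x‖ ^ 2) ^ 2
      + 8 * ‖x‖ ^ 2 - 4 * n * (R ^ 2 - ‖x‖ ^ 2) := by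
    have : (2 * (n : ℝ) + 4) ^ 2 / 8 / R ^ 2 * (R ^ 2 - ‖x‖ ^ 2) ^ 2
      + 8 * ‖x‖ ^ 2 - 4 * n * (R ^ 2 - ‖x‖ ^ 2)
      = ((2 * (n : ℝ) + 4) * (R ^ 2 - ‖x‖ ^ 2) - 8 * R ^ 2) ^ 2 / (8 * R ^ 2) := by
      field_simp; ring
    rw [this]; positivity
  nlinarith [mul_nonneg hmi.le hkey]

/-- Comparison with a decaying radial function outside the unit ball. -/
theorem radial_le_of_lap_lt {n : ℕ} {u : EuclideanSpace ℝ (Fin n) → ℝ} (hu : ContDiff ℝ 2 u)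
    (hpos : ∀ x, 0 < u x) {F F' F'' : ℝ → ℝ} (hF : ∀ s, 0 < s → HasDerivAt F (F' s) s)
    (hF' : ∀ s, 0 < s → HasDerivAt F' (F'' s) s) (hlim : Tendsto F atTop (nhds 0))
    (hbd : ∀ x, ‖x‖ = 1 → F 1 ≤ u x)
    (hlap : ∀ x, 1 < ‖x‖ → lap u x < 4 * ‖x‖ ^ 2 * F'' (‖x‖ ^ 2) + 2 * n * F' (‖x‖ ^ 2))
    {x₀ : EuclideanSpace ℝ (Fin n)} (hx₀ : 1 ≤ ‖x₀‖) : F (‖x₀‖ ^ 2) ≤ u x₀ := by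
  by_contra! hlt
  have hlim' : Tendsto (fun R : ℝ => F (R ^ 2)) atTop (nhds 0) :=
    hlim.comp (tendsto_pow_atTop two_ne_zero)
  obtain ⟨R, hRδ, hRx⟩ := ((hlim'.eventually_lt_const (sub_pos.2 hlt)).and
    (eventually_gt_atTop ‖x₀‖)).exists
  have hcompact : IsCompact (Metric.closedBall (0 : EuclideanSpace ℝ (Fin n)) R \
      Metric.ball 0 1) := (isCompact_closedBall _ _).diff Metric.isOpen_ball
  have hcont : ContinuousOn (fun y : EuclideanSpace ℝ (Fin n) => u y - F (‖y‖ ^ 2))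
      (Metric.closedBall 0 R \ Metric.ball 0 1) := by
    intro y hy
    have hy1 : 1 ≤ ‖y‖ := by simpa using hy.2
    have h1 : ContinuousAt F (‖y‖ ^ 2) := (hF _ (by positivity)).continuousAt
    have h2 : ContinuousAt (fun y : EuclideanSpace ℝ (Fin n) => ‖y‖ ^ 2) y := by fun_prop
    exact (hu.continuous.continuousAt.sub
      (ContinuousAt.comp (g := F) h1 h2)).continuousWithinAt
  obtain ⟨x, hxK, hxmin⟩ := hcompact.exists_isMinOn
    ⟨x₀, by simpa using hRx.le, by simpa using hx₀⟩ hcont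
  have hmin : ∀ y, 1 ≤ ‖y‖ → ‖y‖ ≤ R → u x - F (‖x‖ ^ 2) ≤ u y - F (‖y‖ ^ 2) :=
    fun y h1 h2 => hxmin ⟨by simpa using h2, by simpa using h1⟩
  have hx1 : 1 ≤ ‖x‖ := by simpa using hxK.2
  have hxR : ‖x‖ ≤ R := by simpa using hxK.1
  have hval := hmin x₀ hx₀ hRx.le
  have hx1' : 1 < ‖x‖ := by
    refine lt_of_le_of_ne hx1 fun hEq => ?_
    have := hbd x hEq.symm
    rw [← hEq, one_pow] at hval
    linarith
  have hxR' : ‖x‖ < R := by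
    refine lt_of_le_of_ne hxR fun hEq => ?_
    rw [hEq] at hval
    linarith [hpos x]
  have htouch : IsLocalMin (fun y => u y - F (‖y‖ ^ 2)) x := by
    filter_upwards [continuous_norm.continuousAt.eventually_lt_const hxR',
      continuous_norm.continuousAt.eventually_const_lt hx1'] with y h1 h2
      using hmin y h2.le h1.le
  have hs : 0 < ‖x‖ ^ 2 := by positivity
  have hle := radial_le_lap_of_isLocalMin_sub hu
    ((eventually_gt_nhds hs).mono fun s hs => hF s hs) (hF' _ hs) htouch
  linarith [hlap x hx1']

/-- Minimum principle on balls. -/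
theorem le_of_lap_neg {n : ℕ} {u : EuclideanSpace ℝ (Fin n) → ℝ} (hu : ContDiff ℝ 2 u)
    (hlap : ∀ x, lap u x < 0) {R b : ℝ} (hR : 0 < R) (hb : ∀ x, ‖x‖ = R → b ≤ u x)
    {y : EuclideanSpace ℝ (Fin n)} (hy : ‖y‖ ≤ R) : b ≤ u y := by
  obtain ⟨x, hxR, hxmin⟩ := (isCompact_closedBall (0 : EuclideanSpace ℝ (Fin n)) R).exists_isMinOn
    ⟨0, by simp [hR.le]⟩ hu.continuous.continuousOn
  have hmin : ∀ y, ‖y‖ ≤ R → u x ≤ u y := fun y hy => hxmin (by simpa using hy)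
  have hxR' : ‖x‖ ≤ R := by simpa using hxR
  rcases hxR'.lt_or_eq with hlt | hEq
  · have htouch : IsLocalMin (fun y => u y - (fun _ : ℝ => (0 : ℝ)) (‖y‖ ^ 2)) x := by
      filter_upwards [continuous_norm.continuousAt.eventually_lt_const hlt] with y h1
      simpa using hmin y h1.le
    have := radial_le_lap_of_isLocalMin_sub hu
      (Eventually.of_forall fun s => hasDerivAt_const s (0 : ℝ)) (hasDerivAt_const _ (0 : ℝ)) htouch
    simp only [mul_zero, add_zero] at this
    linarith [hlap x]
  · exact (hb x hEq).trans (hmin y hy)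

/-- The equation `-Δu ≥ u^p` has no positive classical solution when `1 < p ≤ n / (n - 2)`. -/
theorem not_lap_le_neg_rpow {n : ℕ} (hn : 3 ≤ n) {p : ℝ} (hp1 : 1 < p)
    (hp2 : p ≤ (n : ℝ) / ((n : ℝ) - 2)) {u : EuclideanSpace ℝ (Fin n) → ℝ}
    (hu : ContDiff ℝ 2 u) (hpos : ∀ x, 0 < u x) : ¬ ∀ x, lap u x ≤ -u x ^ p := by
  intro hlap
  have hlapneg : ∀ x, lap u x < 0 := fun x =>
    (hlap x).trans_lt (neg_neg_of_pos (rpow_pos_of_pos (hpos x) p))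
  have hn' : (3 : ℝ) ≤ n := by exact_mod_cast hn
  set k : ℝ := ((n : ℝ) - 2) / 2 with hk
  have hkpos : 0 < k := by rw [hk]; linarith
  have hnk : (n : ℝ) = 2 * k + 2 := by rw [hk]; ring
  have hkp : k * p ≤ k + 1 := by
    rw [le_div_iff₀ (by linarith)] at hp2
    rw [hnk] at hp2
    linarith
  have hpow : ∀ b s : ℝ, 0 < s → HasDerivAt (fun s : ℝ => s ^ b) (b * s ^ (b - 1)) s :=
    fun b s hs => hasDerivAt_rpow_const (Or.inl hs.ne')
  obtain ⟨z, -, hz⟩ := (isCompact_closedBall (0 : EuclideanSpace ℝ (Fin n)) 1).exists_isMinOn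
    ⟨0, by simp⟩ hu.continuous.continuousOn
  set c : ℝ := u z with hc
  have hcpos : 0 < c := hpos z
  have hlow : ∀ x : EuclideanSpace ℝ (Fin n), 1 ≤ ‖x‖ → c * (‖x‖ ^ 2) ^ (-k) ≤ u x := by
    intro x hx
    refine radial_le_of_lap_lt hu hpos (F := fun s => c * s ^ (-k))
      (fun s hs => (hpow (-k) s hs).const_mul c)
      (fun s hs => ((hpow (-k - 1) s hs).const_mul (-k)).const_mul c) ?_ ?_ ?_ hx
    · simpa using (tendsto_rpow_neg_atTop hkpos).const_mul c
    · intro y hy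
      simpa using hz (show y ∈ Metric.closedBall 0 1 by simp [hy])
    · intro y hy
      have hs : 0 < ‖y‖ ^ 2 := by positivity
      have e : (‖y‖ ^ 2) ^ (-k - 1) = (‖y‖ ^ 2) ^ (-k - 1 - 1) * ‖y‖ ^ 2 := by
        rw [← rpow_add_one hs.ne']; congr 1; ring
      have : 4 * ‖y‖ ^ 2 * (c * (-k * ((-k - 1) * (‖y‖ ^ 2) ^ (-k - 1 - 1)))) +
          2 * n * (c * (-k * (‖y‖ ^ 2) ^ (-k - 1))) = 0 := by
        rw [e, hnk]; ring
      rw [this]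
      exact hlapneg y
  set c' : ℝ := c ^ p / (8 * k) with hc'
  have hcp : 0 < c ^ p := rpow_pos_of_pos hcpos p
  have hc'pos : 0 < c' := by positivity
  have hlog : ∀ x : EuclideanSpace ℝ (Fin n), 1 ≤ ‖x‖ →
      c' * ((‖x‖ ^ 2) ^ (-k) * log (‖x‖ ^ 2)) ≤ u x := by
    intro x hx
    refine radial_le_of_lap_lt hu hpos (F := fun s => c' * (s ^ (-k) * log s))
      (fun s hs => ((hpow (-k) s hs).mul (hasDerivAt_log hs.ne')).const_mul c')
      (fun s hs => ((((hpow (-k - 1) s hs).const_mul (-k)).mul (hasDerivAt_log hs.ne')).add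
        ((hpow (-k) s hs).mul (hasDerivAt_inv hs.ne'))).const_mul c') ?_ ?_ ?_ hx
    · have h1 : Tendsto (fun s : ℝ => log s / s ^ k) atTop (nhds 0) :=
        (isLittleO_log_rpow_atTop hkpos).tendsto_div_nhds_zero
      have h2 : Tendsto (fun s : ℝ => s ^ (-k) * log s) atTop (nhds 0) := by
        refine h1.congr' ?_
        filter_upwards [eventually_gt_atTop 0] with s hs
        rw [rpow_neg hs.le, div_eq_inv_mul]
      simpa using h2.const_mul c'
    · intro y _
      simpa using (hpos y).le
    · intro y hy
      have hs : 0 < ‖y‖ ^ 2 := by positivity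
      have hs1 : 1 ≤ ‖y‖ ^ 2 := by nlinarith
      set s : ℝ := ‖y‖ ^ 2 with hsdef
      have e1 : s ^ (-k - 1) = s ^ (-k - 1 - 1) * s := by
        rw [← rpow_add_one hs.ne']; congr 1; ring
      have e2 : s ^ (-k) = s ^ (-k - 1 - 1) * s ^ 2 := by
        rw [← rpow_natCast, ← rpow_add hs]; congr 1; push_cast; ring
      have hL : 4 * s * (c' * (-k * ((-k - 1) * s ^ (-k - 1 - 1)) * log s
            + -k * s ^ (-k - 1) * s⁻¹ + (-k * s ^ (-k - 1) * s⁻¹ + s ^ (-k) * -(s ^ 2)⁻¹))) +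
          2 * n * (c' * (-k * s ^ (-k - 1) * log s + s ^ (-k) * s⁻¹))
          = -(4 * k * c' * s ^ (-k - 1)) := by
        rw [e2, e1, hnk]; field_simp; ring
      refine lt_of_lt_of_eq ?_ hL.symm
      have hup : c ^ p * s ^ (-k - 1) ≤ u y ^ p := by
        calc c ^ p * s ^ (-k - 1) ≤ c ^ p * s ^ (-k * p) := by
              refine mul_le_mul_of_nonneg_left ?_ hcp.le
              exact rpow_le_rpow_of_exponent_le hs1 (by linarith)
          _ = (c * s ^ (-k)) ^ p := by
              rw [mul_rpow hcpos.le (rpow_nonneg hs.le _), ← rpow_mul hs.le]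
          _ ≤ u y ^ p := by
              have := hlow y hy.le
              have h0 : 0 ≤ c * s ^ (-k) := by positivity
              gcongr
      have h4 : 4 * k * c' = c ^ p / 2 := by rw [hc']; field_simp; norm_num
      have h5 : 0 < s ^ (-k - 1) := rpow_pos_of_pos hs _
      rw [h4]
      have := hlap y
      nlinarith
  have hp' : 0 < p - 1 := by linarith
  have hgrow : Tendsto (fun s : ℝ => (c' * log s) ^ (p - 1)) atTop atTop :=
    (tendsto_rpow_atTop hp').comp (tendsto_log_atTop.const_mul_atTop hc'pos)
  obtain ⟨s, hsM, hs1⟩ := ((hgrow.eventually_gt_atTop ((2 * (n : ℝ) + 4) ^ 2 / 8)).and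
    (eventually_gt_atTop 1)).exists
  have hs0 : 0 < s := by linarith
  have hR : 0 < √s := sqrt_pos.2 hs0
  have hR2 : √s ^ 2 = s := sq_sqrt hs0.le
  have hR1 : 1 ≤ √s := one_le_sqrt.2 hs1.le
  obtain ⟨x, hx, hxlap⟩ := exists_neg_mul_le_lap hu hpos hR
  have hls : 0 < log s := log_pos hs1
  set b : ℝ := c' * (s ^ (-k) * log s) with hb
  have hbpos : 0 < b := by positivity
  have hbu : b ≤ u x := by
    refine le_of_lap_neg hu hlapneg hR (fun y hy => ?_) hx.le
    have := hlog y (hy ▸ hR1)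
    rwa [hy, hR2] at this
  have hbM : (2 * (n : ℝ) + 4) ^ 2 / 8 / s < b ^ (p - 1) := by
    have h1 : b ^ (p - 1) = (c' * log s) ^ (p - 1) * s ^ (-k * (p - 1)) := by
      rw [rpow_mul hs0.le, ← mul_rpow (by positivity) (by positivity), hb]
      congr 1; ring
    have h2 : s⁻¹ ≤ s ^ (-k * (p - 1)) := by
      rw [← rpow_neg_one]
      exact rpow_le_rpow_of_exponent_le hs1.le (by linarith)
    rw [h1, div_eq_mul_inv]
    calc (2 * (n : ℝ) + 4) ^ 2 / 8 * s⁻¹ < (c' * log s) ^ (p - 1) * s⁻¹ := by gcongr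
      _ ≤ _ := by gcongr
  have hup : b ^ (p - 1) * u x ≤ u x ^ p := by
    have : u x ^ p = u x ^ (p - 1) * u x := by
      rw [← rpow_add_one (hpos x).ne']; congr 1; ring
    rw [this]
    have := (hpos x).le
    gcongr
  rw [hR2] at hxlap
  have := mul_lt_mul_of_pos_right hbM (hpos x)
  linarith [hlap x]

theorem stmt_0 (n : ℕ) (hn : 3 ≤ n) (p : ℝ) (hp1 : 1 < p) (hp2 : p ≤ (n : ℝ) / ((n : ℝ) - 2)) :
    ¬ ∃ u v : EuclideanSpace ℝ (Fin n) → ℝ, IsSysSolution n p u v := by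
  rintro ⟨u, v, hu, hv, hupos, hvpos, hueq, hveq⟩
  have hsq : 1 ≤ √p := one_le_sqrt.2 hp1.le
  have hup : ∀ x, u x ^ p = u x ^ (p - 1) * u x := fun x => by
    rw [← rpow_add_one (hupos x).ne']; congr 1; ring
  have huv : ∀ x, 0 ≤ v x - u x := by
    refine nonneg_of_lap_le_neg_rpow hp1 (hv.sub hu) fun x hx => ?_
    have hw : 0 < -(v x - u x) := by linarith
    have h1 : (-(v x - u x)) ^ (p - 1) ≤ u x ^ (p - 1) :=
      rpow_le_rpow hw.le (by linarith [hvpos x]) (by linarith)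
    have h2 : (-(v x - u x)) ^ p = (-(v x - u x)) ^ (p - 1) * (-(v x - u x)) := by
      rw [← rpow_add_one hw.ne']; congr 1; ring
    have h3 : lap (fun y => v y - u y) x = -(√p * (u x ^ (p - 1) * (-(v x - u x)))) := by
      rw [lap_sub hv hu]
      have := hueq x
      have h4 := hveq x
      rw [hup] at h4
      linarith
    rw [h3, h2, neg_le_neg_iff]
    have h5 : 0 ≤ u x ^ (p - 1) * (-(v x - u x)) :=
      mul_nonneg (rpow_nonneg (hupos x).le _) hw.le
    calc (-(v x - u x)) ^ (p - 1) * (-(v x - u x)) ≤ u x ^ (p - 1) * (-(v x - u x)) := by gcongr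
      _ ≤ _ := le_mul_of_one_le_left h5 hsq
  refine not_lap_le_neg_rpow hn hp1 hp2 hu hupos fun x => ?_
  have h1 : 0 ≤ u x ^ (p - 1) := rpow_nonneg (hupos x).le _
  have h2 : u x ^ p ≤ u x ^ (p - 1) * v x := by
    rw [hup]
    exact mul_le_mul_of_nonneg_left (by linarith [huv x]) h1
  have h3 : u x ^ (p - 1) * v x ≤ √p * (u x ^ (p - 1) * v x) :=
    le_mul_of_one_le_left (mul_nonneg h1 (hvpos x).le) hsq
  linarith [hueq x]
end

section
/- Let n ≥ 3 and p > 1, and let (u, v) be a positive continuous solution of the integral system (IE) with constants c₁, c₂ > 0. Then there exists a constant c > 0 such that u(x) ≥ c (1 + |x|)^{−(n−2)} and v(x) ≥ c (1 + |x|)^{−(p(n−2)−2)} for all x ∈ ℝⁿ. -/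
open MeasureTheory Real Filter

/-- `(u, v)` (with constants `c₁, c₂ > 0`) is a positive continuous solution of the
integral system `u(x) = c₁ ∫ u(y)^(p-1) v(y) |x-y|^(2-n) dy`,
`v(x) = c₂ ∫ u(y)^p |x-y|^(2-n) dy`; in particular the integrals are finite for every `x`. -/
def IsIESolution (n : ℕ) (p c₁ c₂ : ℝ) (u v : EuclideanSpace ℝ (Fin n) → ℝ) : Prop :=
  0 < c₁ ∧ 0 < c₂ ∧ Continuous u ∧ Continuous v ∧ (∀ x, 0 < u x) ∧ (∀ x, 0 < v x) ∧
  (∀ x, Integrable (fun y => u y ^ (p - 1) * v y * ‖x - y‖ ^ (-((n : ℝ) - 2)))) ∧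
  (∀ x, Integrable (fun y => u y ^ p * ‖x - y‖ ^ (-((n : ℝ) - 2)))) ∧
  (∀ x, u x = c₁ * ∫ y, u y ^ (p - 1) * v y * ‖x - y‖ ^ (-((n : ℝ) - 2))) ∧
  (∀ x, v x = c₂ * ∫ y, u y ^ p * ‖x - y‖ ^ (-((n : ℝ) - 2)))

/-- A lower bound for a nonnegative function on a ball, up to one point, bounds its integral. -/
theorem mul_measureReal_ball_le_integral {n : ℕ} (hn : 0 < n)
    {f : EuclideanSpace ℝ (Fin n) → ℝ} (hf : Integrable f) (hf0 : ∀ y, 0 ≤ f y)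
    (x z : EuclideanSpace ℝ (Fin n)) (r m : ℝ)
    (hm : ∀ y ∈ Metric.ball z r, y ≠ x → m ≤ f y) :
    m * volume.real (Metric.ball z r) ≤ ∫ y, f y := by
  have : Nonempty (Fin n) := ⟨⟨0, hn⟩⟩
  calc m * volume.real (Metric.ball z r)
      = ∫ _ in Metric.ball z r, m := by
        rw [setIntegral_const, smul_eq_mul, mul_comm]
    _ ≤ ∫ y in Metric.ball z r, f y := by
        refine setIntegral_mono_on_ae (integrableOn_const (by finiteness)) hf.integrableOn
          measurableSet_ball ?_
        filter_upwards [Measure.ae_ne volume x] with y hy hyz using hm y hyz hy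
    _ ≤ ∫ y, f y := setIntegral_le_integral hf (Eventually.of_forall hf0)

/-- The volume of a Euclidean ball scales like the `n`-th power of its radius. -/
theorem measureReal_ball_eq_rpow {n : ℕ} (x : EuclideanSpace ℝ (Fin n)) {r : ℝ} (hr : 0 < r) :
    volume.real (Metric.ball x r)
      = r ^ (n : ℝ) * volume.real (Metric.ball (0 : EuclideanSpace ℝ (Fin n)) 1) := by
  rw [measureReal_def, Measure.addHaar_ball_of_pos volume x hr, ENNReal.toReal_mul,
    ENNReal.toReal_ofReal (by positivity), finrank_euclideanSpace_fin, rpow_natCast,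
    measureReal_def]

/-- The Newtonian potential of a positive continuous density decays at most like the kernel. -/
theorem exists_pos_mul_rpow_le_integral {n : ℕ} (hn : 3 ≤ n)
    {g : EuclideanSpace ℝ (Fin n) → ℝ} (hg : Continuous g) (hg0 : ∀ y, 0 < g y)
    (hint : ∀ x, Integrable (fun y => g y * ‖x - y‖ ^ (-((n : ℝ) - 2)))) :
    ∃ c : ℝ, 0 < c ∧ ∀ x, c * (1 + ‖x‖) ^ (-((n : ℝ) - 2))
      ≤ ∫ y, g y * ‖x - y‖ ^ (-((n : ℝ) - 2)) := by
  have hn' : (3 : ℝ) ≤ n := by exact_mod_cast hn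
  obtain ⟨z, -, hz⟩ := (isCompact_closedBall (0 : EuclideanSpace ℝ (Fin n)) 1).exists_isMinOn
    ⟨0, by simp⟩ hg.continuousOn
  have hball : 0 < volume.real (Metric.ball (0 : EuclideanSpace ℝ (Fin n)) 1) :=
    ENNReal.toReal_pos (Metric.measure_ball_pos volume 0 one_pos).ne' measure_ball_lt_top.ne
  refine ⟨g z * volume.real (Metric.ball (0 : EuclideanSpace ℝ (Fin n)) 1),
    mul_pos (hg0 z) hball, fun x => ?_⟩
  rw [mul_right_comm]
  refine mul_measureReal_ball_le_integral (by omega) (hint x)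
    (fun y => mul_nonneg (hg0 y).le (by positivity)) x 0 1 _ fun y hy hyx => ?_
  have hpos : 0 < ‖x - y‖ := norm_pos_iff.2 (sub_ne_zero.2 hyx.symm)
  have hy1 : ‖y‖ < 1 := by simpa using hy
  refine mul_le_mul (hz (Metric.ball_subset_closedBall hy)) ?_ (by positivity) (hg0 y).le
  exact rpow_le_rpow_of_nonpos hpos (by linarith [norm_sub_le x y]) (by linarith)

/-- The Newtonian potential of the `p`-th power of a function bounded below by the kernel. -/
theorem exists_pos_mul_rpow_le_integral_rpow {n : ℕ} (hn : 3 ≤ n) {p c : ℝ} (hp : 0 < p)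
    (hc : 0 < c) {u : EuclideanSpace ℝ (Fin n) → ℝ}
    (hu : ∀ y, c * (1 + ‖y‖) ^ (-((n : ℝ) - 2)) ≤ u y)
    (hint : ∀ x, Integrable (fun y => u y ^ p * ‖x - y‖ ^ (-((n : ℝ) - 2)))) :
    ∃ d : ℝ, 0 < d ∧ ∀ x, d * (1 + ‖x‖) ^ (-(p * ((n : ℝ) - 2) - 2))
      ≤ ∫ y, u y ^ p * ‖x - y‖ ^ (-((n : ℝ) - 2)) := by
  have hn' : (3 : ℝ) ≤ n := by exact_mod_cast hn
  have hu0 (y) : 0 < u y := lt_of_lt_of_le (by positivity) (hu y)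
  have hball : 0 < volume.real (Metric.ball (0 : EuclideanSpace ℝ (Fin n)) 1) :=
    ENNReal.toReal_pos (Metric.measure_ball_pos volume 0 one_pos).ne' measure_ball_lt_top.ne
  refine ⟨(c * 2 ^ (-((n : ℝ) - 2))) ^ p
    * volume.real (Metric.ball (0 : EuclideanSpace ℝ (Fin n)) 1), by positivity, fun x => ?_⟩
  set R := 1 + ‖x‖ with hR
  have hR0 : 0 < R := by positivity
  have key : (c * (2 * R) ^ (-((n : ℝ) - 2))) ^ p * R ^ (-((n : ℝ) - 2))
      * volume.real (Metric.ball x R) ≤ ∫ y, u y ^ p * ‖x - y‖ ^ (-((n : ℝ) - 2)) := by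
    refine mul_measureReal_ball_le_integral (by omega) (hint x)
      (fun y => mul_nonneg (rpow_nonneg (hu0 y).le _) (by positivity)) x x R _
      fun y hy hyx => ?_
    have hpos : 0 < ‖x - y‖ := norm_pos_iff.2 (sub_ne_zero.2 hyx.symm)
    have hyR : ‖x - y‖ < R := by rwa [Metric.mem_ball', dist_eq_norm] at hy
    have hnorm : ‖y‖ ≤ ‖x‖ + ‖x - y‖ := by simpa using norm_sub_le x (x - y)
    refine mul_le_mul (rpow_le_rpow (by positivity) (le_trans ?_ (hu y)) hp.le)
      (rpow_le_rpow_of_nonpos hpos hyR.le (by linarith)) (by positivity)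
      (rpow_nonneg (hu0 y).le _)
    exact mul_le_mul_of_nonneg_left
      (rpow_le_rpow_of_nonpos (by positivity) (by linarith) (by linarith)) hc.le
  refine le_of_eq_of_le ?_ key
  have hexp : R ^ (-(p * ((n : ℝ) - 2) - 2))
      = R ^ (-((n : ℝ) - 2) * p) * R ^ (-((n : ℝ) - 2)) * R ^ (n : ℝ) := by
    rw [← rpow_add hR0, ← rpow_add hR0]
    ring_nf
  rw [measureReal_ball_eq_rpow x hR0, mul_rpow zero_le_two hR0.le, ← mul_assoc c,
    mul_rpow (x := c * _) (by positivity) (by positivity), ← rpow_mul hR0.le, hexp]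
  ring

theorem stmt_3 (n : ℕ) (hn : 3 ≤ n) (p : ℝ) (hp : 1 < p)
    (u v : EuclideanSpace ℝ (Fin n) → ℝ) (c₁ c₂ : ℝ)
    (huv : IsIESolution n p c₁ c₂ u v) :
    ∃ c : ℝ, 0 < c ∧ ∀ x : EuclideanSpace ℝ (Fin n),
      c * (1 + ‖x‖) ^ (-((n : ℝ) - 2)) ≤ u x ∧
      c * (1 + ‖x‖) ^ (-(p * ((n : ℝ) - 2) - 2)) ≤ v x := by
  obtain ⟨hc₁, hc₂, hu, hv, hu0, hv0, hint₁, hint₂, hueq, hveq⟩ := huv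
  obtain ⟨a, ha, hau⟩ := exists_pos_mul_rpow_le_integral hn
    ((hu.rpow_const fun y => Or.inl (hu0 y).ne').mul hv)
    (fun y => mul_pos (rpow_pos_of_pos (hu0 y) (p - 1)) (hv0 y)) hint₁
  have hu_lower (x) : c₁ * a * (1 + ‖x‖) ^ (-((n : ℝ) - 2)) ≤ u x := by
    rw [hueq x, mul_assoc]
    exact mul_le_mul_of_nonneg_left (hau x) hc₁.le
  obtain ⟨b, hb, hbv⟩ := exists_pos_mul_rpow_le_integral_rpow hn (one_pos.trans hp)
    (mul_pos hc₁ ha) hu_lower hint₂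
  have hv_lower (x) : c₂ * b * (1 + ‖x‖) ^ (-(p * ((n : ℝ) - 2) - 2)) ≤ v x := by
    rw [hveq x, mul_assoc]
    exact mul_le_mul_of_nonneg_left (hbv x) hc₂.le
  exact ⟨min (c₁ * a) (c₂ * b), by positivity, fun x =>
    ⟨(mul_le_mul_of_nonneg_right (min_le_left _ _) (by positivity)).trans (hu_lower x),
      (mul_le_mul_of_nonneg_right (min_le_right _ _) (by positivity)).trans (hv_lower x)⟩⟩
end

section
/- Let n ≥ 3, p ≥ 2, and h ≥ 0. Suppose u, v are positive continuous functions on ℝⁿ satisfying the weighted integral system u(x) = c₁ ∫_{ℝⁿ} u(y)^{p−1} v(y) |y|^{−h} |x−y|^{−(n−2)} dy and v(x) = c₂ ∫_{ℝⁿ} u(y)^p |y|^{−h} |x−y|^{−(n−2)} dy for constants c₁, c₂ > 0, and that ∫_{ℝⁿ} |y|^{−nh/2} u(y)^{n(p−1)/2} dy < ∞ and ∫_{ℝⁿ} |y|^{−nh/2} v(y)^{n(p−1)/2} dy < ∞. Then there exists x* ∈ ℝⁿ such that u and v are radially symmetric about x* and decreasing in |x − x*|; moreover, if h > 0 then x*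 = 0. -/
open MeasureTheory Real Filter

/-- `w` is radially symmetric about `x₀` and (non-strictly) decreasing in `|x - x₀|`. -/
def RadialDecreasingAbout {n : ℕ} (w : EuclideanSpace ℝ (Fin n) → ℝ)
    (x₀ : EuclideanSpace ℝ (Fin n)) : Prop :=
  ∀ x y : EuclideanSpace ℝ (Fin n), ‖x - x₀‖ ≤ ‖y - x₀‖ → w y ≤ w x

section

open Set Metric Topology
open scoped ENNReal

section Potential

variable {n : ℕ}

/-- Scaling of the Lebesgue integral on Euclidean space. -/
lemma lintegral_inv_smul_euclidean {r : ℝ} (hr : 0 < r)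
    (f : EuclideanSpace ℝ (Fin n) → ℝ≥0∞) :
    ∫⁻ y, f (r⁻¹ • y) = ENNReal.ofReal (r ^ (n : ℝ)) * ∫⁻ y, f y := by
  have hr' : r⁻¹ ≠ 0 := (inv_pos.2 hr).ne'
  have h := (Homeomorph.smulOfNeZero r⁻¹ hr').measurableEmbedding.lintegral_map
    (μ := (volume : Measure (EuclideanSpace ℝ (Fin n)))) f
  have h2 : Measure.map (Homeomorph.smulOfNeZero (α := EuclideanSpace ℝ (Fin n)) r⁻¹ hr') volume
      = Measure.map (r⁻¹ • ·) volume := rfl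
  rw [h2, Measure.map_addHaar_smul _ hr', lintegral_smul_measure] at h
  simp only [Homeomorph.smulOfNeZero_apply] at h
  rw [← h, smul_eq_mul]
  congr 2
  rw [finrank_euclideanSpace_fin, inv_pow, inv_inv, abs_of_pos (pow_pos hr n), Real.rpow_natCast]

/-- A radial profile that is `O(t ^ (-a))` near `0` and `O(t ^ (-b))` near `∞`, with
`a < n < b`, has finite integral over Euclidean space. -/
lemma lintegral_radial_lt_top (hn : 1 ≤ n) {a b : ℝ} (ha : a < n) (hb : (n : ℝ) < b) :
    ∫⁻ y : EuclideanSpace ℝ (Fin n),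
      ENNReal.ofReal (‖y‖ ^ (-a) * (max ‖y‖ 1) ^ (a - b)) < ∞ := by
  have : Nontrivial (EuclideanSpace ℝ (Fin n)) :=
    Module.nontrivial_of_finrank_pos (R := ℝ) (by rw [finrank_euclideanSpace_fin]; omega)
  have key : Integrable (fun y : EuclideanSpace ℝ (Fin n) =>
      (fun t : ℝ => t ^ (-a) * (max t 1) ^ (a - b)) ‖y‖) := by
    rw [integrable_fun_norm_addHaar volume (f := fun t : ℝ => t ^ (-a) * (max t 1) ^ (a - b)),
      finrank_euclideanSpace_fin,
      ← Ioc_union_Ioi_eq_Ioi (zero_le_one (α := ℝ)), integrableOn_union]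
    constructor
    · rw [integrableOn_Ioc_iff_integrableOn_Ioo]
      have h1 : IntegrableOn (fun t : ℝ => t ^ ((n : ℝ) - 1 - a)) (Ioo 0 1) := by
        rw [intervalIntegral.integrableOn_Ioo_rpow_iff one_pos]; linarith
      refine h1.congr_fun (fun t ht => ?_) measurableSet_Ioo
      simp only [smul_eq_mul]
      rw [max_eq_right ht.2.le, one_rpow, mul_one, ← Real.rpow_natCast t (n - 1),
        ← Real.rpow_add ht.1, Nat.cast_sub hn]
      congr 1; push_cast; ring
    · have h1 : IntegrableOn (fun t : ℝ => t ^ ((n : ℝ) - 1 - b)) (Ioi 1) := by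
        rw [integrableOn_Ioi_rpow_iff one_pos]; linarith
      refine h1.congr_fun (fun t ht => ?_) measurableSet_Ioi
      have ht0 : 0 < t := one_pos.trans ht
      simp only [smul_eq_mul]
      rw [max_eq_left (le_of_lt ht), ← Real.rpow_natCast t (n - 1),
        ← Real.rpow_add ht0, ← Real.rpow_add ht0, Nat.cast_sub hn]
      congr 1; push_cast; ring
  have := key.lintegral_lt_top
  simpa using this

/-- The Newtonian potential of `|y| ^ (-2-α)` restricted to `|y| ≥ 1` decays like
`|x| ^ (-α)`. -/
lemma exists_lintegral_newton_rpow_le (hn : 3 ≤ n) {α : ℝ} (hα : 0 < α) (hαn : α < n - 2) :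
    ∃ C : ℝ, 0 < C ∧ ∀ x : EuclideanSpace ℝ (Fin n),
      ∫⁻ y in {y | 1 ≤ ‖y‖}, ENNReal.ofReal (‖x - y‖ ^ (-((n : ℝ) - 2)) * ‖y‖ ^ (-2 - α))
        ≤ ENNReal.ofReal (C * (1 + ‖x‖) ^ (-α)) := by
  have hn' : (3 : ℝ) ≤ n := by exact_mod_cast hn
  set f₁ : EuclideanSpace ℝ (Fin n) → ℝ≥0∞ := fun y =>
    ENNReal.ofReal (‖y‖ ^ (-((n : ℝ) - 2)) * (max ‖y‖ 1) ^ (-2 - α)) with hf₁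
  set f₂ : EuclideanSpace ℝ (Fin n) → ℝ≥0∞ := fun y =>
    ENNReal.ofReal (‖y‖ ^ (-2 - α) * (max ‖y‖ 1) ^ (-((n : ℝ) - 2))) with hf₂
  have hm₁ : Measurable f₁ := by fun_prop
  have hm₂ : Measurable f₂ := by fun_prop
  have h1 : ∫⁻ y, f₁ y < ∞ := by
    have := lintegral_radial_lt_top (n := n) (by omega) (a := (n : ℝ) - 2) (b := n + α)
      (by linarith) (by linarith)
    convert this using 6
    ring
  have h2 : ∫⁻ y, f₂ y < ∞ := by
    have := lintegral_radial_lt_top (n := n) (by omega) (a := 2 + α) (b := n + α)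
      (by linarith) (by linarith)
    convert this using 6 <;> ring
  set D : ℝ := (∫⁻ y, f₁ y).toReal + (∫⁻ y, f₂ y).toReal + 1 with hD
  have hDpos : 0 < D := by positivity
  refine ⟨4 ^ α * D, by positivity, fun x => ?_⟩
  set r : ℝ := (1 + ‖x‖) / 4 with hr
  have hrpos : 0 < r := by positivity
  have hpt : ∀ y : EuclideanSpace ℝ (Fin n), 1 ≤ ‖y‖ →
      ENNReal.ofReal (‖x - y‖ ^ (-((n : ℝ) - 2)) * ‖y‖ ^ (-2 - α)) ≤
        ENNReal.ofReal (r ^ (-(n : ℝ) - α)) * (f₁ (r⁻¹ • (x - y)) + f₂ (r⁻¹ • y)) := by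
    intro y hy
    have hxab : ‖x‖ ≤ ‖x - y‖ + ‖y‖ := by simpa using norm_add_le (x - y) y
    have scale : ∀ a b c : ℝ, 0 ≤ c → a + b = (n : ℝ) + α →
        r ^ (-(n : ℝ) - α) * ((r⁻¹ * c) ^ (-a) * (max (r⁻¹ * c) 1) ^ (-b)) =
          c ^ (-a) * (max c r) ^ (-b) := by
      intro a b c hc hab
      have : max (r⁻¹ * c) 1 = r⁻¹ * max c r := by
        rw [mul_max_of_nonneg _ _ (inv_pos.2 hrpos).le, inv_mul_cancel₀ hrpos.ne']
      rw [this, Real.mul_rpow (inv_pos.2 hrpos).le hc,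
        Real.mul_rpow (inv_pos.2 hrpos).le (le_max_of_le_left hc),
        Real.inv_rpow hrpos.le, Real.inv_rpow hrpos.le, ← Real.rpow_neg hrpos.le,
        ← Real.rpow_neg hrpos.le, neg_neg, neg_neg]
      have : r ^ (-(n : ℝ) - α) * r ^ a * r ^ b = 1 := by
        rw [← Real.rpow_add hrpos, ← Real.rpow_add hrpos]
        have : -(n : ℝ) - α + a + b = 0 := by linarith
        rw [this, Real.rpow_zero]
      linear_combination (c ^ (-a) * (max c r) ^ (-b)) * this
    rw [hf₁, hf₂]
    simp only
    rw [← ENNReal.ofReal_add (by positivity) (by positivity),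
      ← ENNReal.ofReal_mul (by positivity)]
    apply ENNReal.ofReal_le_ofReal
    rw [norm_smul, norm_smul, norm_inv, Real.norm_of_nonneg hrpos.le, mul_add]
    have e1 := scale ((n : ℝ) - 2) (2 + α) ‖x - y‖ (norm_nonneg _) (by ring)
    have e2 := scale (2 + α) ((n : ℝ) - 2) ‖y‖ (norm_nonneg _) (by ring)
    rw [show -2 - α = -(2 + α) by ring, e1, e2]
    rcases le_total ‖x - y‖ ‖y‖ with hle | hle
    · have : max ‖x - y‖ r ≤ ‖y‖ := max_le hle (by rw [hr]; linarith)
      have hmono : ‖y‖ ^ (-(2 + α)) ≤ max ‖x - y‖ r ^ (-(2 + α)) :=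
        Real.rpow_le_rpow_of_nonpos (lt_max_of_lt_right hrpos) this (by linarith)
      have := mul_le_mul_of_nonneg_left hmono
        (Real.rpow_nonneg (norm_nonneg (x - y)) (-((n : ℝ) - 2)))
      have : 0 ≤ ‖y‖ ^ (-(2 + α)) * max ‖y‖ r ^ (-((n : ℝ) - 2)) := by positivity
      linarith
    · have : max ‖y‖ r ≤ ‖x - y‖ := max_le hle (by rw [hr]; linarith)
      have hmono : ‖x - y‖ ^ (-((n : ℝ) - 2)) ≤ max ‖y‖ r ^ (-((n : ℝ) - 2)) :=
        Real.rpow_le_rpow_of_nonpos (lt_max_of_lt_right hrpos) this (by linarith)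
      have := mul_le_mul_of_nonneg_right hmono
        (Real.rpow_nonneg (norm_nonneg y) (-(2 + α)))
      have : 0 ≤ ‖x - y‖ ^ (-((n : ℝ) - 2)) * max ‖x - y‖ r ^ (-(2 + α)) := by positivity
      linarith
  calc ∫⁻ y in {y | 1 ≤ ‖y‖}, ENNReal.ofReal (‖x - y‖ ^ (-((n : ℝ) - 2)) * ‖y‖ ^ (-2 - α))
      ≤ ∫⁻ y in {y | 1 ≤ ‖y‖},
          ENNReal.ofReal (r ^ (-(n : ℝ) - α)) * (f₁ (r⁻¹ • (x - y)) + f₂ (r⁻¹ • y)) :=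
        setLIntegral_mono' (measurableSet_le measurable_const measurable_norm) hpt
    _ ≤ ∫⁻ y, ENNReal.ofReal (r ^ (-(n : ℝ) - α)) * (f₁ (r⁻¹ • (x - y)) + f₂ (r⁻¹ • y)) :=
        setLIntegral_le_lintegral _ _
    _ = ENNReal.ofReal (r ^ (-(n : ℝ) - α)) *
          (ENNReal.ofReal (r ^ (n : ℝ)) * ((∫⁻ y, f₁ y) + ∫⁻ y, f₂ y)) := by
        rw [lintegral_const_mul _ (by fun_prop), lintegral_add_left (by fun_prop),
          lintegral_sub_left_eq_self (fun y => f₁ (r⁻¹ • y)) x,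
          lintegral_inv_smul_euclidean hrpos, lintegral_inv_smul_euclidean hrpos,
          mul_add (ENNReal.ofReal (r ^ (n : ℝ)))]
    _ ≤ ENNReal.ofReal (r ^ (-(n : ℝ) - α)) *
          (ENNReal.ofReal (r ^ (n : ℝ)) * ENNReal.ofReal D) := by
        gcongr
        rw [hD, ENNReal.ofReal_add (by positivity) (by positivity),
          ENNReal.ofReal_add (by positivity) (by positivity),
          ENNReal.ofReal_toReal h1.ne, ENNReal.ofReal_toReal h2.ne]
        exact le_self_add
    _ = ENNReal.ofReal (4 ^ α * D * (1 + ‖x‖) ^ (-α)) := by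
        rw [← ENNReal.ofReal_mul (by positivity), ← ENNReal.ofReal_mul (by positivity)]
        congr 1
        rw [← mul_assoc, ← Real.rpow_add hrpos, show -(n : ℝ) - α + n = -α by ring, hr,
          Real.div_rpow (by positivity) (by positivity), Real.rpow_neg (x := 4) (by norm_num)]
        field_simp

/-- The Newtonian potential of a set of small measure inside a fixed ball is small relative to
`(1 + |x|) ^ (-α)`. -/
lemma exists_lintegral_newton_small (hn : 3 ≤ n) {α : ℝ} (hα : 0 ≤ α) (hαn : α ≤ n - 2)
    {R : ℝ} (hR : 0 ≤ R) {η : ℝ} (hη : 0 < η) :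
    ∃ δ : ℝ≥0∞, 0 < δ ∧ ∀ A : Set (EuclideanSpace ℝ (Fin n)), A ⊆ closedBall 0 R →
      MeasurableSet A → volume A < δ → ∀ x : EuclideanSpace ℝ (Fin n),
      ∫⁻ y in A, ENNReal.ofReal (‖x - y‖ ^ (-((n : ℝ) - 2)))
        ≤ ENNReal.ofReal (η * (1 + ‖x‖) ^ (-α)) := by
  have hn' : (3 : ℝ) ≤ n := by exact_mod_cast hn
  set f : EuclideanSpace ℝ (Fin n) → ℝ≥0∞ := fun y =>
    ENNReal.ofReal (‖y‖ ^ (-((n : ℝ) - 2)) * (max ‖y‖ 1) ^ (-3 : ℝ)) with hf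
  have h1 : ∫⁻ y, f y < ∞ := by
    have := lintegral_radial_lt_top (n := n) (by omega) (a := (n : ℝ) - 2) (b := n + 1)
      (by linarith) (by linarith)
    convert this using 6; ring
  set c : ℝ := (1 + R) ^ α * 2 ^ α with hc
  have hcpos : 0 < c := by positivity
  obtain ⟨δ₁, hδ₁, h⟩ := exists_pos_setLIntegral_lt_of_measure_lt h1.ne
    (ε := ENNReal.ofReal (η / (2 * c))) (by simpa using by positivity)
  refine ⟨min δ₁ (ENNReal.ofReal (η / (2 * c))), lt_min hδ₁ (by simpa using by positivity), ?_⟩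
  intro A hAR hA hAδ x
  have hpt : ∀ y ∈ A, ENNReal.ofReal (‖x - y‖ ^ (-((n : ℝ) - 2))) ≤
      ENNReal.ofReal (c * (1 + ‖x‖) ^ (-α)) * (f (x - y) + 1) := by
    intro y hy
    have hyR : ‖y‖ ≤ R := by simpa using hAR hy
    rw [hf]
    simp only
    rw [← ENNReal.ofReal_one, ← ENNReal.ofReal_add (by positivity) (by positivity),
      ← ENNReal.ofReal_mul (by positivity)]
    apply ENNReal.ofReal_le_ofReal
    have hxab : ‖x‖ ≤ ‖x - y‖ + ‖y‖ := by simpa using norm_add_le (x - y) y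
    set t := ‖x - y‖ with ht
    have ht0 : 0 ≤ t := norm_nonneg _
    have hx1 : 1 + ‖x‖ ≤ (1 + R) * (1 + t) := by nlinarith
    have hx2 : (1 + ‖x‖) ^ α ≤ (1 + R) ^ α * (1 + t) ^ α := by
      rw [← Real.mul_rpow (by positivity) (by positivity)]
      exact Real.rpow_le_rpow (by positivity) hx1 hα
    have hmain : t ^ (-((n : ℝ) - 2)) * (1 + t) ^ α ≤
        2 ^ α * (t ^ (-((n : ℝ) - 2)) * (max t 1) ^ (-3 : ℝ) + 1) := by
      rcases le_total t 1 with h1 | h1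
      · rw [max_eq_right h1, one_rpow, mul_one]
        have : (1 + t) ^ α ≤ 2 ^ α := Real.rpow_le_rpow (by positivity) (by linarith) hα
        have h0 : 0 ≤ t ^ (-((n : ℝ) - 2)) := by positivity
        have h2 : (0 : ℝ) < 2 ^ α := by positivity
        nlinarith
      · have htpos : 0 < t := by linarith
        have : (1 + t) ^ α ≤ 2 ^ α * t ^ α := by
          rw [← Real.mul_rpow (by positivity) (by positivity)]
          exact Real.rpow_le_rpow (by positivity) (by linarith) hα
        have h3 : t ^ (-((n : ℝ) - 2)) * t ^ α ≤ 1 := by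
          rw [← Real.rpow_add htpos]
          exact Real.rpow_le_one_of_one_le_of_nonpos h1 (by linarith)
        have h0 : 0 ≤ t ^ (-((n : ℝ) - 2)) := by positivity
        have h2 : (0 : ℝ) < 2 ^ α := by positivity
        have h4 : 0 ≤ t ^ (-((n : ℝ) - 2)) * (max t 1) ^ (-3 : ℝ) := by positivity
        nlinarith [mul_le_mul_of_nonneg_left this h0]
    have hxpos : 0 < (1 + ‖x‖) ^ α := by positivity
    rw [Real.rpow_neg (x := 1 + ‖x‖) (by positivity), hc]
    rw [show (1 + R) ^ α * 2 ^ α * ((1 + ‖x‖) ^ α)⁻¹ *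
      (t ^ (-((n : ℝ) - 2)) * max t 1 ^ (-3 : ℝ) + 1) = ((1 + R) ^ α * (2 ^ α *
      (t ^ (-((n : ℝ) - 2)) * max t 1 ^ (-3 : ℝ) + 1))) / (1 + ‖x‖) ^ α by field_simp,
      le_div_iff₀ hxpos]
    have h0 : 0 ≤ t ^ (-((n : ℝ) - 2)) := by positivity
    have h5 : (0 : ℝ) < (1 + R) ^ α := by positivity
    calc _ ≤ t ^ (-((n : ℝ) - 2)) * ((1 + R) ^ α * (1 + t) ^ α) := by gcongr
      _ = (1 + R) ^ α * (t ^ (-((n : ℝ) - 2)) * (1 + t) ^ α) := by ring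
      _ ≤ _ := by gcongr
  have hfm : Measurable f := by fun_prop
  have hmp : MeasurePreserving (fun y : EuclideanSpace ℝ (Fin n) => x - y) volume volume :=
    Measure.measurePreserving_sub_left volume x
  have hshift : ∫⁻ y in A, f (x - y) ≤ ENNReal.ofReal (η / (2 * c)) := by
    have hpre : (fun y : EuclideanSpace ℝ (Fin n) => x - y) ⁻¹'
        ((fun y : EuclideanSpace ℝ (Fin n) => x - y) ⁻¹' A) = A := by
      ext y; simp
    have hA' : MeasurableSet ((fun y : EuclideanSpace ℝ (Fin n) => x - y) ⁻¹' A) :=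
      hmp.measurable hA
    have := hmp.setLIntegral_comp_preimage hA' hfm
    rw [hpre] at this
    rw [this]
    refine (h _ ?_).le
    rw [hmp.measure_preimage hA.nullMeasurableSet]
    exact hAδ.trans_le (min_le_left _ _)
  calc ∫⁻ y in A, ENNReal.ofReal (‖x - y‖ ^ (-((n : ℝ) - 2)))
      ≤ ∫⁻ y in A, ENNReal.ofReal (c * (1 + ‖x‖) ^ (-α)) * (f (x - y) + 1) :=
        setLIntegral_mono' hA hpt
    _ = ENNReal.ofReal (c * (1 + ‖x‖) ^ (-α)) * ((∫⁻ y in A, f (x - y)) + volume A) := by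
        rw [lintegral_const_mul _ (by fun_prop), lintegral_add_left (by fun_prop)]
        simp
    _ ≤ ENNReal.ofReal (c * (1 + ‖x‖) ^ (-α)) *
          (ENNReal.ofReal (η / (2 * c)) + ENNReal.ofReal (η / (2 * c))) := by
        gcongr
        exact hAδ.le.trans (min_le_right _ _)
    _ = ENNReal.ofReal (η * (1 + ‖x‖) ^ (-α)) := by
        rw [← ENNReal.ofReal_add (by positivity) (by positivity),
          ← ENNReal.ofReal_mul (by positivity)]
        congr 1
        field_simp
        norm_num

end Potential

section Decay

variable {n : ℕ}

lemma exists_lintegral_newton_ball_le (hn : 3 ≤ n) :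
    ∃ C : ℝ, 0 < C ∧ ∀ (y : EuclideanSpace ℝ (Fin n)) (ρ : ℝ), 0 < ρ →
      ∫⁻ z in ball y ρ, ENNReal.ofReal (‖y - z‖ ^ (-((n : ℝ) - 2))) ≤
        ENNReal.ofReal (C * ρ ^ 2) := by
  have hn' : (3 : ℝ) ≤ n := by exact_mod_cast hn
  set f : EuclideanSpace ℝ (Fin n) → ℝ≥0∞ := fun y =>
    ENNReal.ofReal (‖y‖ ^ (-((n : ℝ) - 2)) * (max ‖y‖ 1) ^ (-3 : ℝ)) with hf
  have h1 : ∫⁻ y, f y < ∞ := by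
    have := lintegral_radial_lt_top (n := n) (by omega) (a := (n : ℝ) - 2) (b := n + 1)
      (by linarith) (by linarith)
    convert this using 6; ring
  have hfm : Measurable f := by fun_prop
  refine ⟨(∫⁻ y, f y).toReal + 1, by positivity, fun y ρ hρ => ?_⟩
  have hpt : ∀ z ∈ ball y ρ, ENNReal.ofReal (‖y - z‖ ^ (-((n : ℝ) - 2))) ≤
      ENNReal.ofReal (ρ ^ (-((n : ℝ) - 2))) * f (ρ⁻¹ • (y - z)) := by
    intro z hz
    rw [mem_ball, dist_comm, dist_eq_norm] at hz
    simp only [hf]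
    rw [← ENNReal.ofReal_mul (by positivity)]
    apply ENNReal.ofReal_le_ofReal
    rw [norm_smul, norm_inv, Real.norm_of_nonneg hρ.le, max_eq_right, one_rpow, mul_one,
      ← Real.mul_rpow hρ.le (by positivity), mul_inv_cancel_left₀ hρ.ne']
    rw [inv_mul_le_iff₀ hρ]
    linarith
  calc _ ≤ ∫⁻ z in ball y ρ, ENNReal.ofReal (ρ ^ (-((n : ℝ) - 2))) * f (ρ⁻¹ • (y - z)) :=
        setLIntegral_mono' measurableSet_ball hpt
    _ ≤ ∫⁻ z, ENNReal.ofReal (ρ ^ (-((n : ℝ) - 2))) * f (ρ⁻¹ • (y - z)) :=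
        setLIntegral_le_lintegral _ _
    _ = ENNReal.ofReal (ρ ^ (-((n : ℝ) - 2))) * (ENNReal.ofReal (ρ ^ (n : ℝ)) * ∫⁻ z, f z) := by
        rw [lintegral_const_mul _ (by fun_prop),
          lintegral_sub_left_eq_self (fun z => f (ρ⁻¹ • z)) y, lintegral_inv_smul_euclidean hρ]
    _ = ENNReal.ofReal ((∫⁻ y, f y).toReal * ρ ^ 2) := by
        rw [← mul_assoc, ← ENNReal.ofReal_mul (by positivity), ← Real.rpow_add hρ,
          mul_comm (∫⁻ y, f y).toReal, ENNReal.ofReal_mul (by positivity),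
          ENNReal.ofReal_toReal h1.ne]
        congr 2
        rw [← Real.rpow_natCast]
        congr 1; push_cast; ring
    _ ≤ _ := by
        apply ENNReal.ofReal_le_ofReal
        nlinarith [sq_nonneg ρ]

set_option maxHeartbeats 1000000 in
/-- A quantitative concentration estimate: if `U` is the Newtonian potential of a density bounded
by `|y| ^ (-h) * U ^ (q + 1)` and `|x₀| ^ (2 - h) * U x₀ ^ q` is at least `ε`, then the scale
invariant integral of `|y| ^ (-h) * U ^ q` near `x₀` is bounded below. -/
lemma exists_le_lintegral_of_le_norm_sq_mul (hn : 3 ≤ n) {h q C ε : ℝ} (hh : 0 ≤ h) (hq : 0 < q)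
    (hC : 0 < C) (hε : 0 < ε) {U F : EuclideanSpace ℝ (Fin n) → ℝ} (hU : Continuous U)
    (hUpos : ∀ x, 0 < U x) (hF0 : ∀ y, 0 ≤ F y)
    (hFle : ∀ y, F y ≤ C * (‖y‖ ^ (-h) * U y ^ q * U y))
    (hInt : ∀ x, Integrable (fun y => F y * ‖x - y‖ ^ (-((n : ℝ) - 2))))
    (hUeq : ∀ x, U x = ∫ y, F y * ‖x - y‖ ^ (-((n : ℝ) - 2))) :
    ∃ c : ℝ≥0∞, 0 < c ∧ ∀ x₀ : EuclideanSpace ℝ (Fin n), x₀ ≠ 0 →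
      ε ≤ ‖x₀‖ ^ 2 * (‖x₀‖ ^ (-h) * U x₀ ^ q) →
      c ≤ ∫⁻ z in {z | ‖x₀‖ / 2 ≤ ‖z‖},
        ENNReal.ofReal ((‖z‖ ^ (-h) * U z ^ q) ^ ((n : ℝ) / 2)) := by
  have hn' : (3 : ℝ) ≤ n := by exact_mod_cast hn
  have : Nontrivial (EuclideanSpace ℝ (Fin n)) :=
    Module.nontrivial_of_finrank_pos (R := ℝ) (by rw [finrank_euclideanSpace_fin]; omega)
  obtain ⟨C₃, hC₃, hball⟩ := exists_lintegral_newton_ball_le hn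
  set C₁ : ℝ := (4 * 3 ^ h) ^ q⁻¹ with hC₁
  have hC₁pos : 0 < C₁ := by positivity
  set C₂ : ℝ := 16 * C * C₁ * C₃ with hC₂
  have hC₂pos : 0 < C₂ := by positivity
  set δ : ℝ := min (√ε / 8) (1 / √(2 * C₂)) with hδ
  have hδpos : 0 < δ := lt_min (by positivity) (by positivity)
  have hδ2 : C₂ * δ ^ 2 ≤ 1 / 2 := by
    have h1 : δ ^ 2 ≤ (1 / √(2 * C₂)) ^ 2 := by gcongr; exact min_le_right _ _
    rw [div_pow, Real.sq_sqrt (by positivity), one_pow] at h1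
    calc C₂ * δ ^ 2 ≤ C₂ * (1 / (2 * C₂)) := by gcongr
      _ = 1 / 2 := by field_simp
  set c₃ : ℝ := (3 / 2) ^ (-((n : ℝ) - 2)) / 2 with hc₃
  have hc₃pos : 0 < c₃ := by positivity
  set c₄ : ℝ := 3 ^ (-h) * c₃ ^ q with hc₄
  have hc₄pos : 0 < c₄ := by positivity
  set V : EuclideanSpace ℝ (Fin n) → ℝ := fun z => ‖z‖ ^ (-h) * U z ^ q with hV
  refine ⟨ENNReal.ofReal (c₄ ^ ((n : ℝ) / 2) * δ ^ n) *
    volume (ball (0 : EuclideanSpace ℝ (Fin n)) 1), ?_, fun x₀ hx₀ hεx => ?_⟩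
  · exact ENNReal.mul_pos (by simpa using by positivity)
      (measure_ball_pos _ _ one_pos).ne'
  set r : ℝ := ‖x₀‖ / 2 with hr
  have hrpos : 0 < r := by have := norm_pos_iff.2 hx₀; positivity
  have hnorm : ∀ z ∈ closedBall x₀ r, r ≤ ‖z‖ ∧ ‖z‖ ≤ 3 * r := by
    intro z hz
    rw [mem_closedBall, dist_eq_norm] at hz
    have h1 := norm_sub_norm_le x₀ z
    rw [norm_sub_rev] at h1
    have h2 := norm_sub_norm_le z x₀
    constructor <;> linarith
  have hVc : ContinuousOn V (closedBall x₀ r) := by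
    intro z hz
    have : ‖z‖ ≠ 0 := (hrpos.trans_le (hnorm z hz).1).ne'
    refine ContinuousAt.continuousWithinAt ?_
    exact (continuous_norm.continuousAt.rpow_const (Or.inl this)).mul
      (hU.continuousAt.rpow_const (Or.inr hq.le))
  obtain ⟨y, hy, hymax⟩ := (isCompact_closedBall x₀ r).exists_isMaxOn
    ⟨x₀, mem_closedBall_self hrpos.le⟩
    (f := fun z => (r - ‖z - x₀‖) ^ 2 * V z)
    (ContinuousOn.mul (by fun_prop) hVc)
  set m : ℝ := V y with hm
  have hVpos : ∀ z ∈ closedBall x₀ r, 0 < V z := fun z hz => by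
    have := hrpos.trans_le (hnorm z hz).1
    have := hUpos z
    positivity
  have hmpos : 0 < m := hVpos y hy
  set d : ℝ := r - ‖y - x₀‖ with hd
  have hd0 : 0 ≤ d := by
    rw [mem_closedBall, dist_eq_norm] at hy; linarith
  have hdm : ε / 4 ≤ d ^ 2 * m := by
    have h1 := hymax (mem_closedBall_self (x := x₀) hrpos.le)
    simp only [sub_self, norm_zero, sub_zero, mem_ofPred_eq] at h1
    calc ε / 4 ≤ ‖x₀‖ ^ 2 * V x₀ / 4 := by linarith
      _ = r ^ 2 * V x₀ := by rw [hr]; ring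
      _ ≤ _ := h1
  set s : ℝ := δ / √m with hs
  have hsm : 0 < √m := Real.sqrt_pos.2 hmpos
  have hspos : 0 < s := by positivity
  have hs2 : s ^ 2 * m = δ ^ 2 := by
    rw [hs, div_pow, Real.sq_sqrt hmpos.le]; field_simp
  have hsd : 4 * s ≤ d := by
    have h1 : √ε / 2 ≤ d * √m := by
      have : √(ε / 4) ≤ √(d ^ 2 * m) := Real.sqrt_le_sqrt hdm
      rw [Real.sqrt_mul (by positivity), Real.sqrt_sq hd0, Real.sqrt_div hε.le,
        show (4 : ℝ) = 2 ^ 2 by norm_num, Real.sqrt_sq (by norm_num)] at this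
      exact this
    have h2 : δ ≤ √ε / 8 := min_le_left _ _
    rw [hs, ← mul_div_assoc, div_le_iff₀ hsm]
    linarith
  have hdpos : 0 < d := by linarith
  have hsub : ∀ z, ‖z - y‖ ≤ d / 2 → z ∈ closedBall x₀ r ∧ d / 2 ≤ r - ‖z - x₀‖ := by
    intro z hz
    have : ‖z - x₀‖ ≤ ‖z - y‖ + ‖y - x₀‖ := norm_sub_le_norm_sub_add_norm_sub _ _ _
    constructor
    · rw [mem_closedBall, dist_eq_norm]; linarith
    · linarith
  have hV4 : ∀ z, ‖z - y‖ ≤ d / 2 → V z ≤ 4 * m := by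
    intro z hz
    obtain ⟨h1, h2⟩ := hsub z hz
    have h3 := hymax h1
    simp only [mem_ofPred_eq] at h3
    have h4 : (d / 2) ^ 2 * V z ≤ (r - ‖z - x₀‖) ^ 2 * V z := by
      have := (hVpos z h1).le
      gcongr
    have h5 : (d / 2) ^ 2 * V z ≤ d ^ 2 * m := h4.trans h3
    have hd2 : 0 < d ^ 2 := by positivity
    nlinarith
  have hUq : ∀ z ∈ closedBall x₀ r, U z ^ q = ‖z‖ ^ h * V z := by
    intro z hz
    have := hrpos.trans_le (hnorm z hz).1
    rw [hV]; simp only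
    rw [← mul_assoc, ← Real.rpow_add this, add_neg_cancel, Real.rpow_zero, one_mul]
  have hUy : r ^ h * m ≤ U y ^ q := by
    rw [hUq y hy]
    gcongr
    exact (hnorm y hy).1
  have hUz : ∀ z, ‖z - y‖ ≤ d / 2 → U z ≤ C₁ * U y := by
    intro z hz
    have hz' := (hsub z hz).1
    have h1 : U z ^ q ≤ (4 * 3 ^ h) * U y ^ q := by
      rw [hUq z hz']
      calc ‖z‖ ^ h * V z ≤ (3 * r) ^ h * (4 * m) := by
            have := (hVpos z hz').le
            gcongr
            · exact (hnorm z hz').2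
            · exact hV4 z hz
        _ = 4 * 3 ^ h * (r ^ h * m) := by
            rw [Real.mul_rpow (by norm_num) hrpos.le]; ring
        _ ≤ _ := by gcongr
    have h2 := Real.rpow_le_rpow (Real.rpow_nonneg (hUpos z).le q) h1 (inv_pos.2 hq).le
    rwa [Real.mul_rpow (by positivity) (Real.rpow_nonneg (hUpos y).le q),
      Real.rpow_rpow_inv (hUpos z).le hq.ne', Real.rpow_rpow_inv (hUpos y).le hq.ne'] at h2
  have hUy0 := hUpos y
  have hFz : ∀ z, ‖z - y‖ ≤ d / 2 → F z ≤ C * (4 * m * (C₁ * U y)) := by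
    intro z hz
    refine (hFle z).trans ?_
    have h1 := hV4 z hz
    have h2 := hUz z hz
    have h3 := (hVpos z (hsub z hz).1).le
    have h4 := (hUpos z).le
    change C * (V z * U z) ≤ _
    gcongr
  have hG0 : ∀ x z : EuclideanSpace ℝ (Fin n), 0 ≤ F z * ‖x - z‖ ^ (-((n : ℝ) - 2)) :=
    fun x z => mul_nonneg (hF0 z) (by positivity)
  have hin : ∫ z in ball y (2 * s), F z * ‖y - z‖ ^ (-((n : ℝ) - 2)) ≤ U y / 2 := by
    rw [integral_eq_lintegral_of_nonneg_ae (ae_of_all _ (hG0 y))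
      (hInt y).aestronglyMeasurable.restrict]
    apply ENNReal.toReal_le_of_le_ofReal (by positivity)
    calc _ ≤ ∫⁻ z in ball y (2 * s), ENNReal.ofReal (C * (4 * m * (C₁ * U y))) *
          ENNReal.ofReal (‖y - z‖ ^ (-((n : ℝ) - 2))) := by
          refine setLIntegral_mono' measurableSet_ball fun z hz => ?_
          rw [← ENNReal.ofReal_mul (by positivity)]
          apply ENNReal.ofReal_le_ofReal
          rw [mem_ball, dist_eq_norm] at hz
          have := hFz z (by linarith)
          gcongr
      _ ≤ ENNReal.ofReal (C * (4 * m * (C₁ * U y))) * ENNReal.ofReal (C₃ * (2 * s) ^ 2) := by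
          rw [lintegral_const_mul _ (by fun_prop)]
          gcongr
          exact hball y (2 * s) (by positivity)
      _ ≤ _ := by
          rw [← ENNReal.ofReal_mul (by positivity)]
          apply ENNReal.ofReal_le_ofReal
          calc _ = C₂ * (s ^ 2 * m) * U y := by rw [hC₂]; ring
            _ = C₂ * δ ^ 2 * U y := by rw [hs2]
            _ ≤ 1 / 2 * U y := by gcongr
            _ = _ := by ring
  have hout : U y / 2 ≤ ∫ z in (ball y (2 * s))ᶜ, F z * ‖y - z‖ ^ (-((n : ℝ) - 2)) := by
    have := integral_add_compl (measurableSet_ball (x := y) (ε := 2 * s)) (hInt y)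
    rw [← hUeq y] at this
    linarith
  have hlow : ∀ y' ∈ ball y s, c₃ * U y ≤ U y' := by
    intro y' hy'
    rw [mem_ball, dist_eq_norm] at hy'
    calc c₃ * U y = (3 / 2) ^ (-((n : ℝ) - 2)) * (U y / 2) := by rw [hc₃]; ring
      _ ≤ (3 / 2) ^ (-((n : ℝ) - 2)) *
          ∫ z in (ball y (2 * s))ᶜ, F z * ‖y - z‖ ^ (-((n : ℝ) - 2)) := by gcongr
      _ = ∫ z in (ball y (2 * s))ᶜ,
          (3 / 2) ^ (-((n : ℝ) - 2)) * (F z * ‖y - z‖ ^ (-((n : ℝ) - 2))) := by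
          rw [integral_const_mul]
      _ ≤ ∫ z in (ball y (2 * s))ᶜ, F z * ‖y' - z‖ ^ (-((n : ℝ) - 2)) := by
          refine setIntegral_mono_on ((hInt y).integrableOn.const_mul _) (hInt y').integrableOn
            measurableSet_ball.compl fun z hz => ?_
          rw [mem_compl_iff, mem_ball, dist_comm, dist_eq_norm, not_lt] at hz
          have h1 : ‖y' - z‖ ≤ ‖y' - y‖ + ‖y - z‖ := norm_sub_le_norm_sub_add_norm_sub _ _ _
          have h2 : ‖y' - z‖ ≤ 3 / 2 * ‖y - z‖ := by linarith
          have h3 : ‖y - z‖ ≤ ‖y - y'‖ + ‖y' - z‖ := norm_sub_le_norm_sub_add_norm_sub _ _ _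
          rw [norm_sub_rev y y'] at h3
          have h4 : 0 < ‖y' - z‖ := by linarith
          have h5 := Real.rpow_le_rpow_of_nonpos h4 h2 (z := -((n : ℝ) - 2)) (by linarith)
          rw [Real.mul_rpow (by norm_num) (norm_nonneg _)] at h5
          calc _ = F z * ((3 / 2) ^ (-((n : ℝ) - 2)) * ‖y - z‖ ^ (-((n : ℝ) - 2))) := by ring
            _ ≤ _ := mul_le_mul_of_nonneg_left h5 (hF0 z)
      _ ≤ ∫ z, F z * ‖y' - z‖ ^ (-((n : ℝ) - 2)) :=
          setIntegral_le_integral (hInt y') (ae_of_all _ (hG0 y'))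
      _ = U y' := (hUeq y').symm
  have hVlow : ∀ y' ∈ ball y s, c₄ * m ≤ V y' := by
    intro y' hy'
    have h1 := hlow y' hy'
    rw [mem_ball, dist_eq_norm] at hy'
    have h2 := hnorm y' (hsub y' (by linarith)).1
    have h3 : 0 < ‖y'‖ := hrpos.trans_le h2.1
    calc c₄ * m = (3 * r) ^ (-h) * (c₃ ^ q * (r ^ h * m)) := by
          rw [Real.mul_rpow (by norm_num) hrpos.le, hc₄, Real.rpow_neg hrpos.le]
          field_simp
      _ ≤ (3 * r) ^ (-h) * (c₃ ^ q * U y ^ q) := by gcongr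
      _ = (3 * r) ^ (-h) * (c₃ * U y) ^ q := by rw [Real.mul_rpow hc₃pos.le hUy0.le]
      _ ≤ ‖y'‖ ^ (-h) * U y' ^ q := by
          have := Real.rpow_le_rpow_of_nonpos h3 h2.2 (z := -h) (by linarith)
          gcongr
  calc _ = ENNReal.ofReal ((c₄ * m) ^ ((n : ℝ) / 2)) * volume (ball y s) := by
        rw [Measure.addHaar_ball _ _ hspos.le, finrank_euclideanSpace_fin, ← mul_assoc,
          ← ENNReal.ofReal_mul (by positivity), Real.mul_rpow hc₄pos.le hmpos.le]
        congr 2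
        rw [mul_assoc]
        congr 1
        have e1 : ∀ t : ℝ, 0 ≤ t → t ^ n = (t ^ 2) ^ ((n : ℝ) / 2) := fun t ht => by
          rw [← Real.rpow_natCast t n, ← Real.rpow_natCast t 2, ← Real.rpow_mul ht]
          congr 1; push_cast; ring
        rw [e1 s hspos.le, e1 δ hδpos.le, ← Real.mul_rpow hmpos.le (by positivity), ← hs2,
          mul_comm]
    _ = ∫⁻ z in ball y s, ENNReal.ofReal ((c₄ * m) ^ ((n : ℝ) / 2)) := by simp
    _ ≤ ∫⁻ z in ball y s, ENNReal.ofReal (V z ^ ((n : ℝ) / 2)) := by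
        refine setLIntegral_mono' measurableSet_ball fun z hz => ?_
        apply ENNReal.ofReal_le_ofReal
        have := hVlow z hz
        gcongr
    _ ≤ _ := by
        refine lintegral_mono_set fun z hz => ?_
        rw [mem_ball, dist_eq_norm] at hz
        exact (hnorm z (hsub z (by linarith)).1).1

/-- Under the scale invariant integrability condition, `|x| ^ (2 - h) * U x ^ q` tends to `0`
at infinity. -/
lemma exists_norm_sq_mul_le (hn : 3 ≤ n) {h q C : ℝ} (hh : 0 ≤ h) (hq : 0 < q)
    (hC : 0 < C) {U F : EuclideanSpace ℝ (Fin n) → ℝ} (hU : Continuous U)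
    (hUpos : ∀ x, 0 < U x) (hF0 : ∀ y, 0 ≤ F y)
    (hFle : ∀ y, F y ≤ C * (‖y‖ ^ (-h) * U y ^ q * U y))
    (hInt : ∀ x, Integrable (fun y => F y * ‖x - y‖ ^ (-((n : ℝ) - 2))))
    (hUeq : ∀ x, U x = ∫ y, F y * ‖x - y‖ ^ (-((n : ℝ) - 2)))
    (hfin : Integrable (fun y => (‖y‖ ^ (-h) * U y ^ q) ^ ((n : ℝ) / 2))) {ε : ℝ} (hε : 0 < ε) :
    ∃ R : ℝ, 1 ≤ R ∧ ∀ x : EuclideanSpace ℝ (Fin n), R ≤ ‖x‖ →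
      ‖x‖ ^ 2 * (‖x‖ ^ (-h) * U x ^ q) ≤ ε := by
  obtain ⟨c, hc, hcle⟩ := exists_le_lintegral_of_le_norm_sq_mul hn hh hq hC hε hU hUpos hF0 hFle
    hInt hUeq
  have hlim : Tendsto (fun k : ℕ => ∫⁻ z in {z : EuclideanSpace ℝ (Fin n) | (k : ℝ) ≤ ‖z‖},
      ENNReal.ofReal ((‖z‖ ^ (-h) * U z ^ q) ^ ((n : ℝ) / 2))) atTop (𝓝 0) := by
    have hmeas : ∀ k : ℕ, MeasurableSet {z : EuclideanSpace ℝ (Fin n) | (k : ℝ) ≤ ‖z‖} :=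
      fun k => measurableSet_le measurable_const measurable_norm
    have hm : AEMeasurable (fun z : EuclideanSpace ℝ (Fin n) =>
        ENNReal.ofReal ((‖z‖ ^ (-h) * U z ^ q) ^ ((n : ℝ) / 2))) volume :=
      hfin.aestronglyMeasurable.aemeasurable.ennreal_ofReal
    simp_rw [← lintegral_indicator (hmeas _)]
    rw [← lintegral_zero (μ := (volume : Measure (EuclideanSpace ℝ (Fin n))))]
    refine tendsto_lintegral_of_dominated_convergence' _ (fun k => hm.indicator (hmeas k))
      (fun k => ae_of_all _ fun z => indicator_le_self _ _ z)
      hfin.lintegral_lt_top.ne (ae_of_all _ fun z => ?_)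
    obtain ⟨k, hk⟩ := exists_nat_gt ‖z‖
    refine tendsto_const_nhds.congr' ?_
    filter_upwards [eventually_ge_atTop k] with j hj
    have hkj : (k : ℝ) ≤ j := by exact_mod_cast hj
    rw [indicator_of_notMem]
    simp only [mem_ofPred_eq, not_le]
    linarith
  obtain ⟨k, hk⟩ := ((hlim.eventually (gt_mem_nhds hc)).and (eventually_ge_atTop 1)).exists
  have hk1 : (1 : ℝ) ≤ k := by exact_mod_cast hk.2
  refine ⟨2 * k, by linarith, fun x hx => ?_⟩
  by_contra! hcon
  have hx0 : x ≠ 0 := by rintro rfl; simp at hx; linarith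
  have h1 := hcle x hx0 hcon.le
  refine absurd (h1.trans (lintegral_mono_set fun z hz => ?_)) (not_le.2 hk.1)
  simp only [mem_ofPred_eq] at hz ⊢
  linarith

end Decay

section Reflection

variable {n : ℕ}

/-- Reflection across the hyperplane `{x | ⟪e, x⟫ = t}` (for a unit vector `e`). -/
noncomputable def planeReflection (e : EuclideanSpace ℝ (Fin n)) (t : ℝ)
    (x : EuclideanSpace ℝ (Fin n)) : EuclideanSpace ℝ (Fin n) :=
  x + (2 * (t - inner ℝ e x)) • e

variable {e : EuclideanSpace ℝ (Fin n)} {t : ℝ}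

lemma continuous_planeReflection_uncurry (e : EuclideanSpace ℝ (Fin n)) :
    Continuous fun z : ℝ × EuclideanSpace ℝ (Fin n) => planeReflection e z.1 z.2 := by
  unfold planeReflection
  fun_prop

@[fun_prop]
lemma continuous_planeReflection : Continuous (planeReflection e t) :=
  (continuous_planeReflection_uncurry e).comp (by fun_prop : Continuous fun x => (t, x))

lemma continuous_planeReflection_left (x : EuclideanSpace ℝ (Fin n)) :
    Continuous fun t => planeReflection e t x :=
  (continuous_planeReflection_uncurry e).comp (by fun_prop : Continuous fun t => (t, x))

lemma inner_planeReflection (he : ‖e‖ = 1) (x : EuclideanSpace ℝ (Fin n)) :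
    inner ℝ e (planeReflection e t x) = 2 * t - inner ℝ e x := by
  rw [planeReflection, inner_add_right, inner_smul_right, real_inner_self_eq_norm_sq, he]
  ring

lemma planeReflection_planeReflection (he : ‖e‖ = 1) (x : EuclideanSpace ℝ (Fin n)) :
    planeReflection e t (planeReflection e t x) = x := by
  conv_lhs => rw [planeReflection, inner_planeReflection he, planeReflection]
  rw [add_assoc, ← add_smul]
  convert add_zero x
  convert zero_smul ℝ e
  ring

lemma planeReflection_of_inner_eq {x : EuclideanSpace ℝ (Fin n)} (hx : inner ℝ e x = t) :
    planeReflection e t x = x := by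
  simp [planeReflection, hx]

lemma norm_planeReflection_sq (he : ‖e‖ = 1) (y : EuclideanSpace ℝ (Fin n)) :
    ‖planeReflection e t y‖ ^ 2 = ‖y‖ ^ 2 + 4 * t * (t - inner ℝ e y) := by
  rw [planeReflection, norm_add_sq_real, norm_smul, he, inner_smul_right, real_inner_comm,
    Real.norm_eq_abs, mul_one, sq_abs]
  ring

lemma norm_sub_planeReflection_sq (he : ‖e‖ = 1) (x y : EuclideanSpace ℝ (Fin n)) :
    ‖x - planeReflection e t y‖ ^ 2 =
      ‖x - y‖ ^ 2 + 4 * (t - inner ℝ e x) * (t - inner ℝ e y) := by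
  rw [planeReflection, ← sub_sub, norm_sub_sq_real (x - y), norm_smul, he, inner_smul_right,
    real_inner_comm e (x - y), Real.norm_eq_abs, mul_one, sq_abs, inner_sub_right]
  ring

lemma norm_planeReflection_sub_planeReflection (he : ‖e‖ = 1)
    (x y : EuclideanSpace ℝ (Fin n)) :
    ‖planeReflection e t x - planeReflection e t y‖ = ‖x - y‖ := by
  rw [← sq_eq_sq₀ (norm_nonneg _) (norm_nonneg _), norm_sub_planeReflection_sq he,
    norm_sub_rev, norm_sub_planeReflection_sq he, inner_planeReflection he, norm_sub_rev]
  ring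

lemma norm_sub_planeReflection (he : ‖e‖ = 1) (x y : EuclideanSpace ℝ (Fin n)) :
    ‖x - planeReflection e t y‖ = ‖planeReflection e t x - y‖ := by
  rw [← norm_planeReflection_sub_planeReflection (t := t) he, planeReflection_planeReflection he]

lemma measurePreserving_planeReflection (he : ‖e‖ = 1) :
    MeasurePreserving (planeReflection e t) volume volume := by
  have h1 := (Submodule.reflection (ℝ ∙ e)ᗮ).measurePreserving
  have h2 := measurePreserving_add_right (volume : Measure (EuclideanSpace ℝ (Fin n)))
    ((2 * t) • e)
  have heq : planeReflection e t =
      (fun x => x + (2 * t) • e) ∘ (Submodule.reflection (ℝ ∙ e)ᗮ) := by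
    funext x
    simp only [Function.comp_apply, planeReflection]
    rw [Submodule.reflection_orthogonal_apply, Submodule.reflection_singleton_apply, he]
    simp only [RCLike.ofReal_real_eq_id, id_eq, one_pow, div_one]
    module
  rw [heq]
  exact h2.comp h1

variable {F g : EuclideanSpace ℝ (Fin n) → ℝ} {c : ℝ}

/-- Difference of a Newtonian potential at `x` and at its reflection, in symmetrized form. -/
lemma integrable_and_sub_planeReflection_eq (he : ‖e‖ = 1)
    (hInt : ∀ x, Integrable (fun y => F y * ‖x - y‖ ^ (-((n : ℝ) - 2))))
    (hg : ∀ x, g x = c * ∫ y, F y * ‖x - y‖ ^ (-((n : ℝ) - 2)))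
    (x : EuclideanSpace ℝ (Fin n)) :
    Integrable (fun y => (‖x - y‖ ^ (-((n : ℝ) - 2)) -
        ‖planeReflection e t x - y‖ ^ (-((n : ℝ) - 2))) * (F y - F (planeReflection e t y))) ∧
      2 * (g x - g (planeReflection e t x)) =
        c * ∫ y, (‖x - y‖ ^ (-((n : ℝ) - 2)) -
        ‖planeReflection e t x - y‖ ^ (-((n : ℝ) - 2))) * (F y - F (planeReflection e t y)) := by
  set R := planeReflection e t with hR
  have hmp : MeasurePreserving R volume volume := measurePreserving_planeReflection he
  have hemb : MeasurableEmbedding R :=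
    (Homeomorph.mk ⟨R, R, planeReflection_planeReflection he, planeReflection_planeReflection he⟩
      continuous_planeReflection continuous_planeReflection).measurableEmbedding
  have hi1 := hInt x
  have hi2 := hInt (R x)
  have hi3 : Integrable (fun y => F (R y) * ‖x - y‖ ^ (-((n : ℝ) - 2))) := by
    have := (hmp.integrable_comp_emb hemb).2 hi2
    refine this.congr (ae_of_all _ fun y => ?_)
    simp only [Function.comp_apply]
    rw [hR, norm_planeReflection_sub_planeReflection he]
  have hi4 : Integrable (fun y => F (R y) * ‖R x - y‖ ^ (-((n : ℝ) - 2))) := by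
    have := (hmp.integrable_comp_emb hemb).2 hi1
    refine this.congr (ae_of_all _ fun y => ?_)
    simp only [Function.comp_apply]
    rw [hR, norm_sub_planeReflection he]
  have e3 : ∫ y, F (R y) * ‖x - y‖ ^ (-((n : ℝ) - 2)) =
      ∫ y, F y * ‖R x - y‖ ^ (-((n : ℝ) - 2)) := by
    rw [← hmp.integral_comp hemb]
    refine integral_congr_ae (ae_of_all _ fun y => ?_)
    simp only
    rw [hR, planeReflection_planeReflection he, norm_sub_planeReflection he]
  have e4 : ∫ y, F (R y) * ‖R x - y‖ ^ (-((n : ℝ) - 2)) =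
      ∫ y, F y * ‖x - y‖ ^ (-((n : ℝ) - 2)) := by
    rw [← hmp.integral_comp hemb]
    refine integral_congr_ae (ae_of_all _ fun y => ?_)
    simp only
    rw [hR, norm_planeReflection_sub_planeReflection he, planeReflection_planeReflection he]
  have hfun : (fun y => (‖x - y‖ ^ (-((n : ℝ) - 2)) - ‖R x - y‖ ^ (-((n : ℝ) - 2))) *
      (F y - F (R y))) = fun y => (F y * ‖x - y‖ ^ (-((n : ℝ) - 2)) -
        F y * ‖R x - y‖ ^ (-((n : ℝ) - 2))) - (F (R y) * ‖x - y‖ ^ (-((n : ℝ) - 2)) -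
        F (R y) * ‖R x - y‖ ^ (-((n : ℝ) - 2))) := by
    ext y; ring
  rw [hfun]
  refine ⟨(hi1.sub hi2).sub (hi3.sub hi4), ?_⟩
  have k1 := integral_sub (hi1.sub hi2) (hi3.sub hi4)
  simp only [Pi.sub_apply] at k1
  rw [k1, integral_sub hi1 hi2, integral_sub hi3 hi4, e3, e4, hg x, hg (R x)]
  ring

/-- On the half space containing `x`, the Newtonian kernel with pole `x` dominates the kernel with
reflected pole. -/
lemma newton_kernel_lt (hn : 3 ≤ n) (he : ‖e‖ = 1) {x y : EuclideanSpace ℝ (Fin n)}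
    (hx : inner ℝ e x < t) (hy : inner ℝ e y < t) (hxy : y ≠ x) :
    ‖planeReflection e t x - y‖ ^ (-((n : ℝ) - 2)) < ‖x - y‖ ^ (-((n : ℝ) - 2)) := by
  have hn' : (3 : ℝ) ≤ n := by exact_mod_cast hn
  have h0 : 0 < ‖x - y‖ := norm_pos_iff.2 (sub_ne_zero.2 hxy.symm)
  refine Real.rpow_lt_rpow_of_neg h0 ?_ (by linarith)
  rw [← norm_sub_planeReflection he, ← sq_lt_sq₀ (norm_nonneg _) (norm_nonneg _),
    norm_sub_planeReflection_sq he]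
  nlinarith [mul_pos (sub_pos.2 hx) (sub_pos.2 hy)]

/-- Moving plane comparison inequality for a Newtonian potential. -/
lemma ofReal_sub_planeReflection_le (hn : 3 ≤ n) (he : ‖e‖ = 1) (hc : 0 < c)
    (hFm : Measurable F)
    (hInt : ∀ x, Integrable (fun y => F y * ‖x - y‖ ^ (-((n : ℝ) - 2))))
    (hg : ∀ x, g x = c * ∫ y, F y * ‖x - y‖ ^ (-((n : ℝ) - 2)))
    {x : EuclideanSpace ℝ (Fin n)} (hx : inner ℝ e x < t) :
    ENNReal.ofReal (g x - g (planeReflection e t x)) ≤ ENNReal.ofReal c *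
      ∫⁻ y in {y | inner ℝ e y < t},
        ENNReal.ofReal (‖x - y‖ ^ (-((n : ℝ) - 2)) * (F y - F (planeReflection e t y))) := by
  obtain ⟨hI, hIeq⟩ := integrable_and_sub_planeReflection_eq (t := t) he hInt hg x
  set R := planeReflection e t with hR
  set I : EuclideanSpace ℝ (Fin n) → ℝ := fun y =>
    (‖x - y‖ ^ (-((n : ℝ) - 2)) - ‖R x - y‖ ^ (-((n : ℝ) - 2))) * (F y - F (R y)) with hIdef
  have hmp : MeasurePreserving R volume volume := measurePreserving_planeReflection he
  have hS : MeasurableSet {y : EuclideanSpace ℝ (Fin n) | inner ℝ e y < t} :=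
    measurableSet_lt (by fun_prop) measurable_const
  set J : EuclideanSpace ℝ (Fin n) → ℝ≥0∞ := indicator {y | inner ℝ e y < t} fun y =>
    ENNReal.ofReal (‖x - y‖ ^ (-((n : ℝ) - 2)) * (F y - F (R y))) with hJ
  have hJm : Measurable J := by
    have : Measurable R := continuous_planeReflection.measurable
    refine Measurable.indicator ?_ hS
    fun_prop
  have hIJ : ∀ y, inner ℝ e y < t → y ≠ x → ENNReal.ofReal (I y) ≤ J y := by
    intro y hy hyx
    rw [hJ, indicator_of_mem (by exact hy)]
    rcases le_total (F y - F (R y)) 0 with h0 | h0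
    · have hk := (newton_kernel_lt hn he hx hy hyx).le
      rw [ENNReal.ofReal_of_nonpos (mul_nonpos_of_nonneg_of_nonpos (sub_nonneg.2 hk) h0)]
      exact zero_le
    · apply ENNReal.ofReal_le_ofReal
      have : 0 ≤ ‖R x - y‖ ^ (-((n : ℝ) - 2)) := by positivity
      rw [hIdef]
      simp only
      gcongr
      linarith
  have hIR : ∀ y, I (R y) = I y := by
    intro y
    simp only [hIdef, hR]
    rw [norm_planeReflection_sub_planeReflection he, norm_sub_planeReflection he,
      planeReflection_planeReflection he]
    ring
  have hae : ∀ᵐ y : EuclideanSpace ℝ (Fin n), ENNReal.ofReal (I y) ≤ J y + J (R y) := by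
    have : Nontrivial (EuclideanSpace ℝ (Fin n)) :=
      Module.nontrivial_of_finrank_pos (R := ℝ) (by rw [finrank_euclideanSpace_fin]; omega)
    filter_upwards [Measure.ae_ne volume x, Measure.ae_ne volume (R x)] with y h1 h2
    rcases lt_trichotomy (inner ℝ e y) t with h | h | h
    · exact (hIJ y h h1).trans le_self_add
    · have : I y = 0 := by
        simp only [hIdef, hR]
        rw [planeReflection_of_inner_eq h, sub_self, mul_zero]
      simp [this]
    · rw [← hIR]
      refine (hIJ (R y) ?_ ?_).trans le_add_self
      · rw [hR, inner_planeReflection he]; linarith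
      · rintro h3
        apply h2
        rw [← h3, hR, planeReflection_planeReflection he]
  have hJlin : ∫⁻ y, (J y + J (R y)) = 2 * ∫⁻ y, J y := by
    rw [lintegral_add_left hJm, hmp.lintegral_comp hJm, two_mul]
  have hIle : ENNReal.ofReal (∫ y, I y) ≤ 2 * ∫⁻ y, J y := by
    rw [← hJlin]
    refine le_trans ?_ (lintegral_mono_ae hae)
    rw [integral_eq_lintegral_pos_part_sub_lintegral_neg_part hI]
    refine (ENNReal.ofReal_le_ofReal (sub_le_self _ ENNReal.toReal_nonneg)).trans ?_
    exact ENNReal.ofReal_toReal_le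
  rw [← lintegral_indicator hS]
  change _ ≤ ENNReal.ofReal c * ∫⁻ y, J y
  have h2 : ENNReal.ofReal 2 * ENNReal.ofReal (g x - g (R x)) ≤
      ENNReal.ofReal 2 * (ENNReal.ofReal c * ∫⁻ y, J y) := by
    rw [← ENNReal.ofReal_mul (by norm_num), hIeq, ENNReal.ofReal_mul hc.le]
    calc _ ≤ ENNReal.ofReal c * (2 * ∫⁻ y, J y) := by gcongr
      _ = _ := by rw [show ENNReal.ofReal 2 = 2 by simp]; ring
  exact (ENNReal.mul_le_mul_iff_right (by simp) (by simp)).1 h2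

/-- Rigidity in the moving plane comparison for a Newtonian potential. -/
lemma ae_eq_comp_planeReflection (hn : 3 ≤ n) (he : ‖e‖ = 1) (hc : 0 < c)
    (hInt : ∀ x, Integrable (fun y => F y * ‖x - y‖ ^ (-((n : ℝ) - 2))))
    (hg : ∀ x, g x = c * ∫ y, F y * ‖x - y‖ ^ (-((n : ℝ) - 2)))
    (hF : ∀ᵐ y, inner ℝ e y < t → F y ≤ F (planeReflection e t y))
    {x : EuclideanSpace ℝ (Fin n)} (hx : inner ℝ e x < t)
    (hgx : g (planeReflection e t x) ≤ g x) :
    ∀ᵐ y, inner ℝ e y < t → F y = F (planeReflection e t y) := by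
  obtain ⟨hI, hIeq⟩ := integrable_and_sub_planeReflection_eq (t := t) he hInt hg x
  have hmp := measurePreserving_planeReflection (t := t) he
  have : Nontrivial (EuclideanSpace ℝ (Fin n)) :=
    Module.nontrivial_of_finrank_pos (R := ℝ) (by rw [finrank_euclideanSpace_fin]; omega)
  set R := planeReflection e t with hR
  set I : EuclideanSpace ℝ (Fin n) → ℝ := fun y =>
    (‖x - y‖ ^ (-((n : ℝ) - 2)) - ‖R x - y‖ ^ (-((n : ℝ) - 2))) * (F y - F (R y)) with hIdef
  have hIR : ∀ y, I (R y) = I y := by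
    intro y
    simp only [hIdef, hR]
    rw [norm_planeReflection_sub_planeReflection he, norm_sub_planeReflection he,
      planeReflection_planeReflection he]
    ring
  have hside : ∀ᵐ y : EuclideanSpace ℝ (Fin n), inner ℝ e y < t → I y ≤ 0 := by
    filter_upwards [hF, Measure.ae_ne volume x] with y h1 h2 hy
    have hk := newton_kernel_lt hn he hx hy h2
    exact mul_nonpos_of_nonneg_of_nonpos (sub_nonneg.2 hk.le) (sub_nonpos.2 (h1 hy))
  have hIle : ∀ᵐ y, I y ≤ 0 := by
    filter_upwards [hside, hmp.quasiMeasurePreserving.ae hside] with y h1 h2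
    rcases lt_trichotomy (inner ℝ e y) t with h | h | h
    · exact h1 h
    · simp only [hIdef, hR]
      rw [planeReflection_of_inner_eq h, sub_self, mul_zero]
    · rw [← hIR]
      exact h2 (by rw [hR, inner_planeReflection he]; linarith)
  have hI0 : 0 ≤ ∫ y, I y := by
    by_contra! hneg
    nlinarith [mul_neg_of_pos_of_neg hc hneg]
  have hzero : (fun y => -I y) =ᵐ[volume] 0 := by
    rw [← integral_eq_zero_iff_of_nonneg_ae (hIle.mono fun y hy => neg_nonneg.2 hy) hI.neg]
    have : 0 ≤ ∫ y, -I y := integral_nonneg_of_ae (hIle.mono fun y hy => neg_nonneg.2 hy)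
    rw [integral_neg] at this ⊢
    linarith
  filter_upwards [hzero, Measure.ae_ne volume x] with y h1 h2 hy
  have hk := newton_kernel_lt hn he hx hy h2
  have h3 : I y = 0 := by simpa using h1
  rcases mul_eq_zero.1 h3 with h4 | h4
  · exact absurd (sub_eq_zero.1 h4) hk.ne'
  · exact sub_eq_zero.1 h4

end Reflection

section System

variable {n : ℕ}

/-- The power function lies above its tangent lines, in difference form. -/
lemma rpow_sub_rpow_le {q x y : ℝ} (hq : 1 ≤ q) (hx : 0 < x) (hy : 0 < y) :
    x ^ q - y ^ q ≤ q * x ^ (q - 1) * (x - y) := by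
  have h1 := one_add_mul_self_le_rpow_one_add (s := y / x - 1)
    (by have : 0 < y / x := by positivity
        linarith) hq
  rw [add_sub_cancel, Real.div_rpow hy.le hx.le, le_div_iff₀ (by positivity)] at h1
  have h2 : x ^ q = x ^ (q - 1) * x := by
    rw [← Real.rpow_add_one hx.ne', sub_add_cancel]
  have h3 : (1 + q * (y / x - 1)) * x ^ q = x ^ q + q * x ^ (q - 1) * (y - x) := by
    rw [h2]; field_simp
  linarith

lemma rpow_sub_rpow_le_of_sub_le {p a b a' W : ℝ} (hp : 2 ≤ p) (ha : 0 < a) (hb : 0 < b)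
    (ha' : 0 < a') (hW : 0 ≤ W) (haW : a - a' ≤ W) :
    a ^ p - a' ^ p ≤ p * (a + b) ^ (p - 1) * W := by
  have h0 : 0 ≤ p * (a + b) ^ (p - 1) * W := by positivity
  rcases le_total a a' with h | h
  · have : a ^ p ≤ a' ^ p := by gcongr
    linarith
  · calc a ^ p - a' ^ p ≤ p * a ^ (p - 1) * (a - a') := rpow_sub_rpow_le (by linarith) ha ha'
      _ ≤ p * (a + b) ^ (p - 1) * W := by
        have : 0 ≤ a - a' := sub_nonneg.2 h
        gcongr
        · linarith
        · linarith

lemma rpow_mul_sub_rpow_mul_le_of_sub_le {p a b a' b' W : ℝ} (hp : 2 ≤ p) (ha : 0 < a)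
    (hb : 0 < b) (ha' : 0 < a') (hb' : 0 < b') (hW : 0 ≤ W) (haW : a - a' ≤ W)
    (hbW : b - b' ≤ W) :
    a ^ (p - 1) * b - a' ^ (p - 1) * b' ≤ p * (a + b) ^ (p - 1) * W := by
  set α := min a a' with hα
  set β := min b b' with hβ
  have hα0 : 0 < α := lt_min ha ha'
  have hβ0 : 0 < β := lt_min hb hb'
  have hαa : α ≤ a := min_le_left _ _
  have hβb : β ≤ b := min_le_left _ _
  have hαW : a - α ≤ W := by
    rcases min_choice a a' with h | h <;> rw [hα, h] <;> linarith
  have hβW : b - β ≤ W := by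
    rcases min_choice b b' with h | h <;> rw [hβ, h] <;> linarith
  have h1 : α ^ (p - 1) * β ≤ a' ^ (p - 1) * b' := by
    gcongr
    · linarith
    · exact min_le_right _ _
    · exact min_le_right _ _
  have h2 : a ^ (p - 1) - α ^ (p - 1) ≤ (p - 1) * a ^ (p - 1 - 1) * (a - α) :=
    rpow_sub_rpow_le (by linarith) ha hα0
  have h3 : (a + b) ^ (p - 1) = (a + b) ^ (p - 1 - 1) * (a + b) := by
    rw [← Real.rpow_add_one (by positivity), sub_add_cancel]
  have h4 : (a ^ (p - 1) - α ^ (p - 1)) * β ≤ (p - 1) * (a + b) ^ (p - 1) * W := by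
    calc _ ≤ ((p - 1) * a ^ (p - 1 - 1) * (a - α)) * β := by gcongr
      _ ≤ ((p - 1) * (a + b) ^ (p - 1 - 1) * W) * (a + b) := by
        have : 0 ≤ a - α := by linarith
        have : 0 ≤ p - 1 := by linarith
        gcongr
        · linarith
        · linarith
        · linarith
      _ = _ := by rw [h3]; ring
  have h5 : a ^ (p - 1) * (b - β) ≤ (a + b) ^ (p - 1) * W := by
    gcongr
    · linarith
    · linarith
  linarith

/-- Positive continuous solutions of the weighted integral system
`u = c₁ ∫ u^(p-1) v |y|^(-h) |x-y|^(2-n) dy`, `v = c₂ ∫ u^p |y|^(-h) |x-y|^(2-n) dy`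
with finite critical energies. -/
structure IsWeightedSolution (p h : ℝ) (u v : EuclideanSpace ℝ (Fin n) → ℝ)
    (c₁ c₂ : ℝ) : Prop where
  three_le : 3 ≤ n
  two_le : 2 ≤ p
  weight_nonneg : 0 ≤ h
  c₁_pos : 0 < c₁
  c₂_pos : 0 < c₂
  continuous_fst : Continuous u
  continuous_snd : Continuous v
  fst_pos : ∀ x, 0 < u x
  snd_pos : ∀ x, 0 < v x
  integrable_fst : ∀ x : EuclideanSpace ℝ (Fin n),
    Integrable (fun y => u y ^ (p - 1) * v y * ‖y‖ ^ (-h) * ‖x - y‖ ^ (-((n : ℝ) - 2)))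
  integrable_snd : ∀ x : EuclideanSpace ℝ (Fin n),
    Integrable (fun y => u y ^ p * ‖y‖ ^ (-h) * ‖x - y‖ ^ (-((n : ℝ) - 2)))
  fst_eq : ∀ x : EuclideanSpace ℝ (Fin n),
    u x = c₁ * ∫ y, u y ^ (p - 1) * v y * ‖y‖ ^ (-h) * ‖x - y‖ ^ (-((n : ℝ) - 2))
  snd_eq : ∀ x : EuclideanSpace ℝ (Fin n),
    v x = c₂ * ∫ y, u y ^ p * ‖y‖ ^ (-h) * ‖x - y‖ ^ (-((n : ℝ) - 2))
  energy_fst : Integrable (fun y : EuclideanSpace ℝ (Fin n) =>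
    ‖y‖ ^ (-((n : ℝ) * h / 2)) * u y ^ ((n : ℝ) * (p - 1) / 2))
  energy_snd : Integrable (fun y : EuclideanSpace ℝ (Fin n) =>
    ‖y‖ ^ (-((n : ℝ) * h / 2)) * v y ^ ((n : ℝ) * (p - 1) / 2))

namespace IsWeightedSolution

variable {p h c₁ c₂ : ℝ} {u v : EuclideanSpace ℝ (Fin n) → ℝ}

lemma nontrivial (H : IsWeightedSolution p h u v c₁ c₂) :
    Nontrivial (EuclideanSpace ℝ (Fin n)) :=
  Module.nontrivial_of_finrank_pos (R := ℝ) (by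
    rw [finrank_euclideanSpace_fin]; have := H.three_le; omega)

/-- The potential `|x|^(-h) (u+v)^(p-1)` is `o(|x|^(-2))` at infinity. -/
lemma exists_norm_sq_mul_potential_le (H : IsWeightedSolution p h u v c₁ c₂) {ε : ℝ}
    (hε : 0 < ε) :
    ∃ R, 1 ≤ R ∧ ∀ x, R ≤ ‖x‖ → ‖x‖ ^ 2 * (‖x‖ ^ (-h) * (u x + v x) ^ (p - 1)) ≤ ε := by
  have hp := H.two_le
  have hn : (3 : ℝ) ≤ n := by exact_mod_cast H.three_le
  have hc₁ := H.c₁_pos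
  have hc₂ := H.c₂_pos
  have hu := H.continuous_fst.measurable
  have hv := H.continuous_snd.measurable
  have hUpos : ∀ x, 0 < u x + v x := fun x => add_pos (H.fst_pos x) (H.snd_pos x)
  set F : EuclideanSpace ℝ (Fin n) → ℝ := fun y =>
    c₁ * (u y ^ (p - 1) * v y * ‖y‖ ^ (-h)) + c₂ * (u y ^ p * ‖y‖ ^ (-h)) with hF
  have hFG : ∀ x : EuclideanSpace ℝ (Fin n), (fun y => F y * ‖x - y‖ ^ (-((n : ℝ) - 2))) =
      fun y => c₁ * (u y ^ (p - 1) * v y * ‖y‖ ^ (-h) * ‖x - y‖ ^ (-((n : ℝ) - 2))) +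
        c₂ * (u y ^ p * ‖y‖ ^ (-h) * ‖x - y‖ ^ (-((n : ℝ) - 2))) := by
    intro x; funext y; simp only [hF]; ring
  refine exists_norm_sq_mul_le (U := fun x => u x + v x) (F := F) (q := p - 1) (C := c₁ + c₂)
    H.three_le H.weight_nonneg (by linarith) (by positivity)
    (H.continuous_fst.add H.continuous_snd) hUpos ?_ ?_ ?_ ?_ ?_ hε
  · intro y
    have := (H.fst_pos y).le
    have := (H.snd_pos y).le
    positivity
  · intro y
    have h1 := H.fst_pos y
    have h2 := H.snd_pos y
    have h3 : u y ^ p = u y ^ (p - 1) * u y := by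
      rw [← Real.rpow_add_one h1.ne', sub_add_cancel]
    calc F y = (c₁ * (u y ^ (p - 1) * v y) + c₂ * (u y ^ (p - 1) * u y)) * ‖y‖ ^ (-h) := by
          simp only [hF]; rw [h3]; ring
      _ ≤ (c₁ * ((u y + v y) ^ (p - 1) * (u y + v y)) +
          c₂ * ((u y + v y) ^ (p - 1) * (u y + v y))) * ‖y‖ ^ (-h) := by
          gcongr <;> linarith
      _ = _ := by ring
  · intro x
    rw [hFG]
    exact ((H.integrable_fst x).const_mul c₁).add ((H.integrable_snd x).const_mul c₂)
  · intro x
    rw [hFG, integral_add ((H.integrable_fst x).const_mul c₁) ((H.integrable_snd x).const_mul c₂),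
      integral_const_mul, integral_const_mul, ← H.fst_eq, ← H.snd_eq]
  · set s := (n : ℝ) * (p - 1) / 2 with hs
    have hs0 : 0 < s := by
      have : 0 < p - 1 := by linarith
      positivity
    refine Integrable.mono' ((H.energy_fst.add H.energy_snd).const_mul (2 ^ s))
      (Measurable.aestronglyMeasurable (by fun_prop)) (ae_of_all _ fun y => ?_)
    have h1 := H.fst_pos y
    have h2 := H.snd_pos y
    have h3 : (u y + v y) ^ s ≤ 2 ^ s * (u y ^ s + v y ^ s) := by
      rcases le_total (u y) (v y) with h | h
      · calc (u y + v y) ^ s ≤ (2 * v y) ^ s := by gcongr; linarith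
          _ = 2 ^ s * v y ^ s := Real.mul_rpow (by norm_num) h2.le
          _ ≤ _ := by
            have : 0 < u y ^ s := by positivity
            gcongr; linarith
      · calc (u y + v y) ^ s ≤ (2 * u y) ^ s := by gcongr; linarith
          _ = 2 ^ s * u y ^ s := Real.mul_rpow (by norm_num) h1.le
          _ ≤ _ := by
            have : 0 < v y ^ s := by positivity
            gcongr; linarith
    rw [Real.norm_of_nonneg (by positivity), Real.mul_rpow (by positivity) (by positivity),
      ← Real.rpow_mul (norm_nonneg _), ← Real.rpow_mul (by positivity)]
    rw [show -h * ((n : ℝ) / 2) = -((n : ℝ) * h / 2) by ring,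
      show (p - 1) * ((n : ℝ) / 2) = s by rw [hs]; ring]
    simp only [Pi.add_apply]
    calc _ ≤ ‖y‖ ^ (-((n : ℝ) * h / 2)) * (2 ^ s * (u y ^ s + v y ^ s)) := by gcongr
      _ = _ := by ring

/-- Finiteness of the critical energy forces the weight to be subcritical. -/
lemma weight_lt_two (H : IsWeightedSolution p h u v c₁ c₂) : h < 2 := by
  have := H.nontrivial
  have hn : (3 : ℝ) ≤ n := by exact_mod_cast H.three_le
  have hp := H.two_le
  obtain ⟨x₀, -, hx₀⟩ := (isCompact_closedBall (0 : EuclideanSpace ℝ (Fin n)) 1).exists_isMinOn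
    ⟨0, by simp⟩ H.continuous_fst.continuousOn
  set m := u x₀ with hm
  have hm0 : 0 < m := H.fst_pos x₀
  set s := (n : ℝ) * (p - 1) / 2 with hs
  have hs0 : 0 < s := by
    have : 0 < p - 1 := by linarith
    positivity
  have h1 : IntegrableOn (fun y : EuclideanSpace ℝ (Fin n) => ‖y‖ ^ (-((n : ℝ) * h / 2)))
      (ball 0 1) := by
    refine Integrable.mono' ((H.energy_fst.integrableOn (s := ball 0 1)).const_mul ((m ^ s)⁻¹))
      (Measurable.aestronglyMeasurable (by fun_prop)) ?_
    filter_upwards [ae_restrict_mem measurableSet_ball] with y hy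
    have h2 : m ≤ u y := hx₀ (ball_subset_closedBall hy)
    rw [Real.norm_of_nonneg (by positivity), ← div_eq_inv_mul, le_div_iff₀ (by positivity)]
    gcongr
  have h2 := (integrableOn_fun_norm_addHaar (volume : Measure (EuclideanSpace ℝ (Fin n)))
    (f := fun r : ℝ => r ^ (-((n : ℝ) * h / 2)))).1 h1
  have h3 : IntegrableOn (fun r : ℝ => r ^ ((n : ℝ) - 1 + -((n : ℝ) * h / 2))) (Ioo 0 1) := by
    refine h2.congr_fun (fun r hr => ?_) measurableSet_Ioo
    have hn1 : 1 ≤ n := by have := H.three_le; omega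
    simp only [finrank_euclideanSpace_fin, smul_eq_mul]
    rw [Real.rpow_add hr.1, ← Real.rpow_natCast, Nat.cast_sub hn1, Nat.cast_one]
  rw [intervalIntegral.integrableOn_Ioo_rpow_iff one_pos] at h3
  nlinarith

/-- Power decay of solutions at infinity. -/
lemma exists_add_le_rpow (H : IsWeightedSolution p h u v c₁ c₂) :
    ∃ α C, 0 < α ∧ α < (n : ℝ) - 2 ∧ 0 < C ∧ ∀ x, u x + v x ≤ C * (1 + ‖x‖) ^ (-α) := by
  have hn : (3 : ℝ) ≤ n := by exact_mod_cast H.three_le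
  have hp := H.two_le
  have hh := H.weight_lt_two
  have hUpos : ∀ x, 0 < u x + v x := fun x => add_pos (H.fst_pos x) (H.snd_pos x)
  obtain ⟨R, hR1, hR⟩ := H.exists_norm_sq_mul_potential_le one_pos
  obtain ⟨x₀, -, hx₀⟩ := (isCompact_closedBall (0 : EuclideanSpace ℝ (Fin n)) R).exists_isMaxOn
    ⟨0, mem_closedBall_self (by linarith)⟩ (H.continuous_fst.add H.continuous_snd).continuousOn
  set B := u x₀ + v x₀ with hB
  have hB0 : 0 < B := hUpos x₀
  set α := min ((2 - h) / (p - 1)) (((n : ℝ) - 2) / 2) with hα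
  have hα0 : 0 < α := lt_min (div_pos (by linarith) (by linarith)) (by linarith)
  refine ⟨α, 2 ^ α + B * (1 + R) ^ α, hα0, (min_le_right _ _).trans_lt (by linarith),
    by positivity, fun x => ?_⟩
  rw [Real.rpow_neg (by positivity), ← div_eq_mul_inv, le_div_iff₀ (by positivity)]
  rcases le_total ‖x‖ R with h1 | h1
  · have h2 : u x + v x ≤ B := hx₀ (by simpa using h1)
    calc _ ≤ B * (1 + R) ^ α := by gcongr
      _ ≤ _ := by
        have : (0 : ℝ) < 2 ^ α := by positivity
        linarith
  · have hx1 : 1 ≤ ‖x‖ := hR1.trans h1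
    have hx0 : 0 < ‖x‖ := by linarith
    have h2 := hR x h1
    have h3 : (u x + v x) ^ (p - 1) ≤ ‖x‖ ^ (-(2 - h)) := by
      have h4 : ‖x‖ ^ 2 * ‖x‖ ^ (-h) = ‖x‖ ^ (2 - h) := by
        rw [← Real.rpow_natCast, ← Real.rpow_add hx0]; norm_num [sub_eq_add_neg]
      rw [← mul_assoc, h4] at h2
      rw [Real.rpow_neg hx0.le, ← one_div, le_div_iff₀ (by positivity)]
      linarith
    have h5 : u x + v x ≤ ‖x‖ ^ (-α) := by
      have h6 : ‖x‖ ^ (-(2 - h)) ≤ (‖x‖ ^ (-α)) ^ (p - 1) := by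
        rw [← Real.rpow_mul hx0.le]
        refine Real.rpow_le_rpow_of_exponent_le hx1 ?_
        have : α ≤ (2 - h) / (p - 1) := min_le_left _ _
        rw [le_div_iff₀ (by linarith)] at this
        linarith
      exact (Real.rpow_le_rpow_iff (hUpos x).le (by positivity) (by linarith : 0 < p - 1)).1
        (h3.trans h6)
    calc (u x + v x) * (1 + ‖x‖) ^ α ≤ ‖x‖ ^ (-α) * (2 * ‖x‖) ^ α := by
          gcongr; linarith
      _ = 2 ^ α := by
        rw [Real.mul_rpow (by norm_num) hx0.le, Real.rpow_neg hx0.le]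
        field_simp
      _ ≤ _ := by
        have : 0 ≤ B * (1 + R) ^ α := by positivity
        linarith

end IsWeightedSolution

end System

section Comparison

variable {n : ℕ} {p h c₁ c₂ : ℝ} {u v : EuclideanSpace ℝ (Fin n) → ℝ}
  {e : EuclideanSpace ℝ (Fin n)} {t : ℝ}

/-- The hyperplane `{y | ⟪e, y⟫ = t}` is Lebesgue null. -/
lemma ae_inner_ne (he : ‖e‖ = 1) (t : ℝ) : ∀ᵐ y : EuclideanSpace ℝ (Fin n), inner ℝ e y ≠ t := by
  have h1 : volume (((ℝ ∙ e)ᗮ : Submodule ℝ (EuclideanSpace ℝ (Fin n))) :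
      Set (EuclideanSpace ℝ (Fin n))) = 0 := by
    refine Measure.addHaar_submodule _ _ fun h => ?_
    have h2 : e ∈ (ℝ ∙ e)ᗮ := h ▸ Submodule.mem_top
    rw [Submodule.mem_orthogonal_singleton_iff_inner_right, real_inner_self_eq_norm_sq, he] at h2
    norm_num at h2
  rw [← measure_preimage_add_right volume (-(t • e))] at h1
  rw [ae_iff]
  convert h1 using 2
  ext y
  simp only [mem_preimage, SetLike.mem_coe, Submodule.mem_orthogonal_singleton_iff_inner_right,
    inner_add_right, inner_neg_right, inner_smul_right, real_inner_self_eq_norm_sq, he]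
  simp only [not_not, mem_ofPred_eq]
  constructor <;> intro h <;> linarith

/-- `max (u - u ∘ R) (v - v ∘ R) 0`, where `R` is the reflection across `{y | ⟪e, y⟫ = t}`. -/
noncomputable def planeExcess (u v : EuclideanSpace ℝ (Fin n) → ℝ)
    (e : EuclideanSpace ℝ (Fin n)) (t : ℝ) (x : EuclideanSpace ℝ (Fin n)) : ℝ :=
  max (max (u x - u (planeReflection e t x)) (v x - v (planeReflection e t x))) 0

lemma planeExcess_nonneg (x : EuclideanSpace ℝ (Fin n)) : 0 ≤ planeExcess u v e t x :=
  le_max_right _ _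

lemma sub_le_planeExcess_fst (x : EuclideanSpace ℝ (Fin n)) :
    u x - u (planeReflection e t x) ≤ planeExcess u v e t x :=
  (le_max_left _ _).trans (le_max_left _ _)

lemma sub_le_planeExcess_snd (x : EuclideanSpace ℝ (Fin n)) :
    v x - v (planeReflection e t x) ≤ planeExcess u v e t x :=
  (le_max_right _ _).trans (le_max_left _ _)

/-- The weight `|y|^(-h)` increases under reflections which bring points closer to the origin. -/
lemma norm_rpow_neg_le_planeReflection (hh : 0 ≤ h) (he : ‖e‖ = 1) (ht : h = 0 ∨ t < 0)
    {y : EuclideanSpace ℝ (Fin n)} (hy : inner ℝ e y < t) (hy0 : planeReflection e t y ≠ 0) :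
    ‖y‖ ^ (-h) ≤ ‖planeReflection e t y‖ ^ (-h) := by
  rcases ht with rfl | ht
  · simp
  · refine Real.rpow_le_rpow_of_nonpos (norm_pos_iff.2 hy0) ?_ (by linarith)
    rw [← sq_le_sq₀ (norm_nonneg _) (norm_nonneg _), norm_planeReflection_sq he]
    nlinarith [mul_neg_of_neg_of_pos ht (sub_pos.2 hy)]

lemma ofReal_sub_planeReflection_le_of_le (hn : 3 ≤ n) (he : ‖e‖ = 1)
    {F g D : EuclideanSpace ℝ (Fin n) → ℝ} {c C : ℝ}
    (hc : 0 < c) (hcC : c ≤ C) (hFm : Measurable F)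
    (hInt : ∀ x, Integrable (fun y => F y * ‖x - y‖ ^ (-((n : ℝ) - 2))))
    (hg : ∀ x, g x = c * ∫ y, F y * ‖x - y‖ ^ (-((n : ℝ) - 2)))
    (hD : ∀ y, 0 ≤ D y)
    (hF : ∀ᵐ y, inner ℝ e y < t → F y - F (planeReflection e t y) ≤ D y)
    {x : EuclideanSpace ℝ (Fin n)} (hx : inner ℝ e x < t) :
    ENNReal.ofReal (g x - g (planeReflection e t x)) ≤
      ∫⁻ y in {y | inner ℝ e y < t}, ENNReal.ofReal (C * (‖x - y‖ ^ (-((n : ℝ) - 2)) * D y)) := by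
  refine (ofReal_sub_planeReflection_le hn he hc hFm hInt hg hx).trans ?_
  rw [← lintegral_const_mul' _ _ ENNReal.ofReal_ne_top]
  have hS : MeasurableSet {y : EuclideanSpace ℝ (Fin n) | inner ℝ e y < t} :=
    measurableSet_lt (by fun_prop) measurable_const
  refine lintegral_mono_ae ?_
  filter_upwards [ae_restrict_mem hS, ae_restrict_of_ae hF] with y hy h1
  rw [← ENNReal.ofReal_mul hc.le]
  apply ENNReal.ofReal_le_ofReal
  have := hD y
  calc _ ≤ c * (‖x - y‖ ^ (-((n : ℝ) - 2)) * D y) := by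
        gcongr
        exact h1 hy
    _ ≤ _ := by gcongr

namespace IsWeightedSolution

lemma ofReal_planeExcess_le (H : IsWeightedSolution p h u v c₁ c₂) (he : ‖e‖ = 1)
    (ht : h = 0 ∨ t < 0) {x : EuclideanSpace ℝ (Fin n)} (hx : inner ℝ e x < t) :
    ENNReal.ofReal (planeExcess u v e t x) ≤ ∫⁻ y in {y | inner ℝ e y < t},
      ENNReal.ofReal ((c₁ + c₂) * (‖x - y‖ ^ (-((n : ℝ) - 2)) *
        (‖y‖ ^ (-h) * (p * (u y + v y) ^ (p - 1) * planeExcess u v e t y)))) := by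
  have hn := H.three_le
  have hp := H.two_le
  have hh := H.weight_nonneg
  have hc₁ := H.c₁_pos
  have hc₂ := H.c₂_pos
  have hu := H.continuous_fst.measurable
  have hv := H.continuous_snd.measurable
  have hupos := H.fst_pos
  have hvpos := H.snd_pos
  have := H.nontrivial
  have hne : ∀ᵐ y, planeReflection e t y ≠ 0 := by
    filter_upwards [Measure.ae_ne volume (planeReflection e t 0)] with y hy h0
    rw [← h0, planeReflection_planeReflection he] at hy
    exact hy rfl
  have hD : ∀ y, 0 ≤ ‖y‖ ^ (-h) * (p * (u y + v y) ^ (p - 1) * planeExcess u v e t y) := by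
    intro y
    have := (hupos y).le
    have := (hvpos y).le
    have : 0 ≤ planeExcess u v e t y := planeExcess_nonneg y
    positivity
  have hwt : ∀ a b D : ℝ, ∀ y, 0 ≤ b → planeReflection e t y ≠ 0 → inner ℝ e y < t →
      a - b ≤ D → a * ‖y‖ ^ (-h) - b * ‖planeReflection e t y‖ ^ (-h) ≤ ‖y‖ ^ (-h) * D := by
    intro a b D y hb hy0 hy hab
    have h1 := norm_rpow_neg_le_planeReflection hh he ht hy hy0
    calc _ ≤ a * ‖y‖ ^ (-h) - b * ‖y‖ ^ (-h) := by gcongr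
      _ = ‖y‖ ^ (-h) * (a - b) := by ring
      _ ≤ _ := by gcongr
  have h1 : ENNReal.ofReal (u x - u (planeReflection e t x)) ≤ _ :=
    ofReal_sub_planeReflection_le_of_le (C := c₁ + c₂) hn he hc₁ (by linarith)
      (by fun_prop) H.integrable_fst H.fst_eq hD (by
      filter_upwards [hne] with y hy0 hy
      refine hwt _ _ _ y ?_ hy0 hy ?_
      · have := (hupos (planeReflection e t y)).le
        have := (hvpos (planeReflection e t y)).le
        positivity
      · exact rpow_mul_sub_rpow_mul_le_of_sub_le hp (hupos _) (hvpos _) (hupos _) (hvpos _)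
          (planeExcess_nonneg y) (sub_le_planeExcess_fst y) (sub_le_planeExcess_snd y)) hx
  have h2 : ENNReal.ofReal (v x - v (planeReflection e t x)) ≤ _ :=
    ofReal_sub_planeReflection_le_of_le (C := c₁ + c₂) hn he hc₂ (by linarith)
      (by fun_prop) H.integrable_snd H.snd_eq hD (by
      filter_upwards [hne] with y hy0 hy
      refine hwt _ _ _ y ?_ hy0 hy ?_
      · have := (hupos (planeReflection e t y)).le
        positivity
      · exact rpow_sub_rpow_le_of_sub_le hp (hupos _) (hvpos _) (hupos _)
          (planeExcess_nonneg y) (sub_le_planeExcess_fst y)) hx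
  rw [planeExcess, ENNReal.ofReal_max, ENNReal.ofReal_max, ENNReal.ofReal_zero]
  exact max_le (max_le h1 h2) bot_le

/-- If the points violating the moving plane inequality asymptotically disappear along `l`, then
the moving plane inequality eventually holds along `l`. -/
lemma eventually_le_planeReflection (H : IsWeightedSolution p h u v c₁ c₂) (he : ‖e‖ = 1)
    {l : Filter ℝ} [l.IsCountablyGenerated] (hl : ∀ᶠ t in l, h = 0 ∨ t < 0)
    (hM : ∃ M, ∀ᶠ t in l, ∀ y : EuclideanSpace ℝ (Fin n), inner ℝ e y < t → ‖y‖ ^ (-h) ≤ M)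
    (hbad : ∀ᵐ y : EuclideanSpace ℝ (Fin n), ∀ᶠ t in l, inner ℝ e y < t →
      u y ≤ u (planeReflection e t y) ∧ v y ≤ v (planeReflection e t y)) :
    ∀ᶠ t in l, ∀ x, inner ℝ e x < t →
      u x ≤ u (planeReflection e t x) ∧ v x ≤ v (planeReflection e t x) := by
  have hn := H.three_le
  have hp := H.two_le
  have hc₁ := H.c₁_pos
  have hc₂ := H.c₂_pos
  have hu := H.continuous_fst
  have hv := H.continuous_snd
  have hUpos : ∀ x, 0 < u x + v x := fun x => add_pos (H.fst_pos x) (H.snd_pos x)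
  obtain ⟨M, hM⟩ := hM
  obtain ⟨α, C, hα, hαn, hC, hUC⟩ := H.exists_add_le_rpow
  obtain ⟨Cn, hCn, hnewton⟩ := exists_lintegral_newton_rpow_le hn hα hαn
  obtain ⟨R, hR1, hR⟩ := H.exists_norm_sq_mul_potential_le
    (ε := (4 * ((c₁ + c₂) * p * Cn))⁻¹) (by positivity)
  set M' := |M| * C ^ (p - 1) + 1 with hM'
  have hM'0 : 0 < M' := by positivity
  obtain ⟨δ, hδ, hsmall⟩ := exists_lintegral_newton_small (n := n) (α := α) (R := R)
    (η := (4 * ((c₁ + c₂) * p * M'))⁻¹) hn hα.le hαn.le (by linarith) (by positivity)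
  set φ : EuclideanSpace ℝ (Fin n) → ℝ := fun x => (1 + ‖x‖) ^ (-α) with hφ
  have hφ0 : ∀ x, 0 < φ x := fun x => by simp only [hφ]; positivity
  have hφ1 : ∀ x, φ x ≤ 1 := fun x =>
    Real.rpow_le_one_of_one_le_of_nonpos (by linarith [norm_nonneg x]) (by linarith)
  set V : EuclideanSpace ℝ (Fin n) → ℝ := fun y => ‖y‖ ^ (-h) * (u y + v y) ^ (p - 1) with hV
  have hV0 : ∀ y, 0 ≤ V y := fun y => by have := (hUpos y).le; simp only [hV]; positivity
  set Bad : ℝ → Set (EuclideanSpace ℝ (Fin n)) := fun t => {y | inner ℝ e y < t ∧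
    (u (planeReflection e t y) < u y ∨ v (planeReflection e t y) < v y)} with hBad
  have hBadm : ∀ t, MeasurableSet (Bad t) := by
    intro t
    have hS : MeasurableSet {y : EuclideanSpace ℝ (Fin n) | inner ℝ e y < t} :=
      measurableSet_lt (by fun_prop) measurable_const
    have h1 := hS.inter
      ((measurableSet_lt (hu.comp (continuous_planeReflection (e := e) (t := t))).measurable
        hu.measurable).union
      (measurableSet_lt (hv.comp (continuous_planeReflection (e := e) (t := t))).measurable
        hv.measurable))
    exact h1
  have hlim : Tendsto (fun t => volume (Bad t ∩ closedBall 0 R)) l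
      (𝓝 (volume (∅ : Set (EuclideanSpace ℝ (Fin n))))) := by
    refine tendsto_measure_of_ae_tendsto_indicator (B := closedBall 0 R) l MeasurableSet.empty
      (fun t => (hBadm t).inter measurableSet_closedBall) measurableSet_closedBall
      measure_closedBall_lt_top.ne (Eventually.of_forall fun t => inter_subset_right) ?_
    filter_upwards [hbad] with y hy
    filter_upwards [hy] with t ht
    simp only [mem_empty_iff_false, iff_false]
    rintro ⟨⟨h1, h2⟩, -⟩
    rcases h2 with h2 | h2
    · exact absurd (ht h1).1 h2.not_ge
    · exact absurd (ht h1).2 h2.not_ge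
  rw [measure_empty] at hlim
  filter_upwards [hl, hM, hlim.eventually_lt_const hδ] with t ht hMt hvol
  have hkey : ∀ x, ∫⁻ y in Bad t, ENNReal.ofReal ((c₁ + c₂) * (‖x - y‖ ^ (-((n : ℝ) - 2)) *
      (p * V y * φ y))) ≤ ENNReal.ofReal (φ x / 2) := by
    intro x
    have hφx := hφ0 x
    rw [← lintegral_inter_add_sdiff _ (Bad t) (measurableSet_closedBall (x := 0) (ε := R)),
      show φ x / 2 = φ x / 4 + φ x / 4 by ring, ENNReal.ofReal_add (by positivity) (by positivity)]
    refine add_le_add ?_ ?_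
    · calc _ ≤ ∫⁻ y in Bad t ∩ closedBall 0 R, ENNReal.ofReal ((c₁ + c₂) * p * M') *
            ENNReal.ofReal (‖x - y‖ ^ (-((n : ℝ) - 2))) := by
            refine setLIntegral_mono' ((hBadm t).inter measurableSet_closedBall) fun y hy => ?_
            rw [← ENNReal.ofReal_mul (by positivity)]
            apply ENNReal.ofReal_le_ofReal
            have hω : ‖y‖ ^ (-h) ≤ |M| := (hMt y hy.1.1).trans (le_abs_self M)
            have hU : u y + v y ≤ C := (hUC y).trans (mul_le_of_le_one_right hC.le (hφ1 y))
            have hVy : V y ≤ M' := by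
              have h1 : V y ≤ |M| * C ^ (p - 1) := by
                simp only [hV]
                have := (hUpos y).le
                gcongr
                linarith
              linarith
            have hVφ : V y * φ y ≤ M' := by
              calc _ ≤ M' * 1 := by
                    have := hV0 y
                    have := (hφ0 y).le
                    gcongr
                    exact hφ1 y
                _ = _ := mul_one _
            calc _ = (c₁ + c₂) * p * (V y * φ y) * ‖x - y‖ ^ (-((n : ℝ) - 2)) := by ring
              _ ≤ _ := by gcongr
        _ = ENNReal.ofReal ((c₁ + c₂) * p * M') * ∫⁻ y in Bad t ∩ closedBall 0 R,
            ENNReal.ofReal (‖x - y‖ ^ (-((n : ℝ) - 2))) :=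
            lintegral_const_mul' _ _ ENNReal.ofReal_ne_top
        _ ≤ ENNReal.ofReal ((c₁ + c₂) * p * M') *
            ENNReal.ofReal ((4 * ((c₁ + c₂) * p * M'))⁻¹ * φ x) := by
            gcongr
            exact hsmall _ inter_subset_right ((hBadm t).inter measurableSet_closedBall) hvol x
        _ = _ := by
            rw [← ENNReal.ofReal_mul (by positivity)]
            congr 1
            field_simp
    · calc _ ≤ ∫⁻ y in Bad t \ closedBall 0 R, ENNReal.ofReal
              ((c₁ + c₂) * p * (4 * ((c₁ + c₂) * p * Cn))⁻¹) *
            ENNReal.ofReal (‖x - y‖ ^ (-((n : ℝ) - 2)) * ‖y‖ ^ (-2 - α)) := by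
            refine setLIntegral_mono' ((hBadm t).diff measurableSet_closedBall) fun y hy => ?_
            rw [← ENNReal.ofReal_mul (by positivity)]
            apply ENNReal.ofReal_le_ofReal
            have hyR : R ≤ ‖y‖ := by
              have := hy.2
              rw [mem_closedBall_zero_iff, not_le] at this
              exact this.le
            have hy0 : 0 < ‖y‖ := by linarith
            have hVy := hR y hyR
            have hφy : φ y ≤ ‖y‖ ^ (-α) :=
              Real.rpow_le_rpow_of_nonpos hy0 (by linarith) (by linarith)
            have hVφ : V y * φ y ≤ (4 * ((c₁ + c₂) * p * Cn))⁻¹ * ‖y‖ ^ (-2 - α) := by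
              have h1 : ‖y‖ ^ (-2 - α) = (‖y‖ ^ 2)⁻¹ * ‖y‖ ^ (-α) := by
                rw [sub_eq_add_neg, Real.rpow_add hy0, Real.rpow_neg hy0.le]
                norm_num
              have h2 : V y ≤ (4 * ((c₁ + c₂) * p * Cn))⁻¹ * (‖y‖ ^ 2)⁻¹ := by
                rw [← div_eq_mul_inv, le_div_iff₀ (by positivity)]
                simp only [hV]
                linarith
              rw [h1, ← mul_assoc]
              have := (hφ0 y).le
              gcongr
            calc _ = (c₁ + c₂) * p * (V y * φ y) * ‖x - y‖ ^ (-((n : ℝ) - 2)) := by ring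
              _ ≤ (c₁ + c₂) * p * ((4 * ((c₁ + c₂) * p * Cn))⁻¹ * ‖y‖ ^ (-2 - α)) *
                  ‖x - y‖ ^ (-((n : ℝ) - 2)) := by gcongr
              _ = _ := by ring
        _ = ENNReal.ofReal ((c₁ + c₂) * p * (4 * ((c₁ + c₂) * p * Cn))⁻¹) *
            ∫⁻ y in Bad t \ closedBall 0 R,
            ENNReal.ofReal (‖x - y‖ ^ (-((n : ℝ) - 2)) * ‖y‖ ^ (-2 - α)) :=
            lintegral_const_mul' _ _ ENNReal.ofReal_ne_top
        _ ≤ ENNReal.ofReal ((c₁ + c₂) * p * (4 * ((c₁ + c₂) * p * Cn))⁻¹) *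
            ENNReal.ofReal (Cn * φ x) := by
            gcongr
            refine (lintegral_mono_set fun y hy => ?_).trans (hnewton x)
            have := hy.2
            rw [mem_closedBall_zero_iff, not_le] at this
            exact hR1.trans this.le
        _ = _ := by
            rw [← ENNReal.ofReal_mul (by positivity)]
            congr 1
            field_simp
  have hiter : ∀ k : ℕ, ∀ x, inner ℝ e x < t →
      planeExcess u v e t x ≤ C * (1 / 2) ^ k * φ x := by
    intro k
    induction k with
    | zero =>
      intro x hx
      have h1 := H.fst_pos x
      have h2 := H.snd_pos x
      have h3 := H.fst_pos (planeReflection e t x)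
      have h4 := H.snd_pos (planeReflection e t x)
      rw [pow_zero, mul_one]
      refine le_trans ?_ (hUC x)
      exact max_le (max_le (by linarith) (by linarith)) (by linarith)
    | succ k ih =>
      intro x hx
      set K := C * (1 / 2) ^ k with hK
      have hK0 : 0 < K := by positivity
      have hS : MeasurableSet {y : EuclideanSpace ℝ (Fin n) | inner ℝ e y < t} :=
        measurableSet_lt (by fun_prop) measurable_const
      have h1 : ENNReal.ofReal (planeExcess u v e t x) ≤ ENNReal.ofReal (K * (φ x / 2)) := by
        calc _ ≤ _ := H.ofReal_planeExcess_le he ht hx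
          _ ≤ ∫⁻ y in Bad t, ENNReal.ofReal K * ENNReal.ofReal ((c₁ + c₂) *
              (‖x - y‖ ^ (-((n : ℝ) - 2)) * (p * V y * φ y))) := by
              rw [← lintegral_indicator hS, ← lintegral_indicator (hBadm t)]
              refine lintegral_mono fun y => ?_
              by_cases hy : inner ℝ e y < t
              · rw [indicator_of_mem (by exact hy)]
                by_cases hyB : y ∈ Bad t
                · rw [indicator_of_mem hyB, ← ENNReal.ofReal_mul hK0.le]
                  apply ENNReal.ofReal_le_ofReal
                  have := ih y hy
                  have := hV0 y
                  calc _ = (c₁ + c₂) * (‖x - y‖ ^ (-((n : ℝ) - 2)) *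
                        (p * V y * planeExcess u v e t y)) := by simp only [hV]; ring
                    _ ≤ (c₁ + c₂) * (‖x - y‖ ^ (-((n : ℝ) - 2)) *
                        (p * V y * (K * φ y))) := by gcongr
                    _ = _ := by ring
                · have h0 : planeExcess u v e t y = 0 := by
                    simp only [hBad, mem_ofPred_eq, not_and, not_or, not_lt] at hyB
                    obtain ⟨h2, h3⟩ := hyB hy
                    exact max_eq_right (max_le (by linarith) (by linarith))
                  rw [h0]
                  simp
              · rw [indicator_of_notMem (by exact hy)]
                exact bot_le
          _ = ENNReal.ofReal K * ∫⁻ y in Bad t, ENNReal.ofReal ((c₁ + c₂) *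
              (‖x - y‖ ^ (-((n : ℝ) - 2)) * (p * V y * φ y))) :=
              lintegral_const_mul' _ _ ENNReal.ofReal_ne_top
          _ ≤ ENNReal.ofReal K * ENNReal.ofReal (φ x / 2) := by
              gcongr
              exact hkey x
          _ = _ := (ENNReal.ofReal_mul hK0.le).symm
      have hφx := hφ0 x
      rw [ENNReal.ofReal_le_ofReal_iff (by positivity)] at h1
      calc _ ≤ _ := h1
        _ = _ := by rw [hK, pow_succ]; ring
  intro x hx
  have h1 : planeExcess u v e t x ≤ 0 := by
    have h2 : Tendsto (fun k : ℕ => C * (1 / 2 : ℝ) ^ k * φ x) atTop (𝓝 (C * 0 * φ x)) :=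
      ((tendsto_pow_atTop_nhds_zero_of_lt_one (by norm_num) (by norm_num)).const_mul C).mul_const _
    rw [mul_zero, zero_mul] at h2
    exact ge_of_tendsto' h2 fun k => hiter k x hx
  constructor
  · linarith [sub_le_planeExcess_fst (u := u) (v := v) (e := e) (t := t) x]
  · linarith [sub_le_planeExcess_snd (u := u) (v := v) (e := e) (t := t) x]

end IsWeightedSolution

end Comparison

section MovingPlanes

variable {n : ℕ} {p h c₁ c₂ : ℝ} {u v : EuclideanSpace ℝ (Fin n) → ℝ}
  {e : EuclideanSpace ℝ (Fin n)} {t : ℝ}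

/-- Rigidity: equality at one point forces the weight to be trivial and the density to be
symmetric. -/
lemma weight_eq_zero_and_ae_eq_comp_planeReflection (hn : 3 ≤ n) (hh : 0 ≤ h) (he : ‖e‖ = 1)
    (ht : h = 0 ∨ t < 0) {f g : EuclideanSpace ℝ (Fin n) → ℝ} {c : ℝ} (hc : 0 < c)
    (hf : ∀ y, 0 < f y)
    (hInt : ∀ x, Integrable (fun y => f y * ‖y‖ ^ (-h) * ‖x - y‖ ^ (-((n : ℝ) - 2))))
    (hg : ∀ x, g x = c * ∫ y, f y * ‖y‖ ^ (-h) * ‖x - y‖ ^ (-((n : ℝ) - 2)))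
    (hle : ∀ y, inner ℝ e y < t → f y ≤ f (planeReflection e t y))
    {x : EuclideanSpace ℝ (Fin n)} (hx : inner ℝ e x < t)
    (hgx : g (planeReflection e t x) ≤ g x) :
    h = 0 ∧ ∀ᵐ y, inner ℝ e y < t → f y = f (planeReflection e t y) := by
  have : Nontrivial (EuclideanSpace ℝ (Fin n)) :=
    Module.nontrivial_of_finrank_pos (R := ℝ) (by rw [finrank_euclideanSpace_fin]; omega)
  have hne : ∀ᵐ y, planeReflection e t y ≠ 0 := by
    filter_upwards [Measure.ae_ne volume (planeReflection e t 0)] with y hy h0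
    rw [← h0, planeReflection_planeReflection he] at hy
    exact hy rfl
  have hae := ae_eq_comp_planeReflection hn he hc hInt hg (by
    filter_upwards [hne] with y hy0 hy
    have h1 := norm_rpow_neg_le_planeReflection hh he ht hy hy0
    have h2 := hle y hy
    have := (hf (planeReflection e t y)).le
    gcongr) hx hgx
  have hh0 : h = 0 := by
    by_contra hh0
    have ht0 : t < 0 := ht.resolve_left hh0
    have hS : IsOpen {y : EuclideanSpace ℝ (Fin n) | inner ℝ e y < t} :=
      isOpen_lt (by fun_prop) continuous_const
    obtain ⟨y, hy, h1, hy0⟩ := Measure.exists_mem_of_measure_ne_zero_of_ae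
      (hS.measure_pos volume ⟨x, hx⟩).ne' (ae_restrict_of_ae (hae.and hne))
    have h2 : ‖y‖ ^ (-h) < ‖planeReflection e t y‖ ^ (-h) := by
      refine Real.rpow_lt_rpow_of_neg (norm_pos_iff.2 hy0) ?_
        (neg_neg_of_pos (lt_of_le_of_ne hh (Ne.symm hh0)))
      rw [← sq_lt_sq₀ (norm_nonneg _) (norm_nonneg _), norm_planeReflection_sq he]
      nlinarith [mul_neg_of_neg_of_pos ht0 (sub_pos.2 hy)]
    have h3 : f y * ‖y‖ ^ (-h) < f (planeReflection e t y) * ‖planeReflection e t y‖ ^ (-h) :=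
      mul_lt_mul' (hle y hy) h2 (by positivity) (hf _)
    exact h3.ne (h1 hy)
  subst hh0
  exact ⟨rfl, by simpa using hae⟩

namespace IsWeightedSolution

lemma comp_planeReflection_eq (H : IsWeightedSolution p h u v c₁ c₂) (he : ‖e‖ = 1)
    (ht : h = 0 ∨ t < 0)
    (hle : ∀ y, inner ℝ e y < t →
      u y ≤ u (planeReflection e t y) ∧ v y ≤ v (planeReflection e t y))
    {x : EuclideanSpace ℝ (Fin n)} (hx : inner ℝ e x < t)
    (hxe : u (planeReflection e t x) ≤ u x ∨ v (planeReflection e t x) ≤ v x) :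
    h = 0 ∧ ∀ y, u (planeReflection e t y) = u y := by
  have hp := H.two_le
  have hS : IsOpen {y : EuclideanSpace ℝ (Fin n) | inner ℝ e y < t} :=
    isOpen_lt (by fun_prop) continuous_const
  have hupos := H.fst_pos
  have hvpos := H.snd_pos
  have key : h = 0 ∧ ∀ᵐ y, inner ℝ e y < t → u y = u (planeReflection e t y) := by
    rcases hxe with hxe | hxe
    · obtain ⟨h0, h1⟩ := weight_eq_zero_and_ae_eq_comp_planeReflection
        (f := fun y => u y ^ (p - 1) * v y) H.three_le H.weight_nonneg he ht H.c₁_pos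
        (fun y => by have := hupos y; have := hvpos y; positivity) H.integrable_fst H.fst_eq
        (fun y hy => by
          obtain ⟨h1, h2⟩ := hle y hy
          have := (hupos y).le
          have := (hvpos y).le
          have : 0 ≤ u (planeReflection e t y) := (hupos _).le
          gcongr
          linarith) hx hxe
      refine ⟨h0, h1.mono fun y hy1 hy => ?_⟩
      obtain ⟨h2, h3⟩ := hle y hy
      refine h2.antisymm (not_lt.1 fun h4 => ?_)
      have h5 : u y ^ (p - 1) < u (planeReflection e t y) ^ (p - 1) :=
        Real.rpow_lt_rpow (hupos y).le h4 (by linarith)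
      have h6 : u y ^ (p - 1) * v y <
          u (planeReflection e t y) ^ (p - 1) * v (planeReflection e t y) :=
        mul_lt_mul h5 h3 (hvpos y) (Real.rpow_nonneg (hupos _).le _)
      exact h6.ne (hy1 hy)
    · obtain ⟨h0, h1⟩ := weight_eq_zero_and_ae_eq_comp_planeReflection
        (f := fun y => u y ^ p) H.three_le H.weight_nonneg he ht H.c₂_pos
        (fun y => by have := hupos y; positivity) H.integrable_snd H.snd_eq
        (fun y hy => Real.rpow_le_rpow (hupos y).le (hle y hy).1 (by linarith)) hx hxe
      refine ⟨h0, h1.mono fun y hy1 hy => ?_⟩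
      exact (Real.rpow_left_inj (hupos _).le (hupos _).le (by linarith)).1 (hy1 hy)
  obtain ⟨h0, hae⟩ := key
  refine ⟨h0, ?_⟩
  have hEq : EqOn u (u ∘ planeReflection e t) {y | inner ℝ e y < t} :=
    Measure.eqOn_open_of_ae_eq (μ := volume) ((ae_restrict_iff' hS.measurableSet).2 hae) hS
      H.continuous_fst.continuousOn (H.continuous_fst.comp continuous_planeReflection).continuousOn
  intro y
  rcases lt_trichotomy (inner ℝ e y) t with h1 | h1 | h1
  · exact (hEq h1).symm
  · rw [planeReflection_of_inner_eq h1]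
  · have h2 := hEq (x := planeReflection e t y)
      (by simp only [mem_ofPred_eq]; rw [inner_planeReflection he]; linarith)
    rwa [Function.comp_apply, planeReflection_planeReflection he] at h2

/-- The moving plane inequality holds for hyperplanes close to infinity. -/
lemma eventually_atBot_le_planeReflection (H : IsWeightedSolution p h u v c₁ c₂)
    (he : ‖e‖ = 1) :
    ∀ᶠ t in atBot, ∀ x, inner ℝ e x < t →
      u x ≤ u (planeReflection e t x) ∧ v x ≤ v (planeReflection e t x) := by
  refine H.eventually_le_planeReflection he ?_ ⟨1, ?_⟩ (ae_of_all _ fun y => ?_)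
  · filter_upwards [eventually_lt_atBot 0] with t ht
    exact Or.inr ht
  · filter_upwards [eventually_le_atBot (-1)] with t ht y hy
    refine Real.rpow_le_one_of_one_le_of_nonpos ?_ (neg_nonpos.2 H.weight_nonneg)
    have h1 := abs_le.1 (abs_real_inner_le_norm e y)
    rw [he, one_mul] at h1
    linarith [h1.1]
  · filter_upwards [eventually_le_atBot (inner ℝ e y)] with t ht hy
    exact absurd hy ht.not_gt

/-- Starting from a strict moving plane inequality, the hyperplane can be moved further. -/
lemma eventually_nhds_le_planeReflection (H : IsWeightedSolution p h u v c₁ c₂)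
    (he : ‖e‖ = 1) (ht : h = 0 ∨ t < 0)
    (hlt : ∀ x, inner ℝ e x < t →
      u x < u (planeReflection e t x) ∧ v x < v (planeReflection e t x)) :
    ∀ᶠ s in 𝓝 t, ∀ x, inner ℝ e x < s →
      u x ≤ u (planeReflection e s x) ∧ v x ≤ v (planeReflection e s x) := by
  refine H.eventually_le_planeReflection he ?_ ?_ ?_
  · rcases ht with h0 | ht
    · exact Eventually.of_forall fun _ => Or.inl h0
    · exact (eventually_lt_nhds ht).mono fun _ => Or.inr
  · rcases ht with rfl | ht
    · exact ⟨1, Eventually.of_forall fun s y _ => by simp⟩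
    · refine ⟨(-(t / 2)) ^ (-h), ?_⟩
      filter_upwards [eventually_lt_nhds (show t < t / 2 by linarith)] with s hs y hy
      refine Real.rpow_le_rpow_of_nonpos (by linarith) ?_ (neg_nonpos.2 H.weight_nonneg)
      have h1 := abs_le.1 (abs_real_inner_le_norm e y)
      rw [he, one_mul] at h1
      linarith [h1.1]
  · filter_upwards [ae_inner_ne he t] with y hy
    rcases lt_or_gt_of_ne hy with h1 | h1
    · obtain ⟨h2, h3⟩ := hlt y h1
      have h4 : ∀ᶠ s in 𝓝 t, u y < u (planeReflection e s y) :=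
        (H.continuous_fst.comp (continuous_planeReflection_left y)).continuousAt.eventually
          (lt_mem_nhds h2)
      have h5 : ∀ᶠ s in 𝓝 t, v y < v (planeReflection e s y) :=
        (H.continuous_snd.comp (continuous_planeReflection_left y)).continuousAt.eventually
          (lt_mem_nhds h3)
      filter_upwards [h4, h5] with s h6 h7 _
      exact ⟨h6.le, h7.le⟩
    · filter_upwards [eventually_lt_nhds h1] with s hs hys
      exact absurd hys hs.not_gt

lemma tendsto_fst_cocompact (H : IsWeightedSolution p h u v c₁ c₂) :
    Tendsto u (cocompact _) (𝓝 0) := by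
  obtain ⟨α, C, hα, -, -, hle⟩ := H.exists_add_le_rpow
  have h1 : Tendsto (fun x : EuclideanSpace ℝ (Fin n) => C * (1 + ‖x‖) ^ (-α)) (cocompact _)
      (𝓝 (C * 0)) :=
    ((tendsto_rpow_neg_atTop hα).comp
      (tendsto_atTop_add_const_left _ 1 tendsto_norm_cocompact_atTop)).const_mul C
  rw [mul_zero] at h1
  refine squeeze_zero (fun x => (H.fst_pos x).le) (fun x => ?_) h1
  have := H.snd_pos x
  linarith [hle x]

lemma exists_center (H : IsWeightedSolution p h u v c₁ c₂) :
    ∃ c, (0 < h → c = 0) ∧ (h = 0 → ∀ x, u x ≤ u c) := by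
  obtain ⟨c, hc⟩ := H.continuous_fst.exists_forall_ge' 0
    ((H.tendsto_fst_cocompact.eventually (gt_mem_nhds (H.fst_pos 0))).mono fun _ => le_of_lt)
  rcases eq_or_ne h 0 with h0 | h0
  · exact ⟨c, fun h1 => absurd h0 h1.ne', fun _ => hc⟩
  · exact ⟨0, fun _ => rfl, fun h1 => absurd h1 h0⟩

/-- A solution vanishing at infinity is not invariant under a nontrivial translation. -/
lemma not_forall_fst_add_smul_eq (H : IsWeightedSolution p h u v c₁ c₂) (he : ‖e‖ = 1)
    {τ : ℝ} (hτ : 0 < τ) : ¬ ∀ y, u (y + τ • e) = u y := by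
  intro hper
  have h1 : ∀ k : ℕ, u ((k * τ) • e) = u 0 := by
    intro k
    induction k with
    | zero => simp
    | succ k ih => rw [← ih, ← hper ((k * τ) • e), ← add_smul]; congr 2; push_cast; ring
  have h2 : Tendsto (fun k : ℕ => ((k : ℝ) * τ) • e) atTop (cocompact _) := by
    rw [← Metric.cobounded_eq_cocompact, ← tendsto_norm_atTop_iff_cobounded]
    have h3 : ∀ k : ℕ, ‖((k : ℝ) * τ) • e‖ = k * τ := fun k => by
      rw [norm_smul, he, mul_one, Real.norm_of_nonneg (by positivity)]
    simp only [h3]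
    exact tendsto_natCast_atTop_atTop.atTop_mul_const hτ
  have h4 := H.tendsto_fst_cocompact.comp h2
  have h5 : Tendsto (u ∘ fun k : ℕ => ((k : ℝ) * τ) • e) atTop (𝓝 (u 0)) := by
    refine tendsto_const_nhds.congr fun k => (h1 k).symm
  exact (H.fst_pos 0).ne' (tendsto_nhds_unique h5 h4)

/-- The hyperplanes orthogonal to `e` can be moved up to the center. -/
lemma le_planeReflection_of_le_inner (H : IsWeightedSolution p h u v c₁ c₂)
    {c : EuclideanSpace ℝ (Fin n)} (hc0 : 0 < h → c = 0) (hcmax : h = 0 → ∀ x, u x ≤ u c)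
    (he : ‖e‖ = 1) (ht : t ≤ inner ℝ e c) :
    ∀ x, inner ℝ e x < t →
      u x ≤ u (planeReflection e t x) ∧ v x ≤ v (planeReflection e t x) := by
  set P : ℝ → Prop := fun t => ∀ x, inner ℝ e x < t →
      u x ≤ u (planeReflection e t x) ∧ v x ≤ v (planeReflection e t x) with hP
  change P t
  set T : ℝ := inner ℝ e c with hT
  set S : Set ℝ := {l | l ≤ T ∧ ∀ s ≤ l, P s} with hS
  have hSne : S.Nonempty := by
    obtain ⟨a, ha⟩ := eventually_atBot.1 (H.eventually_atBot_le_planeReflection he)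
    exact ⟨min a T, min_le_right _ _, fun s hs => ha s (hs.trans (min_le_left _ _))⟩
  have hSbdd : BddAbove S := ⟨T, fun l hl => hl.1⟩
  set l₀ := sSup S with hl₀
  have hl₀T : l₀ ≤ T := csSup_le hSne fun l hl => hl.1
  have hPlt : ∀ s, s < l₀ → P s := by
    intro s hs
    obtain ⟨l, hl, hsl⟩ := exists_lt_of_lt_csSup hSne hs
    exact hl.2 s hsl.le
  have hPl₀ : P l₀ := by
    intro x hx
    have hev : ∀ᶠ s in 𝓝[<] l₀, u x ≤ u (planeReflection e s x) ∧
        v x ≤ v (planeReflection e s x) := by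
      filter_upwards [Ioo_mem_nhdsLT hx] with s hs
      exact hPlt s hs.2 x hs.1
    constructor
    · exact ge_of_tendsto (((H.continuous_fst.comp
        (continuous_planeReflection_left x)).tendsto l₀).mono_left nhdsWithin_le_nhds)
        (hev.mono fun s hs => hs.1)
    · exact ge_of_tendsto (((H.continuous_snd.comp
        (continuous_planeReflection_left x)).tendsto l₀).mono_left nhdsWithin_le_nhds)
        (hev.mono fun s hs => hs.2)
  have hl₀eq : l₀ = T := by
    by_contra hne
    have hlt : l₀ < T := lt_of_le_of_ne hl₀T hne
    have hl₀0 : h = 0 ∨ l₀ < 0 := by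
      rcases H.weight_nonneg.eq_or_lt' with h0 | h0
      · exact Or.inl h0
      · right
        rwa [hT, hc0 h0, inner_zero_right] at hlt
    have hstrict : ∀ x, inner ℝ e x < l₀ →
        u x < u (planeReflection e l₀ x) ∧ v x < v (planeReflection e l₀ x) := by
      by_contra! hcon
      obtain ⟨x, hx, hxe⟩ := hcon
      have hxe' : u (planeReflection e l₀ x) ≤ u x ∨ v (planeReflection e l₀ x) ≤ v x := by
        by_contra! h1
        exact absurd (hxe h1.1) h1.2.not_ge
      obtain ⟨h0, hsym⟩ := H.comp_planeReflection_eq he hl₀0 hPl₀ hx hxe'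
      set c' := planeReflection e l₀ c with hc'
      have hc'i : inner ℝ e c' = 2 * l₀ - T := inner_planeReflection he c
      obtain ⟨m, hm1, hm2⟩ := exists_between (show inner ℝ e c' < l₀ by linarith)
      obtain ⟨-, hsym'⟩ := H.comp_planeReflection_eq he (Or.inl h0) (hPlt m hm2) hm1
        (Or.inl ((hcmax h0 _).trans (hsym c).ge))
      refine H.not_forall_fst_add_smul_eq he (τ := 2 * (l₀ - m)) (by linarith) fun y => ?_
      rw [← hsym' y, ← hsym (planeReflection e m y)]
      congr 1
      rw [planeReflection, inner_planeReflection he, planeReflection]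
      module
    obtain ⟨ε, hε, hball⟩ := Metric.eventually_nhds_iff.1
      (H.eventually_nhds_le_planeReflection he hl₀0 hstrict)
    have hmem : min T (l₀ + ε / 2) ∈ S := by
      refine ⟨min_le_left _ _, fun s hs => ?_⟩
      rcases lt_or_ge s l₀ with h1 | h1
      · exact hPlt s h1
      · refine hball ?_
        rw [Real.dist_eq, abs_of_nonneg (by linarith)]
        linarith [hs.trans (min_le_right _ _)]
    have h1 := le_csSup hSbdd hmem
    have h2 : l₀ < min T (l₀ + ε / 2) := lt_min hlt (by linarith)
    exact h1.not_gt h2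
  rcases (ht.trans hl₀eq.ge).lt_or_eq with h1 | h1
  · exact hPlt t h1
  · rw [h1]; exact hPl₀

/-- Solutions are radially symmetric and decreasing about a point. -/
lemma exists_radialDecreasingAbout (H : IsWeightedSolution p h u v c₁ c₂) :
    ∃ x₀, RadialDecreasingAbout u x₀ ∧ RadialDecreasingAbout v x₀ ∧ (0 < h → x₀ = 0) := by
  obtain ⟨c, hc0, hcmax⟩ := H.exists_center
  have key : ∀ x y, ‖x - c‖ ≤ ‖y - c‖ → u y ≤ u x ∧ v y ≤ v x := by
    intro x y hxy
    rcases eq_or_ne x y with rfl | hne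
    · exact ⟨le_rfl, le_rfl⟩
    have hd : 0 < ‖x - y‖ := norm_pos_iff.2 (sub_ne_zero.2 hne)
    set e := ‖x - y‖⁻¹ • (x - y) with he_def
    have he : ‖e‖ = 1 := by
      rw [he_def, norm_smul, norm_inv, norm_norm, inv_mul_cancel₀ hd.ne']
    have hexy : inner ℝ e x - inner ℝ e y = ‖x - y‖ := by
      rw [← inner_sub_right, he_def, real_inner_smul_left, real_inner_self_eq_norm_sq]
      field_simp
    set t := (inner ℝ e x + inner ℝ e y) / 2 with ht_def
    have ht : t ≤ inner ℝ e c := by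
      have h1 : inner ℝ (x - y) ((x - c) + (y - c)) ≤ 0 := by
        rw [show x - y = (x - c) - (y - c) by abel, inner_sub_left, inner_add_right,
          inner_add_right, real_inner_self_eq_norm_sq, real_inner_self_eq_norm_sq,
          real_inner_comm (x - c) (y - c)]
        have := pow_le_pow_left₀ (norm_nonneg _) hxy 2
        linarith
      have h2 : inner ℝ e ((x - c) + (y - c)) ≤ 0 := by
        rw [he_def, real_inner_smul_left]
        exact mul_nonpos_of_nonneg_of_nonpos (by positivity) h1
      rw [inner_add_right, inner_sub_right, inner_sub_right] at h2
      linarith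
    have hR : planeReflection e t y = x := by
      have h1 : 2 * (t - inner ℝ e y) = ‖x - y‖ := by linarith
      rw [planeReflection, h1, he_def, smul_smul, mul_inv_cancel₀ hd.ne', one_smul]
      abel
    have h3 := H.le_planeReflection_of_le_inner hc0 hcmax he ht y (by linarith)
    rwa [hR] at h3
  exact ⟨c, fun x y hxy => (key x y hxy).1, fun x y hxy => (key x y hxy).2, hc0⟩

end IsWeightedSolution

end MovingPlanes

end

theorem stmt_4 (n : ℕ) (hn : 3 ≤ n) (p h : ℝ) (hp : 2 ≤ p) (hh : 0 ≤ h)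
    (u v : EuclideanSpace ℝ (Fin n) → ℝ) (c₁ c₂ : ℝ) (hc₁ : 0 < c₁) (hc₂ : 0 < c₂)
    (hu : Continuous u) (hv : Continuous v)
    (hupos : ∀ x, 0 < u x) (hvpos : ∀ x, 0 < v x)
    (hInt₁ : ∀ x : EuclideanSpace ℝ (Fin n),
      Integrable (fun y => u y ^ (p - 1) * v y * ‖y‖ ^ (-h) * ‖x - y‖ ^ (-((n : ℝ) - 2))))
    (hInt₂ : ∀ x : EuclideanSpace ℝ (Fin n),
      Integrable (fun y => u y ^ p * ‖y‖ ^ (-h) * ‖x - y‖ ^ (-((n : ℝ) - 2))))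
    (hueq : ∀ x : EuclideanSpace ℝ (Fin n),
      u x = c₁ * ∫ y, u y ^ (p - 1) * v y * ‖y‖ ^ (-h) * ‖x - y‖ ^ (-((n : ℝ) - 2)))
    (hveq : ∀ x : EuclideanSpace ℝ (Fin n),
      v x = c₂ * ∫ y, u y ^ p * ‖y‖ ^ (-h) * ‖x - y‖ ^ (-((n : ℝ) - 2)))
    (hfin₁ : Integrable (fun y : EuclideanSpace ℝ (Fin n) =>
      ‖y‖ ^ (-((n : ℝ) * h / 2)) * u y ^ ((n : ℝ) * (p - 1) / 2)))
    (hfin₂ : Integrable (fun y : EuclideanSpace ℝ (Fin n) =>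
      ‖y‖ ^ (-((n : ℝ) * h / 2)) * v y ^ ((n : ℝ) * (p - 1) / 2))) :
    ∃ x₀ : EuclideanSpace ℝ (Fin n),
      RadialDecreasingAbout u x₀ ∧ RadialDecreasingAbout v x₀ ∧ (0 < h → x₀ = 0) := by
  exact IsWeightedSolution.exists_radialDecreasingAbout ⟨hn, hp, hh, hc₁, hc₂, hu, hv, hupos, hvpos,
    hInt₁, hInt₂, hueq, hveq, hfin₁, hfin₂⟩
end

section
/- Let n ≥ 3 and p > n/(n−2). Suppose c₁, c₂, t₁, t₂ are positive constants such that u(x) = c₁ |x|^{−t₁} and v(x) = c₂ |x|^{−t₂} solve the system −Δu = √p · u^{p−1} v, −Δv = √p · u^p on ℝⁿ \ {0}. Then t₁ = t₂ = 2/(p−1) and c₁ = c₂ = (2n/(√p (p−1)) − 4√p/(p−1)²)^{1/(p−1)}. Conversely, with these values of the exponents and constants, (u, v) is a positive solution of the system on ℝⁿ \ {0}. -/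
open MeasureTheory Real Filter

theorem hasFDerivAt_norm_rpow_of_ne_zero {E : Type*} [NormedAddCommGroup E]
    [InnerProductSpace ℝ E] (s : ℝ) {x : E} (hx : x ≠ 0) :
    HasFDerivAt (fun y : E => ‖y‖ ^ s) ((s * ‖x‖ ^ (s - 2)) • innerSL ℝ x) x := by
  have hx' : 0 < ‖x‖ := norm_pos_iff.mpr hx
  have h := (hasStrictFDerivAt_norm_sq x).hasFDerivAt.rpow_const (p := s / 2)
    (Or.inl (by positivity))
  have hpow (y : E) (a : ℝ) : (‖y‖ ^ 2) ^ a = ‖y‖ ^ (2 * a) := by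
    rw [← Real.rpow_natCast, ← Real.rpow_mul (norm_nonneg y)]
    norm_num
  simp only [hpow] at h
  convert h using 1
  · ext y
    congr 1
    ring
  · rw [show 2 * (s / 2 - 1) = s - 2 by ring]
    ext v
    simp
    ring

theorem neg_lap_const_mul_norm_rpow {n : ℕ} (c t : ℝ) {x : EuclideanSpace ℝ (Fin n)}
    (hx : x ≠ 0) :
    -lap (fun y => c * ‖y‖ ^ (-t)) x = c * (t * (n - 2 - t)) * ‖x‖ ^ (-t - 2) := by
  have hx' : 0 < ‖x‖ := norm_pos_iff.mpr hx
  have hfst : fderiv ℝ (fun y : EuclideanSpace ℝ (Fin n) => c * ‖y‖ ^ (-t)) =ᶠ[nhds x]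
      fun y => (c * (-t * ‖y‖ ^ (-t - 2))) • innerSL ℝ y := by
    filter_upwards [isOpen_ne.mem_nhds hx] with y hy
    rw [((hasFDerivAt_norm_rpow_of_ne_zero (-t) hy).const_mul c).fderiv, smul_smul]
  have hsnd := (((hasFDerivAt_norm_rpow_of_ne_zero (-t - 2) hx).const_mul (-t)).const_mul c).fun_smul
    (innerSL ℝ : EuclideanSpace ℝ (Fin n) →L[ℝ] _).hasFDerivAt
  have hinner (y z : EuclideanSpace ℝ (Fin n)) :
      (innerSL ℝ : EuclideanSpace ℝ (Fin n) →L[ℝ] _) y z = inner ℝ y z := rfl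
  have hdiag (i : Fin n) :
      iteratedFDeriv ℝ 2 (fun y : EuclideanSpace ℝ (Fin n) => c * ‖y‖ ^ (-t)) x
        ![EuclideanSpace.single i 1, EuclideanSpace.single i 1] =
      c * (-t * ‖x‖ ^ (-t - 2)) + c * (-t * ((-t - 2) * ‖x‖ ^ (-t - 2 - 2))) * x i ^ 2 := by
    rw [iteratedFDeriv_two_apply, hfst.fderiv_eq, hsnd.fderiv]
    simp [hinner, EuclideanSpace.inner_single_right]
    ring
  have hpow : ‖x‖ ^ (-t - 2 - 2) * ‖x‖ ^ 2 = ‖x‖ ^ (-t - 2) := by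
    rw [← Real.rpow_natCast, ← Real.rpow_add hx']
    norm_num
  rw [lap, Finset.sum_congr rfl fun i _ => hdiag i, Finset.sum_add_distrib, Finset.sum_const, ← Finset.mul_sum,
    ← EuclideanSpace.real_norm_sq_eq, Finset.card_univ, Fintype.card_fin,
    nsmul_eq_mul]
  linear_combination (-c * t * (t + 2)) * hpow

theorem coeff_eq_and_exponent_eq_of_mul_rpow_eq {A B a b : ℝ} (hB : 0 < B)
    (h : ∀ r : ℝ, 0 < r → A * r ^ a = B * r ^ b) : A = B ∧ a = b := by
  have hAB : A = B := by simpa using h 1 one_pos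
  refine ⟨hAB, ?_⟩
  subst hAB
  have h2 := mul_left_cancel₀ hB.ne' (h 2 two_pos)
  exact (Real.rpow_right_inj (by norm_num) (by norm_num)).mp h2

theorem const_mul_rpow_rpow {c r : ℝ} (hc : 0 < c) (hr : 0 < r) (t q : ℝ) :
    (c * r ^ (-t)) ^ q = c ^ q * r ^ (-t * q) := by
  rw [Real.mul_rpow hc.le (Real.rpow_nonneg hr.le _), ← Real.rpow_mul hr.le]

theorem stmt_14 (n : ℕ) (hn : 3 ≤ n) (p : ℝ) (hp : (n : ℝ) / ((n : ℝ) - 2) < p)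
    (c₁ c₂ t₁ t₂ : ℝ) (hc₁ : 0 < c₁) (hc₂ : 0 < c₂) (ht₁ : 0 < t₁) (ht₂ : 0 < t₂) :
    ((∀ x : EuclideanSpace ℝ (Fin n), x ≠ 0 →
        -lap (fun y => c₁ * ‖y‖ ^ (-t₁)) x =
          Real.sqrt p * (c₁ * ‖x‖ ^ (-t₁)) ^ (p - 1) * (c₂ * ‖x‖ ^ (-t₂)) ∧
        -lap (fun y => c₂ * ‖y‖ ^ (-t₂)) x =
          Real.sqrt p * (c₁ * ‖x‖ ^ (-t₁)) ^ p) →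
      (t₁ = 2 / (p - 1) ∧ t₂ = 2 / (p - 1) ∧
        c₁ = (2 * (n : ℝ) / (Real.sqrt p * (p - 1)) -
          4 * Real.sqrt p / (p - 1) ^ 2) ^ (1 / (p - 1)) ∧
        c₂ = (2 * (n : ℝ) / (Real.sqrt p * (p - 1)) -
          4 * Real.sqrt p / (p - 1) ^ 2) ^ (1 / (p - 1)))) ∧
    ((t₁ = 2 / (p - 1) ∧ t₂ = 2 / (p - 1) ∧
        c₁ = (2 * (n : ℝ) / (Real.sqrt p * (p - 1)) -
          4 * Real.sqrt p / (p - 1) ^ 2) ^ (1 / (p - 1)) ∧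
        c₂ = (2 * (n : ℝ) / (Real.sqrt p * (p - 1)) -
          4 * Real.sqrt p / (p - 1) ^ 2) ^ (1 / (p - 1))) →
      ∀ x : EuclideanSpace ℝ (Fin n), x ≠ 0 →
        0 < c₁ * ‖x‖ ^ (-t₁) ∧ 0 < c₂ * ‖x‖ ^ (-t₂) ∧
        -lap (fun y => c₁ * ‖y‖ ^ (-t₁)) x =
          Real.sqrt p * (c₁ * ‖x‖ ^ (-t₁)) ^ (p - 1) * (c₂ * ‖x‖ ^ (-t₂)) ∧
        -lap (fun y => c₂ * ‖y‖ ^ (-t₂)) x =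
          Real.sqrt p * (c₁ * ‖x‖ ^ (-t₁)) ^ p) := by
  have hn' : (0 : ℝ) < n - 2 := by
    have : (3 : ℝ) ≤ n := by exact_mod_cast hn
    linarith
  rw [div_lt_iff₀ hn'] at hp
  have hp1 : 0 < p - 1 := by nlinarith
  have hp0 : 0 < p := by linarith
  have hs : 0 < √p := Real.sqrt_pos.mpr hp0
  have hsq : √p ^ 2 = p := Real.sq_sqrt hp0.le
  set t : ℝ := 2 / (p - 1) with ht
  have htp : t * (p - 1) = 2 := by rw [ht]; field_simp
  set K : ℝ := t * (n - 2 - t) with hK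
  have hbase : 2 * (n : ℝ) / (√p * (p - 1)) - 4 * √p / (p - 1) ^ 2 = K / √p := by
    rw [hK, ht]
    field_simp
    rw [hsq]
    ring
  have hKpos : 0 < K := by
    have ht0 : 0 < t := by positivity
    refine mul_pos ht0 (sub_pos.mpr ?_)
    rw [ht, div_lt_iff₀ hp1]
    linarith
  have hc₁p : c₁ ^ p = c₁ ^ (p - 1) * c₁ := by
    rw [← Real.rpow_add_one hc₁.ne']
    ring_nf
  rw [hbase]
  constructor
  · intro h
    have hsphere (r : ℝ) (hr : 0 < r) : ∃ x : EuclideanSpace ℝ (Fin n), x ≠ 0 ∧ ‖x‖ = r := by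
      refine ⟨EuclideanSpace.single ⟨0, by omega⟩ r, ?_, ?_⟩
      · simpa using hr.ne'
      · simpa using hr.le
    obtain ⟨hA, ha⟩ := coeff_eq_and_exponent_eq_of_mul_rpow_eq
      (A := c₁ * (t₁ * (n - 2 - t₁))) (B := √p * c₁ ^ (p - 1) * c₂)
      (a := -t₁ - 2) (b := -t₁ * (p - 1) + -t₂) (by positivity) (by
        intro r hr
        obtain ⟨x, hx, rfl⟩ := hsphere r hr
        rw [← neg_lap_const_mul_norm_rpow c₁ t₁ hx, (h x hx).1, const_mul_rpow_rpow hc₁ hr,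
          Real.rpow_add hr]
        ring)
    obtain ⟨hB, hb⟩ := coeff_eq_and_exponent_eq_of_mul_rpow_eq
      (A := c₂ * (t₂ * (n - 2 - t₂))) (B := √p * c₁ ^ p)
      (a := -t₂ - 2) (b := -t₁ * p) (by positivity) (by
        intro r hr
        obtain ⟨x, hx, rfl⟩ := hsphere r hr
        rw [← neg_lap_const_mul_norm_rpow c₂ t₂ hx, (h x hx).2, const_mul_rpow_rpow hc₁ hr]
        ring)
    have ht₁t : t₁ = t := by
      rw [ht, eq_div_iff hp1.ne']
      linarith
    have ht₂t : t₂ = t := by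
      have : t₁ * (p - 1) = 2 := by rw [ht₁t, htp]
      linarith
    rw [ht₁t, ← hK] at hA
    rw [ht₂t, ← hK, hc₁p] at hB
    have hcc : c₂ = c₁ := by
      have hsq' : c₂ ^ 2 = c₁ ^ 2 := by
        refine mul_right_cancel₀ hKpos.ne' ?_
        linear_combination c₂ * hB - c₁ * hA
      exact (pow_left_inj₀ hc₂.le hc₁.le two_ne_zero).mp hsq'
    have hc : c₁ = (K / √p) ^ (1 / (p - 1)) := by
      rw [one_div, Real.eq_rpow_inv hc₁.le (by positivity) hp1.ne', eq_div_iff hs.ne']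
      rw [hcc] at hB
      refine mul_right_cancel₀ hc₁.ne' ?_
      linear_combination -hB
    exact ⟨ht₁t, ht₂t, hc, hcc.trans hc⟩
  · rintro ⟨ht₁t, ht₂t, hc, hc'⟩ x hx
    have hr : 0 < ‖x‖ := norm_pos_iff.mpr hx
    have hcc : c₂ = c₁ := hc'.trans hc.symm
    have hcp : √p * c₁ ^ (p - 1) = K := by
      rw [one_div, Real.eq_rpow_inv hc₁.le (by positivity) hp1.ne', eq_div_iff hs.ne'] at hc
      linarith
    refine ⟨by positivity, by positivity, ?_, ?_⟩
    · rw [neg_lap_const_mul_norm_rpow c₁ t₁ hx, const_mul_rpow_rpow hc₁ hr, ht₁t, ht₂t, hcc, ← hK,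
        show -t - 2 = -t * (p - 1) + -t by linarith, Real.rpow_add hr, ← hcp]
      ring
    · rw [neg_lap_const_mul_norm_rpow c₂ t₂ hx, const_mul_rpow_rpow hc₁ hr, ht₁t, ht₂t, hcc, ← hK,
        show -t - 2 = -t * p by linarith, hc₁p, ← hcp]
      ring
end

section
/- Let n ≥ 3 and p ≥ max{2, (n+2)/(n−2)}. Then there exists a constant a > 0 such that the ODE system −(U'' + ((n−1)/r) U') = √p · U^{p−1} V, −(V'' + ((n−1)/r) V') = √p · U^p for r > 0, with initial conditions U(0) = 1, V(0) = a, U'(0) = V'(0) = 0, has a solution (U, V) defined on all of [0, ∞) with U(r) > 0 and V(r) > 0 for all r ≥ 0. -/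
open MeasureTheory Real Filter

/-- The mean `∫₀¹ τ ^ m * f (u (s * τ)) dτ`, so that `s * radialMean m f u s` is
`s ^ (-m) * ∫₀ˢ t ^ m * f (u t) dt` for positive `s`. -/
noncomputable def radialMean (m : ℕ) (f u : ℝ → ℝ) (s : ℝ) : ℝ :=
  ∫ τ in (0 : ℝ)..1, τ ^ m * f (u (s * τ))

theorem continuous_radialMean {m : ℕ} {f u : ℝ → ℝ} (hf : Continuous f) (hu : Continuous u) :
    Continuous (radialMean m f u) := by
  apply intervalIntegral.continuous_parametric_intervalIntegral_of_continuous'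
  fun_prop

theorem abs_radialMean_le {m : ℕ} {f u : ℝ → ℝ} {M : ℝ} (hM : ∀ x, |f x| ≤ M) (s : ℝ) :
    |radialMean m f u s| ≤ M := by
  have h := intervalIntegral.norm_integral_le_of_norm_le_const (a := (0 : ℝ)) (b := 1) (C := M)
    (f := fun τ => τ ^ m * f (u (s * τ))) (fun τ hτ => by
      rw [Set.uIoc_of_le zero_le_one] at hτ
      rw [norm_mul, norm_eq_abs, norm_eq_abs, abs_of_nonneg (pow_nonneg hτ.1.le m)]
      calc τ ^ m * |f (u (s * τ))| ≤ 1 * |f (u (s * τ))| := by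
            gcongr
            exact pow_le_one₀ hτ.1.le hτ.2
        _ ≤ M := by rw [one_mul]; exact hM _)
  simpa [radialMean] using h

theorem abs_radialMean_sub_le {m : ℕ} {f u v : ℝ → ℝ} (hf : Continuous f) (hu : Continuous u)
    (hv : Continuous v) {s C : ℝ}
    (h : ∀ τ ∈ Set.Icc (0 : ℝ) 1, |f (u (s * τ)) - f (v (s * τ))| ≤ C) :
    |radialMean m f u s - radialMean m f v s| ≤ C := by
  have h := intervalIntegral.norm_integral_le_of_norm_le_const (a := (0 : ℝ)) (b := 1) (C := C)
    (f := fun τ => τ ^ m * f (u (s * τ)) - τ ^ m * f (v (s * τ))) (fun τ hτ => by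
      rw [Set.uIoc_of_le zero_le_one] at hτ
      rw [← mul_sub, norm_mul, norm_eq_abs, norm_eq_abs, abs_of_nonneg (pow_nonneg hτ.1.le m)]
      calc τ ^ m * |f (u (s * τ)) - f (v (s * τ))| ≤ 1 * |f (u (s * τ)) - f (v (s * τ))| := by
            gcongr
            exact pow_le_one₀ hτ.1.le hτ.2
        _ ≤ C := by rw [one_mul]; exact h _ ⟨hτ.1.le, hτ.2⟩)
  rw [intervalIntegral.integral_sub] at h
  · simpa [radialMean] using h
  · exact Continuous.intervalIntegrable (by fun_prop) _ _
  · exact Continuous.intervalIntegrable (by fun_prop) _ _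

theorem pow_mul_radialMean (m : ℕ) (f u : ℝ → ℝ) (r : ℝ) :
    r ^ (m + 1) * radialMean m f u r = ∫ t in (0 : ℝ)..r, t ^ m * f (u t) := by
  have h := intervalIntegral.mul_integral_comp_mul_left (a := 0) (b := 1)
    (f := fun t => t ^ m * f (u t)) r
  rw [mul_zero, mul_one] at h
  rw [← h, radialMean, pow_succ', mul_assoc, ← intervalIntegral.integral_const_mul]
  simp only [mul_pow, mul_assoc]

/-- The Picard map of the radial equation, conjugated by the weight `exp (L * r ^ 2)`. -/
noncomputable def weightedPicard (m : ℕ) (f : ℝ → ℝ) (L : ℝ) (w : ℝ → ℝ) (r : ℝ) : ℝ :=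
  exp (-(L * r ^ 2)) *
    (1 - ∫ s in (0 : ℝ)..|r|, s * radialMean m f (fun x => exp (L * x ^ 2) * w x) s)

theorem continuous_weightedPicard {m : ℕ} {f w : ℝ → ℝ} {L : ℝ} (hf : Continuous f)
    (hw : Continuous w) : Continuous (weightedPicard m f L w) := by
  have h1 : Continuous (radialMean m f (fun x => exp (L * x ^ 2) * w x)) :=
    continuous_radialMean hf (by fun_prop)
  have h2 : Continuous fun r : ℝ =>
      ∫ s in (0 : ℝ)..r, s * radialMean m f (fun x => exp (L * x ^ 2) * w x) s :=
    intervalIntegral.continuous_primitive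
      (fun a b => Continuous.intervalIntegrable (by fun_prop) a b) 0
  have h3 := h2.comp continuous_abs
  unfold weightedPicard
  exact Continuous.mul (by fun_prop) (continuous_const.sub h3)

theorem abs_weightedPicard_le {m : ℕ} {f w : ℝ → ℝ} {L M : ℝ} (hL : 0 < L)
    (hM : ∀ x, |f x| ≤ M) (r : ℝ) : |weightedPicard m f L w r| ≤ 1 + M / L := by
  have hM0 : 0 ≤ M := (abs_nonneg _).trans (hM 0)
  have h1 : |∫ s in (0 : ℝ)..|r|, s * radialMean m f (fun x => exp (L * x ^ 2) * w x) s|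
      ≤ M * r ^ 2 := by
    have h := intervalIntegral.norm_integral_le_of_norm_le_const (a := (0 : ℝ)) (b := |r|)
      (C := |r| * M) (f := fun s => s * radialMean m f (fun x => exp (L * x ^ 2) * w x) s)
      (fun s hs => by
        rw [Set.uIoc_of_le (abs_nonneg r)] at hs
        rw [norm_mul, norm_eq_abs, norm_eq_abs, abs_of_nonneg hs.1.le]
        exact mul_le_mul hs.2 (abs_radialMean_le hM s) (abs_nonneg _) (abs_nonneg _))
    rw [sub_zero, abs_abs, norm_eq_abs] at h
    calc _ ≤ |r| * M * |r| := h
      _ = M * |r| ^ 2 := by ring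
      _ = M * r ^ 2 := by rw [sq_abs]
  have h2 : 1 + M * r ^ 2 ≤ (1 + M / L) * exp (L * r ^ 2) := by
    have h3 : 1 + L * r ^ 2 ≤ exp (L * r ^ 2) := by linarith [add_one_le_exp (L * r ^ 2)]
    have h4 : 0 ≤ L * r ^ 2 := by positivity
    have h5 : M / L * (L * r ^ 2) = M * r ^ 2 := by field_simp
    have h6 : 0 ≤ M / L := by positivity
    nlinarith
  rw [weightedPicard, abs_mul, abs_of_pos (exp_pos _), exp_neg, inv_mul_le_iff₀ (exp_pos _)]
  calc _ ≤ |(1 : ℝ)| + |∫ s in (0 : ℝ)..|r|,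
        s * radialMean m f (fun x => exp (L * x ^ 2) * w x) s| := abs_sub _ _
    _ ≤ 1 + M * r ^ 2 := by rw [abs_one]; gcongr
    _ ≤ _ := by linarith

theorem abs_weightedPicard_sub_le {m : ℕ} {f v w : ℝ → ℝ} {L d : ℝ} (hL : 0 < L)
    (hf : Continuous f) (hfL : ∀ x y, |f x - f y| ≤ L * |x - y|) (hv : Continuous v)
    (hw : Continuous w) (hd : ∀ x, |v x - w x| ≤ d) (r : ℝ) :
    |weightedPicard m f L v r - weightedPicard m f L w r| ≤ d / 2 := by
  have hd0 : 0 ≤ d := (abs_nonneg _).trans (hd 0)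
  have hv' : Continuous fun x => exp (L * x ^ 2) * v x := by fun_prop
  have hw' : Continuous fun x => exp (L * x ^ 2) * w x := by fun_prop
  have cv := continuous_radialMean (m := m) hf hv'
  have cw := continuous_radialMean (m := m) hf hw'
  have key : ∀ s, 0 ≤ s → |s * radialMean m f (fun x => exp (L * x ^ 2) * w x) s -
      s * radialMean m f (fun x => exp (L * x ^ 2) * v x) s| ≤
      d / 2 * (exp (L * s ^ 2) * (L * (2 * s))) := by
    intro s hs
    rw [← mul_sub, abs_mul, abs_of_nonneg hs]
    have : |radialMean m f (fun x => exp (L * x ^ 2) * w x) s -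
        radialMean m f (fun x => exp (L * x ^ 2) * v x) s| ≤ L * (exp (L * s ^ 2) * d) := by
      refine abs_radialMean_sub_le hf hw' hv' fun τ hτ => (hfL _ _).trans ?_
      rw [← mul_sub, abs_mul, abs_of_pos (exp_pos _), abs_sub_comm]
      have : (s * τ) ^ 2 ≤ s ^ 2 := by
        rw [mul_pow]
        exact mul_le_of_le_one_right (sq_nonneg s) (pow_le_one₀ hτ.1 hτ.2)
      gcongr
      exact hd _
    calc _ ≤ s * (L * (exp (L * s ^ 2) * d)) := by gcongr
      _ = _ := by ring
  have hint : ∫ s in (0 : ℝ)..|r|, d / 2 * (exp (L * s ^ 2) * (L * (2 * s))) =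
      d / 2 * (exp (L * r ^ 2) - 1) := by
    rw [intervalIntegral.integral_const_mul,
      intervalIntegral.integral_eq_sub_of_hasDerivAt (f := fun s => exp (L * s ^ 2))]
    · simp
    · intro x _
      simpa using ((hasDerivAt_pow 2 x).const_mul L).exp
    · exact Continuous.intervalIntegrable (by fun_prop) _ _
  rw [weightedPicard, weightedPicard, ← mul_sub, abs_mul, abs_of_pos (exp_pos _), exp_neg,
    inv_mul_le_iff₀ (exp_pos _), sub_sub_sub_cancel_left, ← intervalIntegral.integral_sub]
  · have hle := intervalIntegral.norm_integral_le_of_norm_le (μ := volume) (abs_nonneg r)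
      (f := fun s => s * radialMean m f (fun x => exp (L * x ^ 2) * w x) s -
        s * radialMean m f (fun x => exp (L * x ^ 2) * v x) s)
      (g := fun s => d / 2 * (exp (L * s ^ 2) * (L * (2 * s))))
      (ae_of_all _ fun s hs => key s hs.1.le)
      (Continuous.intervalIntegrable (by fun_prop) _ _)
    rw [hint, norm_eq_abs] at hle
    nlinarith
  · exact Continuous.intervalIntegrable (by fun_prop) _ _
  · exact Continuous.intervalIntegrable (by fun_prop) _ _

theorem exists_radial_integral_equation (m : ℕ) {f : ℝ → ℝ} {L M : ℝ} (hL : 0 < L)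
    (hfL : ∀ x y, |f x - f y| ≤ L * |x - y|) (hM : ∀ x, |f x| ≤ M) :
    ∃ u : ℝ → ℝ, Continuous u ∧
      ∀ r, 0 ≤ r → u r = 1 - ∫ s in (0 : ℝ)..r, s * radialMean m f u s := by
  have hf : Continuous f :=
    (LipschitzWith.of_dist_le_mul (K := ⟨L, hL.le⟩) fun x y => hfL x y).continuous
  let T : BoundedContinuousFunction ℝ ℝ → BoundedContinuousFunction ℝ ℝ := fun w =>
    BoundedContinuousFunction.ofNormedAddCommGroup (weightedPicard m f L w)
      (continuous_weightedPicard hf w.continuous) (1 + M / L) (abs_weightedPicard_le hL hM)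
  have hT : ContractingWith (1 / 2) T := by
    refine ⟨by norm_num [← NNReal.coe_lt_coe], LipschitzWith.of_dist_le_mul fun v w => ?_⟩
    refine (BoundedContinuousFunction.dist_le (by positivity)).2 fun r => ?_
    refine (abs_weightedPicard_sub_le hL hf hfL v.continuous w.continuous
      (d := dist v w) (fun x => ?_) r).trans (le_of_eq ?_)
    · rw [← Real.dist_eq]; exact BoundedContinuousFunction.dist_coe_le_dist x
    · push_cast; ring
  set w := hT.fixedPoint
  have hw : T w = w := hT.fixedPoint_isFixedPt
  refine ⟨fun x => exp (L * x ^ 2) * w x, by have := w.continuous; fun_prop, fun r hr => ?_⟩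
  have h : weightedPicard m f L w r = w r := congrArg (fun g => g r) hw
  dsimp only
  rw [← h, weightedPicard, ← mul_assoc, ← exp_add, add_neg_cancel, exp_zero, one_mul,
    abs_of_nonneg hr]

/-- Global solvability of the radial initial value problem `u'' + (m / r) u' = -f u`, `u 0 = 1`,
`u' 0 = 0`, for bounded Lipschitz nonlinearities. -/
theorem exists_radial_solution (m : ℕ) {f : ℝ → ℝ} {L M : ℝ} (hL : 0 < L)
    (hfL : ∀ x y, |f x - f y| ≤ L * |x - y|) (hM : ∀ x, |f x| ≤ M) :
    ∃ U D : ℝ → ℝ, U 0 = 1 ∧ D 0 = 0 ∧ (∀ r, HasDerivAt U (D r) r) ∧ DifferentiableAt ℝ D 0 ∧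
      ∀ r, 0 < r → HasDerivAt D (-f (U r) - m / r * D r) r := by
  have hf : Continuous f :=
    (LipschitzWith.of_dist_le_mul (K := ⟨L, hL.le⟩) fun x y => hfL x y).continuous
  obtain ⟨u, hu, hint⟩ := exists_radial_integral_equation m hL hfL hM
  have hg := continuous_radialMean (m := m) hf hu
  refine ⟨fun r => 1 - ∫ s in (0 : ℝ)..r, s * radialMean m f u s,
    fun r => -(r * radialMean m f u r), by simp, by simp, fun r => ?_, ?_, fun r hr => ?_⟩
  · exact ((show Continuous fun s => s * radialMean m f u s by fun_prop).integral_hasStrictDerivAt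
      0 r).hasDerivAt.const_sub 1
  · refine HasDerivAt.differentiableAt (f' := -radialMean m f u 0) ?_
    refine HasDerivAt.fun_neg (hasDerivAt_iff_tendsto_slope.2 ?_)
    refine (hg.continuousAt.tendsto.mono_left nhdsWithin_le_nhds).congr' ?_
    filter_upwards [self_mem_nhdsWithin] with x hx
    have hx : x ≠ 0 := hx
    rw [slope_def_field]
    field_simp
    simp
  · dsimp only
    rw [← hint r hr.le]
    have hG := ((show Continuous fun t => t ^ m * f (u t) by fun_prop).integral_hasStrictDerivAt
      0 r).hasDerivAt
    have hq := (hG.fun_div (hasDerivAt_pow m r) (pow_ne_zero m hr.ne')).fun_neg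
    have hE : ∀ x : ℝ, 0 < x →
        -(x * radialMean m f u x) = -((∫ t in (0 : ℝ)..x, t ^ m * f (u t)) / x ^ m) := by
      intro x hx
      rw [← pow_mul_radialMean]
      rw [pow_succ']
      field_simp
    have hev : (fun r => -(r * radialMean m f u r)) =ᶠ[nhds r]
        fun x => -((∫ t in (0 : ℝ)..x, t ^ m * f (u t)) / x ^ m) := by
      filter_upwards [lt_mem_nhds hr] with x hx using hE x hx
    refine (hq.congr_of_eventuallyEq hev).congr_deriv ?_
    rw [hE r hr]
    rcases m with _ | k
    · simp
    · simp only [Nat.add_sub_cancel]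
      field_simp
      ring

theorem radial_derivative_neg {m : ℕ} {f U D : ℝ → ℝ} {R : ℝ} (hm : m ≠ 0)
    (hD0 : DifferentiableAt ℝ D 0)
    (hD : ∀ r, 0 < r → HasDerivAt D (-f (U r) - m / r * D r) r)
    (hf : ∀ r ∈ Set.Ioo 0 R, 0 < f (U r)) {r : ℝ} (hr : r ∈ Set.Ioc 0 R) : D r < 0 := by
  have hc : ContinuousOn (fun x => x ^ m * D x) (Set.Icc 0 R) := by
    refine (continuous_pow m).continuousOn.mul fun x hx => ?_
    rcases hx.1.eq_or_lt with rfl | h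
    · exact hD0.continuousAt.continuousWithinAt
    · exact (hD x h).continuousAt.continuousWithinAt
  have h := strictAntiOn_of_deriv_neg (convex_Icc 0 R) hc (fun x hx => by
    rw [interior_Icc] at hx
    have hx0 := hx.1
    have hd : HasDerivAt (fun x => x ^ m * D x) (-(x ^ m * f (U x))) x := by
      refine ((hasDerivAt_pow m x).fun_mul (hD x hx0)).congr_deriv ?_
      obtain ⟨k, rfl⟩ := Nat.exists_eq_succ_of_ne_zero hm
      simp only [Nat.succ_eq_add_one, Nat.add_sub_cancel]
      field_simp
      ring
    rw [hd.deriv, neg_lt_zero]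
    exact mul_pos (pow_pos hx0 m) (hf x hx))
  have h0 := h (Set.left_mem_Icc.2 (hr.1.le.trans hr.2)) (Set.Ioc_subset_Icc_self hr) hr.1
  simp only [zero_pow hm, zero_mul] at h0
  exact (mul_neg_iff.1 h0).elim (fun h => h.2) fun h => absurd h.1 (pow_pos hr.1 m).not_gt

theorem radial_le_initial {U D : ℝ → ℝ} {R : ℝ} (hU : ∀ r, HasDerivAt U (D r) r)
    (hD : ∀ r ∈ Set.Ioc 0 R, D r < 0) {r : ℝ} (hr : r ∈ Set.Icc 0 R) : U r ≤ U 0 := by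
  refine antitoneOn_of_deriv_nonpos (convex_Icc 0 R)
    (fun x _ => (hU x).continuousAt.continuousWithinAt)
    (fun x _ => (hU x).differentiableAt.differentiableWithinAt) (fun x hx => ?_)
    (Set.left_mem_Icc.2 (hr.1.trans hr.2)) hr hr.1
  rw [interior_Icc] at hx
  rw [(hU x).deriv]
  exact (hD x (Set.Ioo_subset_Ioc_self hx)).le

/-- The Pohozaev functional of the radial Lane–Emden equation `u'' + (m / r) u' = -c u ^ p` on a
profile `U` with derivative `D`. -/
noncomputable def pohozaev (m : ℕ) (c p : ℝ) (U D : ℝ → ℝ) (r : ℝ) : ℝ :=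
  r ^ (m + 1) * (D r ^ 2 / 2 + c * U r ^ (p + 1) / (p + 1)) +
    ((m : ℝ) - 1) / 2 * (r ^ m * (U r * D r))

theorem hasDerivAt_pohozaev {m : ℕ} {c p r : ℝ} {U D : ℝ → ℝ} (hm : m ≠ 0) (hp : 0 < p)
    (hr : 0 < r) (hUr : 0 < U r) (hU : HasDerivAt U (D r) r)
    (hD : HasDerivAt D (-(c * U r ^ p) - m / r * D r) r) :
    HasDerivAt (pohozaev m c p U D)
      (r ^ m * (c * U r ^ (p + 1)) * (((m : ℝ) + 1) / (p + 1) - ((m : ℝ) - 1) / 2)) r := by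
  have hp1 : p + 1 ≠ 0 := by positivity
  have h1 := hU.rpow_const (p := p + 1) (Or.inl hUr.ne')
  have h2 := (((hD.fun_pow 2).div_const 2).fun_add ((h1.const_mul c).div_const (p + 1)))
  have h3 := ((hasDerivAt_pow (m + 1) r).fun_mul h2).fun_add
    (((hasDerivAt_pow m r).fun_mul (hU.fun_mul hD)).const_mul (((m : ℝ) - 1) / 2))
  refine h3.congr_deriv ?_
  rw [add_sub_cancel_right, rpow_add_one hUr.ne']
  generalize U r ^ p = a
  obtain ⟨k, rfl⟩ := Nat.exists_eq_succ_of_ne_zero hm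
  simp only [Nat.succ_eq_add_one, Nat.add_sub_cancel]
  push_cast
  field_simp
  ring

theorem radial_pos {m : ℕ} {c p : ℝ} {f U D : ℝ → ℝ} (hm : 2 ≤ m) (hc : 0 < c) (hp : 0 < p)
    (hcrit : ((m : ℝ) + 1) / (p + 1) ≤ ((m : ℝ) - 1) / 2)
    (hfpos : ∀ x, 0 < x → 0 < f x) (hf : ∀ x ∈ Set.Ioc (0 : ℝ) 1, f x = c * x ^ p)
    (hU0 : U 0 = 1) (hU : ∀ r, HasDerivAt U (D r) r) (hD0 : DifferentiableAt ℝ D 0)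
    (hD : ∀ r, 0 < r → HasDerivAt D (-f (U r) - m / r * D r) r) {r : ℝ} (hr : 0 ≤ r) :
    0 < U r := by
  by_contra! hneg
  have hm0 : m ≠ 0 := by omega
  have hUc : Continuous U := continuous_iff_continuousAt.2 fun x => (hU x).continuousAt
  let S : Set ℝ := {x | 0 ≤ x ∧ U x ≤ 0}
  have hS : IsClosed S := isClosed_Ici.inter (isClosed_le hUc continuous_const)
  have hbdd : BddBelow S := ⟨0, fun x hx => hx.1⟩
  have hRS : sInf S ∈ S := hS.csInf_mem ⟨r, hr, hneg⟩ hbdd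
  set R := sInf S
  have hlt : ∀ x, 0 ≤ x → x < R → 0 < U x := fun x hx hxR => by
    by_contra! h
    exact hxR.not_ge (csInf_le hbdd ⟨hx, h⟩)
  have hUR : U R = 0 := by
    obtain ⟨x, hx, hUx⟩ := intermediate_value_Icc' hRS.1 hUc.continuousOn
      ⟨hRS.2, hU0.symm ▸ zero_le_one⟩
    rwa [← hx.2.antisymm (csInf_le hbdd ⟨hx.1, hUx.le⟩)]
  have hR : 0 < R := hRS.1.lt_of_ne fun h => by
    rw [← h, hU0] at hUR
    exact one_ne_zero hUR
  have hDneg : ∀ x ∈ Set.Ioc 0 R, D x < 0 := fun x hx =>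
    radial_derivative_neg hm0 hD0 hD (fun y hy => hfpos _ (hlt y hy.1.le hy.2)) hx
  have hDc : ContinuousOn D (Set.Icc 0 R) := fun x hx => by
    rcases hx.1.eq_or_lt with rfl | h
    · exact hD0.continuousAt.continuousWithinAt
    · exact (hD x h).continuousAt.continuousWithinAt
  have hPc : ContinuousOn (pohozaev m c p U D) (Set.Icc 0 R) := by
    have h1 : Continuous fun x => U x ^ (p + 1) := hUc.rpow_const fun _ => Or.inr (by positivity)
    have h2 := hUc.continuousOn (s := Set.Icc 0 R)
    have h3 := h1.continuousOn (s := Set.Icc 0 R)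
    unfold pohozaev
    fun_prop
  have hderiv : ∀ x ∈ Set.Ioo 0 R, HasDerivAt (pohozaev m c p U D)
      (x ^ m * (c * U x ^ (p + 1)) * (((m : ℝ) + 1) / (p + 1) - ((m : ℝ) - 1) / 2)) x := by
    intro x hx
    have hUx := hlt x hx.1.le hx.2
    have hUx1 : U x ≤ 1 := hU0 ▸ radial_le_initial hU hDneg (Set.Ioo_subset_Icc_self hx)
    refine hasDerivAt_pohozaev hm0 hp hx.1 hUx (hU x) ?_
    rw [← hf _ ⟨hUx, hUx1⟩]
    exact hD x hx.1
  have hanti := antitoneOn_of_deriv_nonpos (convex_Icc 0 R) hPc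
    (fun x hx => by
      rw [interior_Icc] at hx
      exact (hderiv x hx).differentiableAt.differentiableWithinAt)
    (fun x hx => by
      rw [interior_Icc] at hx
      rw [(hderiv x hx).deriv]
      have := hlt x hx.1.le hx.2
      have := hx.1
      exact mul_nonpos_of_nonneg_of_nonpos (by positivity) (sub_nonpos.2 hcrit))
  have hle := hanti (Set.left_mem_Icc.2 hR.le) (Set.right_mem_Icc.2 hR.le) hR.le
  have hp1 : p + 1 ≠ 0 := by positivity
  simp only [pohozaev, hUR, zero_rpow hp1, zero_pow hm0, zero_pow m.succ_ne_zero] at hle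
  have hDR := hDneg R ⟨hR, le_rfl⟩
  have : 0 < R ^ (m + 1) * (D R ^ 2 / 2) :=
    mul_pos (pow_pos hR _) (half_pos (sq_pos_of_neg hDR))
  simp at hle
  linarith

theorem abs_rpow_clamp_sub_le {p : ℝ} (hp : 1 ≤ p) (x y : ℝ) :
    |max 0 (min x 1) ^ p - max 0 (min y 1) ^ p| ≤ p * |x - y| := by
  have hmem : ∀ z : ℝ, max 0 (min z 1) ∈ Set.Icc (0 : ℝ) 1 := fun z =>
    ⟨le_max_left _ _, max_le zero_le_one (min_le_right _ _)⟩
  have h := (convex_Icc (0 : ℝ) 1).norm_image_sub_le_of_norm_hasDerivWithin_le (C := p)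
    (f := fun z : ℝ => z ^ p) (f' := fun z => p * z ^ (p - 1))
    (fun z _ => (hasDerivAt_rpow_const (Or.inr hp)).hasDerivWithinAt)
    (fun z hz => by
      have h0 : 0 ≤ z ^ (p - 1) := rpow_nonneg hz.1 _
      have h1 : z ^ (p - 1) ≤ 1 := rpow_le_one hz.1 hz.2 (by linarith)
      rw [norm_eq_abs, abs_of_nonneg (by positivity)]
      nlinarith) (hmem y) (hmem x)
  have hclamp : |max 0 (min x 1) - max 0 (min y 1)| ≤ |x - y| :=
    calc |max 0 (min x 1) - max 0 (min y 1)| ≤ |min x 1 - min y 1| := by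
          simpa [max_comm] using abs_max_sub_max_le_abs (min x 1) (min y 1) 0
      _ ≤ |x - y| := by simpa using abs_min_sub_min_le_max x 1 y 1
  exact h.trans (mul_le_mul_of_nonneg_left hclamp (zero_le_one.trans hp))

/-- The radial Lane–Emden equation has a global positive solution in the critical and
supercritical range. -/
theorem exists_pos_radial_laneEmden {m : ℕ} {c p : ℝ} (hm : 2 ≤ m) (hc : 0 < c) (hp : 1 ≤ p)
    (hcrit : ((m : ℝ) + 1) / (p + 1) ≤ ((m : ℝ) - 1) / 2) :
    ∃ U D : ℝ → ℝ, U 0 = 1 ∧ D 0 = 0 ∧ (∀ r, HasDerivAt U (D r) r) ∧ DifferentiableAt ℝ D 0 ∧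
      (∀ r, 0 < r → HasDerivAt D (-(c * U r ^ p) - m / r * D r) r) ∧ ∀ r, 0 ≤ r → 0 < U r := by
  have hp0 : 0 < p := one_pos.trans_le hp
  have hmem : ∀ z : ℝ, max 0 (min z 1) ∈ Set.Icc (0 : ℝ) 1 := fun z =>
    ⟨le_max_left _ _, max_le zero_le_one (min_le_right _ _)⟩
  let f : ℝ → ℝ := fun x => c * max 0 (min x 1) ^ p
  have hfL : ∀ x y, |f x - f y| ≤ c * p * |x - y| := fun x y => by
    rw [← mul_sub, abs_mul, abs_of_pos hc, mul_assoc]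
    gcongr
    exact abs_rpow_clamp_sub_le hp x y
  have hM : ∀ x, |f x| ≤ c := fun x => by
    have h0 := rpow_nonneg (hmem x).1 p
    rw [abs_of_nonneg (mul_nonneg hc.le h0)]
    exact mul_le_of_le_one_right hc.le (rpow_le_one (hmem x).1 (hmem x).2 hp0.le)
  have hfpos : ∀ x, 0 < x → 0 < f x := fun x hx =>
    mul_pos hc (rpow_pos_of_pos (lt_max_of_lt_right (lt_min hx one_pos)) p)
  have hf : ∀ x ∈ Set.Ioc (0 : ℝ) 1, f x = c * x ^ p := fun x hx => by
    simp only [f, min_eq_left hx.2, max_eq_right hx.1.le]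
  obtain ⟨U, D, hU0, hDz, hU, hD0, hD⟩ := exists_radial_solution m (mul_pos hc hp0) hfL hM
  have hpos : ∀ r, 0 ≤ r → 0 < U r := fun r hr =>
    radial_pos hm hc hp0 hcrit hfpos hf hU0 hU hD0 hD hr
  refine ⟨U, D, hU0, hDz, hU, hD0, fun r hr => ?_, hpos⟩
  have hDneg : ∀ x ∈ Set.Ioc 0 r, D x < 0 := fun x hx =>
    radial_derivative_neg (by omega) hD0 hD (fun y hy => hfpos _ (hpos y hy.1.le)) hx
  have hle : U r ≤ 1 := hU0 ▸ radial_le_initial hU hDneg ⟨hr.le, le_rfl⟩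
  rw [← hf _ ⟨hpos r hr.le, hle⟩]
  exact hD r hr

theorem stmt_17 (n : ℕ) (hn : 3 ≤ n) (p : ℝ)
    (hp : max 2 (((n : ℝ) + 2) / ((n : ℝ) - 2)) ≤ p) :
    ∃ (a : ℝ) (U V : ℝ → ℝ), 0 < a ∧
      (∀ r : ℝ, 0 ≤ r → 0 < U r) ∧ (∀ r : ℝ, 0 ≤ r → 0 < V r) ∧
      U 0 = 1 ∧ V 0 = a ∧ deriv U 0 = 0 ∧ deriv V 0 = 0 ∧
      (∀ r : ℝ, 0 ≤ r → DifferentiableAt ℝ U r ∧ DifferentiableAt ℝ (deriv U) r ∧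
        DifferentiableAt ℝ V r ∧ DifferentiableAt ℝ (deriv V) r) ∧
      (∀ r : ℝ, 0 < r →
        -(deriv (deriv U) r + ((n : ℝ) - 1) / r * deriv U r) =
          Real.sqrt p * U r ^ (p - 1) * V r) ∧
      (∀ r : ℝ, 0 < r →
        -(deriv (deriv V) r + ((n : ℝ) - 1) / r * deriv V r) =
          Real.sqrt p * U r ^ p) := by
  obtain ⟨m, rfl⟩ : ∃ m, n = m + 1 := ⟨n - 1, by omega⟩
  have hp2 : 2 ≤ p := (le_max_left _ _).trans hp
  have hpn := (le_max_right _ _).trans hp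
  have hm : (2 : ℝ) ≤ m := by exact_mod_cast Nat.le_of_succ_le_succ hn
  have hcrit : ((m : ℝ) + 1) / (p + 1) ≤ ((m : ℝ) - 1) / 2 := by
    push_cast at hpn
    rw [div_le_iff₀ (by linarith)] at hpn
    rw [div_le_div_iff₀ (by linarith) two_pos]
    linarith
  obtain ⟨U, D, hU0, hDz, hU, hD0, hD, hpos⟩ := exists_pos_radial_laneEmden
    (Nat.le_of_succ_le_succ hn) (sqrt_pos.2 (by linarith : 0 < p)) (by linarith) hcrit
  have hUD : deriv U = D := funext fun r => (hU r).deriv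
  have hdiff : ∀ r : ℝ, 0 ≤ r → DifferentiableAt ℝ U r ∧ DifferentiableAt ℝ (deriv U) r := by
    intro r hr
    rw [hUD]
    rcases hr.eq_or_lt with rfl | h
    · exact ⟨(hU 0).differentiableAt, hD0⟩
    · exact ⟨(hU r).differentiableAt, (hD r h).differentiableAt⟩
  have hode : ∀ r : ℝ, 0 < r →
      -(deriv (deriv U) r + (((m + 1 : ℕ) : ℝ) - 1) / r * deriv U r) = √p * U r ^ p := by
    intro r hr
    rw [hUD, (hD r hr).deriv]
    push_cast
    ring
  refine ⟨1, U, U, one_pos, hpos, hpos, hU0, hU0, by rw [hUD, hDz], by rw [hUD, hDz],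
    fun r hr => ⟨(hdiff r hr).1, (hdiff r hr).2, hdiff r hr⟩, fun r hr => ?_, hode⟩
  rw [hode r hr, mul_assoc, ← rpow_add_one (hpos r hr.le).ne', sub_add_cancel]
end

section
/- Let n ≥ 3 and p > 1, and let U, V : [0, ∞) → (0, ∞) be C² functions satisfying −(r^{n−1} U'(r))' = √p · r^{n−1} U(r)^{p−1} V(r) and −(r^{n−1} V'(r))' = √p · r^{n−1} U(r)^p for r > 0, with U(r) → 0 and V(r) → 0 as r → ∞. Then U(r) = V(r) for all r ≥ 0. -/
open MeasureTheory Real Filter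

theorem differentiableAt_pow_mul_deriv {m : ℕ} {F : ℝ → ℝ} (hF : ContDiffOn ℝ 2 F (Set.Ici 0))
    {r : ℝ} (hr : 0 < r) : DifferentiableAt ℝ (fun s => s ^ m * deriv F s) r := by
  have h1 : ContDiffOn ℝ 1 (deriv F) (Set.Ioi 0) :=
    (hF.mono Set.Ioi_subset_Ici_self).deriv_of_isOpen isOpen_Ioi (by norm_num)
  have h2 : DifferentiableAt ℝ (deriv F) r :=
    (h1.contDiffAt (Ioi_mem_nhds hr)).differentiableAt (by norm_num)
  fun_prop

/-- A function that is `C²` on `[0, ∞)`, tends to `0` at infinity, and whose radial Laplacian has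
the same sign as the function itself vanishes identically. -/
theorem eq_zero_of_mul_radial_laplacian_nonneg {m : ℕ} (hm : m ≠ 0) {W : ℝ → ℝ}
    (hW : ContDiffOn ℝ 2 W (Set.Ici 0))
    (hsign : ∀ r : ℝ, 0 < r → 0 ≤ W r * deriv (fun s => s ^ m * deriv W s) r)
    (hlim : Tendsto W atTop (nhds 0)) {r : ℝ} (hr : 0 ≤ r) : W r = 0 := by
  have hW' : ContinuousOn (derivWithin W (Set.Ici 0)) (Set.Ici 0) :=
    hW.continuousOn_derivWithin (uniqueDiffOn_Ici 0) (by norm_num)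
  have hdW : ∀ s : ℝ, 0 < s → HasDerivAt W (deriv W s) s := fun s hs =>
    ((hW.contDiffAt (Ici_mem_nhds hs)).differentiableAt (by norm_num)).hasDerivAt
  have hwithin : ∀ s : ℝ, 0 < s → derivWithin W (Set.Ici 0) s = deriv W s := fun s hs =>
    derivWithin_of_mem_nhds (Ici_mem_nhds hs)
  -- The flux `s ^ m * W s * W' s` of `W ^ 2 / 2` is monotone and vanishes at the origin.
  have hflux : MonotoneOn (fun s => W s * (s ^ m * derivWithin W (Set.Ici 0) s)) (Set.Ici 0) := by
    have hderiv : ∀ s : ℝ, 0 < s →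
        HasDerivAt (fun s => W s * (s ^ m * derivWithin W (Set.Ici 0) s))
          (deriv W s * (s ^ m * deriv W s) + W s * deriv (fun s => s ^ m * deriv W s) s) s := by
      intro s hs
      refine ((hdW s hs).mul (differentiableAt_pow_mul_deriv hW hs).hasDerivAt).congr_of_eventuallyEq ?_
      filter_upwards [Ioi_mem_nhds hs] with t ht
      simp [hwithin t ht]
    refine monotoneOn_of_deriv_nonneg (convex_Ici 0)
      (hW.continuousOn.mul ((continuous_pow m).continuousOn.mul hW')) ?_ ?_
    · rw [interior_Ici]
      exact fun s hs => (hderiv s hs).differentiableAt.differentiableWithinAt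
    · rw [interior_Ici]
      intro s hs
      rw [(hderiv s hs).deriv]
      have hs' : 0 < s := hs
      have h1 : 0 ≤ s ^ m * (deriv W s) ^ 2 := by positivity
      linarith [hsign s hs]
  have hnonneg : ∀ s : ℝ, 0 < s → 0 ≤ W s * deriv W s := by
    intro s hs
    have h1 := hflux Set.self_mem_Ici hs.le hs.le
    simp only [zero_pow hm, zero_mul, mul_zero, hwithin s hs] at h1
    refine nonneg_of_mul_nonneg_right (a := s ^ m) ?_ (pow_pos hs m)
    linarith
  have hmono : MonotoneOn (fun s => W s ^ 2) (Set.Ici 0) := by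
    refine monotoneOn_of_deriv_nonneg (convex_Ici 0) (hW.continuousOn.pow 2) ?_ ?_
    · rw [interior_Ici]
      exact fun s hs => ((hdW s hs).pow 2).differentiableAt.differentiableWithinAt
    · rw [interior_Ici]
      intro s hs
      rw [((hdW s hs).fun_pow 2).deriv]
      have := hnonneg s hs
      push_cast
      linarith
  have hle : W r ^ 2 ≤ 0 := by
    have hsq : Tendsto (fun s => W s ^ 2) atTop (nhds 0) := by simpa using hlim.pow 2
    refine ge_of_tendsto hsq ?_
    filter_upwards [eventually_ge_atTop r] with s hs
    exact hmono hr (hr.trans hs) hs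
  exact pow_eq_zero_iff two_ne_zero |>.mp (le_antisymm hle (sq_nonneg _))

theorem stmt_19 (n : ℕ) (hn : 3 ≤ n) (p : ℝ) (hp : 1 < p) (U V : ℝ → ℝ)
    (hUsmooth : ContDiffOn ℝ 2 U (Set.Ici 0)) (hVsmooth : ContDiffOn ℝ 2 V (Set.Ici 0))
    (hUpos : ∀ r : ℝ, 0 ≤ r → 0 < U r) (hVpos : ∀ r : ℝ, 0 ≤ r → 0 < V r)
    (hUeq : ∀ r : ℝ, 0 < r →
      -deriv (fun s => s ^ ((n : ℕ) - 1) * deriv U s) r =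
        Real.sqrt p * r ^ ((n : ℕ) - 1) * U r ^ (p - 1) * V r)
    (hVeq : ∀ r : ℝ, 0 < r →
      -deriv (fun s => s ^ ((n : ℕ) - 1) * deriv V s) r =
        Real.sqrt p * r ^ ((n : ℕ) - 1) * U r ^ p)
    (hUlim : Tendsto U atTop (nhds 0)) (hVlim : Tendsto V atTop (nhds 0)) :
    ∀ r : ℝ, 0 ≤ r → U r = V r := by
  have hdiff : ∀ F : ℝ → ℝ, ContDiffOn ℝ 2 F (Set.Ici 0) → ∀ r : ℝ, 0 < r →
      DifferentiableAt ℝ F r := fun F hF r hr =>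
    (hF.contDiffAt (Ici_mem_nhds hr)).differentiableAt (by norm_num)
  intro r hr
  refine sub_eq_zero.mp (eq_zero_of_mul_radial_laplacian_nonneg (m := n - 1)
    (W := fun s => U s - V s) (by omega) (hUsmooth.sub hVsmooth) ?_ (by simpa using hUlim.sub hVlim)
    hr)
  intro s hs
  have hflux : (fun t => t ^ (n - 1) * deriv (fun x => U x - V x) t) =ᶠ[nhds s]
      fun t => t ^ (n - 1) * deriv U t - t ^ (n - 1) * deriv V t := by
    filter_upwards [Ioi_mem_nhds hs] with t ht
    rw [deriv_fun_sub (hdiff U hUsmooth t ht) (hdiff V hVsmooth t ht), mul_sub]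
  rw [hflux.deriv_eq, deriv_fun_sub (differentiableAt_pow_mul_deriv hUsmooth hs)
    (differentiableAt_pow_mul_deriv hVsmooth hs)]
  have hU := hUpos s hs.le
  have hpow : U s ^ p = U s ^ (p - 1) * U s := by
    rw [Real.rpow_sub_one hU.ne', div_mul_cancel₀ _ hU.ne']
  have hVs := hVeq s hs
  rw [hpow] at hVs
  calc 0 ≤ √p * s ^ (n - 1) * U s ^ (p - 1) * (U s - V s) ^ 2 := by positivity
    _ = _ := by linear_combination (U s - V s) * (hUeq s hs - hVs)
end
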